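/- For every K > 0 there exists c > 0 such that for every p ∈ ℕ and every real λ ∈ [0, K] with dist(λ, Σ) > c·p^{-1/4}, there exists δ > 0 such that ‖(H_p − λ)u‖_{L²(ℝ^{2n}, |g|^{1/2}dZ)} ≥ δ‖u‖_{L²(ℝ^{2n}, |g|^{1/2}dZ)} for every u ∈ C_c^∞(ℝ^{2n}, ℂ). (This expresses that the spectrum of the self-adjoint closure of H_p intersected with [0,K] is contained in the c·p^{-1/4}-neighborhood of Σ.) -/

import Mathlib

open MeasureTheory Matrix Polynomial

noncomputable section

/-- Complex partial derivative `∂_j u` on `ℝ^{2n}`. -/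
def pd {n : ℕ} (j : Fin (2*n)) (u : (Fin (2*n) → ℝ) → ℂ) (Z : Fin (2*n) → ℝ) : ℂ :=
  fderiv ℝ u Z (Pi.single j 1)

/-- Real partial derivative `∂_j f` on `ℝ^{2n}`. -/
def pdR {n : ℕ} (j : Fin (2*n)) (f : (Fin (2*n) → ℝ) → ℝ) (Z : Fin (2*n) → ℝ) : ℝ :=
  fderiv ℝ f Z (Pi.single j 1)

/-- The magnetic derivative `(i∂_j + p A_j)u`. -/
def mg {n : ℕ} (A : Fin (2*n) → (Fin (2*n) → ℝ) → ℝ) (p : ℕ) (j : Fin (2*n))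
    (u : (Fin (2*n) → ℝ) → ℂ) (Z : Fin (2*n) → ℝ) : ℂ :=
  Complex.I * pd j u Z + (p : ℂ) * ((A j Z : ℝ) : ℂ) * u Z

/-- The magnetic field `B_{jk} = ∂_j A_k − ∂_k A_j`. -/
def Bfield {n : ℕ} (A : Fin (2*n) → (Fin (2*n) → ℝ) → ℝ) (Z : Fin (2*n) → ℝ) :
    Matrix (Fin (2*n)) (Fin (2*n)) ℝ :=
  fun j k => pdR j (A k) Z - pdR k (A j) Z

/-- The Bochner–Schrödinger operator
`H_p u = (1/p)|g|^{-1/2} Σ_{j,ℓ} (i∂_j + pA_j)[|g|^{1/2} g^{jℓ} (i∂_ℓ + pA_ℓ)u] + V u`. -/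
def Hop {n : ℕ} (g : (Fin (2*n) → ℝ) → Matrix (Fin (2*n)) (Fin (2*n)) ℝ)
    (A : Fin (2*n) → (Fin (2*n) → ℝ) → ℝ) (V : (Fin (2*n) → ℝ) → ℝ) (p : ℕ)
    (u : (Fin (2*n) → ℝ) → ℂ) (Z : Fin (2*n) → ℝ) : ℂ :=
  (1 / (p : ℂ)) * (((Real.sqrt (g Z).det : ℝ) : ℂ))⁻¹ *
    ∑ j, ∑ l, mg A p j
      (fun W => ((Real.sqrt (g W).det : ℝ) : ℂ) * (((g W)⁻¹ j l : ℝ) : ℂ) * mg A p l u W) Z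
  + ((V Z : ℝ) : ℂ) * u Z

/-- The weighted `L²`-norm `‖u‖_{L²(ℝ^{2n}, |g|^{1/2}dZ)}`. -/
def l2g {n : ℕ} (g : (Fin (2*n) → ℝ) → Matrix (Fin (2*n)) (Fin (2*n)) ℝ)
    (u : (Fin (2*n) → ℝ) → ℂ) : ℝ :=
  Real.sqrt (∫ Z, ‖u Z‖ ^ 2 * Real.sqrt (g Z).det)

section DenseRange

variable {E : Type*} [NormedAddCommGroup E] [InnerProductSpace ℂ E]

/-- A linear map whose range approximates every vector up to a fixed ratio `ρ < 1` has dense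
range. -/
theorem denseRange_of_approx (A : E →ₗ[ℂ] E) {ρ : ℝ} (hρ0 : 0 ≤ ρ) (hρ : ρ < 1)
    (h : ∀ g, ∃ w, ‖A w - g‖ ≤ ρ * ‖g‖) : DenseRange A := by
  have key : ∀ (k : ℕ) g, ∃ w, ‖A w - g‖ ≤ ρ ^ k * ‖g‖ := by
    intro k
    induction k with
    | zero => intro g; exact ⟨0, by simp⟩
    | succ k ih =>
      intro g
      obtain ⟨w, hw⟩ := ih g
      obtain ⟨w', hw'⟩ := h (g - A w)
      refine ⟨w + w', ?_⟩
      have : A (w + w') - g = A w' - (g - A w) := by rw [map_add]; abel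
      rw [this]
      calc _ ≤ ρ * ‖g - A w‖ := hw'
        _ = ρ * ‖A w - g‖ := by rw [norm_sub_rev]
        _ ≤ ρ * (ρ ^ k * ‖g‖) := by gcongr
        _ = _ := by ring
  intro g
  rw [Metric.mem_closure_range_iff]
  intro ε hε
  have : Filter.Tendsto (fun k : ℕ => ρ ^ k * ‖g‖) Filter.atTop (nhds (0 * ‖g‖)) :=
    (tendsto_pow_atTop_nhds_zero_of_lt_one hρ0 hρ).mul_const _
  rw [zero_mul] at this
  obtain ⟨k, hk⟩ := (this.eventually (gt_mem_nhds hε)).exists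
  obtain ⟨w, hw⟩ := key k g
  exact ⟨w, by rw [dist_comm, dist_eq_norm]; exact hw.trans_lt hk⟩

theorem DenseRange.exists_norm_sub_le {A : E →ₗ[ℂ] E} (hA : DenseRange A) {ρ : ℝ} (hρ : 0 < ρ)
    (g : E) : ∃ w, ‖A w - g‖ ≤ ρ * ‖g‖ := by
  by_cases hg : g = 0
  · exact ⟨0, by simp [hg]⟩
  · have : 0 < ρ * ‖g‖ := mul_pos hρ (norm_pos_iff.2 hg)
    obtain ⟨w, hw⟩ := hA.exists_dist_lt g this
    exact ⟨w, by rw [norm_sub_rev, ← dist_eq_norm]; exact hw.le⟩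

/-- Bounded perturbations preserve density of the range far from the spectrum. -/
theorem denseRange_perturb (S M : E →ₗ[ℂ] E) {C T : ℝ}
    (hM : ∀ x, ‖M x‖ ≤ C * ‖x‖) (hT : 2 * C ≤ T) (hS : ∀ x, T * ‖x‖ ≤ ‖S x‖)
    (hd : DenseRange S) : DenseRange (S + M) := by
  refine denseRange_of_approx (S + M) (ρ := 3 / 4) (by norm_num) (by norm_num) fun g => ?_
  obtain ⟨w, hw⟩ := hd.exists_norm_sub_le (ρ := 1 / 8) (by norm_num) g
  refine ⟨w, ?_⟩
  have h1 : ‖S w‖ ≤ 9 / 8 * ‖g‖ := by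
    have := norm_add_le (S w - g) g
    rw [sub_add_cancel] at this
    linarith
  have h2 : ‖M w‖ ≤ 9 / 16 * ‖g‖ := by
    have := hM w
    have h3 := hS w
    nlinarith [norm_nonneg w]
  calc ‖(S + M) w - g‖ = ‖(S w - g) + M w‖ := by rw [LinearMap.add_apply]; congr 1; abel
    _ ≤ ‖S w - g‖ + ‖M w‖ := norm_add_le _ _
    _ ≤ _ := by linarith [norm_nonneg g]

theorem denseRange_of_orthogonal_completion (A : E →ₗ[ℂ] E)
    (h : ∀ G : UniformSpace.Completion E,
      (∀ w, inner ℂ G ((A w : E) : UniformSpace.Completion E) = 0) → G = 0) : DenseRange A := by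
  let R : Submodule ℂ (UniformSpace.Completion E) :=
    LinearMap.range ((UniformSpace.Completion.toComplL (𝕜 := ℂ) (E := E)).toLinearMap ∘ₗ A)
  have hR : R.topologicalClosure = ⊤ := by
    rw [Submodule.topologicalClosure_eq_top_iff, Submodule.eq_bot_iff]
    intro G hG
    apply h
    intro w
    rw [Submodule.mem_orthogonal'] at hG
    exact hG _ ⟨w, rfl⟩
  intro g
  rw [Metric.mem_closure_range_iff]
  intro ε hε
  have hg : (g : UniformSpace.Completion E) ∈ R.topologicalClosure := by rw [hR]; trivial
  rw [← SetLike.mem_coe, Submodule.topologicalClosure_coe, Metric.mem_closure_iff] at hg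
  obtain ⟨_, ⟨w, rfl⟩, hw⟩ := hg ε hε
  refine ⟨w, ?_⟩
  simpa using hw

/-- For a symmetric operator with dense range after one shift, a lower bound at a real point
implies density of the range at that point. -/
theorem denseRange_sub_of_lower_bound (S : E →ₗ[ℂ] E)
    (hsymm : ∀ x y, inner ℂ (S x) y = inner ℂ x (S y)) {T ν q : ℝ} (hT : 0 < T)
    (hTb : ∀ x, T * ‖x‖ ≤ ‖S x + (T : ℂ) • x‖)
    (hd : DenseRange (S + (T : ℂ) • (LinearMap.id : E →ₗ[ℂ] E)))
    (hq : 0 < q) (hν : ∀ x, q * ‖x‖ ≤ ‖S x - (ν : ℂ) • x‖) :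
    DenseRange (S - (ν : ℂ) • (LinearMap.id : E →ₗ[ℂ] E)) := by
  apply denseRange_of_orthogonal_completion
  intro G hG
  let c : E → UniformSpace.Completion E := fun x => x
  have hc : ∀ x y, inner ℂ (c x) (c y) = inner ℂ x y := fun x y =>
    UniformSpace.Completion.inner_coe x y
  have cadd : ∀ x y, c (x + y) = c x + c y := fun x y => UniformSpace.Completion.coe_add x y
  have csub : ∀ x y, c (x - y) = c x - c y := fun x y => UniformSpace.Completion.coe_sub x y
  have csmul : ∀ (z : ℂ) x, c (z • x) = z • c x := fun z x => UniformSpace.Completion.coe_smul z x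
  have cnorm : ∀ x, ‖c x‖ = ‖x‖ := fun x => UniformSpace.Completion.norm_coe x
  let P : E →ₗ[ℂ] E := S + (T : ℂ) • (LinearMap.id : E →ₗ[ℂ] E)
  have hPa : ∀ x, P x = S x + (T : ℂ) • x := fun x => by simp [P]
  have hdense : DenseRange (fun x => c (P x)) :=
    (UniformSpace.Completion.denseRange_coe).comp hd
      (UniformSpace.Completion.continuous_coe E)
  have happ : ∀ k : ℕ, ∃ w, dist G (c (P w)) < 1 / ((k : ℝ) + 1) := fun k =>
    hdense.exists_dist_lt G (by positivity)
  choose w hw using happ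
  have hlim : Filter.Tendsto (fun k => c (P (w k))) Filter.atTop (nhds G) := by
    rw [tendsto_iff_dist_tendsto_zero]
    refine squeeze_zero (fun _ => dist_nonneg) (fun k => ?_)
      tendsto_one_div_add_atTop_nhds_zero_nat
    rw [dist_comm]; exact (hw k).le
  have hcau : CauchySeq (fun k => c (w k)) := by
    have h1 := hlim.cauchySeq
    rw [Metric.cauchySeq_iff] at h1 ⊢
    intro ε hε
    obtain ⟨N, hN⟩ := h1 (T * ε) (by positivity)
    refine ⟨N, fun m hm k hk => ?_⟩
    have h2 := hN m hm k hk
    rw [dist_eq_norm, ← csub, cnorm, ← map_sub, hPa] at h2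
    rw [dist_eq_norm, ← csub, cnorm]
    have := hTb (w m - w k)
    nlinarith
  obtain ⟨h, hh⟩ := cauchySeq_tendsto_of_complete hcau
  have e1 : ∀ x, inner ℂ h (c (P x)) = inner ℂ G (c x) := by
    intro x
    have t1 : Filter.Tendsto (fun k => inner ℂ (c (w k)) (c (P x))) Filter.atTop
        (nhds (inner ℂ h (c (P x)))) := hh.inner tendsto_const_nhds
    have t2 : Filter.Tendsto (fun k => inner ℂ (c (P (w k))) (c x)) Filter.atTop
        (nhds (inner ℂ G (c x))) := hlim.inner tendsto_const_nhds
    have t3 : (fun k => inner ℂ (c (w k)) (c (P x))) = fun k => inner ℂ (c (P (w k))) (c x) := by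
      funext k
      rw [hc, hc, hPa, hPa, inner_add_left, inner_add_right, hsymm, inner_smul_left,
        inner_smul_right]
      simp
    rw [t3] at t1
    exact tendsto_nhds_unique t1 t2
  have e2 : G = ((T : ℂ) + ν) • h := by
    rw [← sub_eq_zero]
    have : ∀ y : UniformSpace.Completion E, inner ℂ (G - ((T : ℂ) + ν) • h) y = 0 := by
      intro y
      have hcl : IsClosed {y : UniformSpace.Completion E |
          inner ℂ (G - ((T : ℂ) + ν) • h) y = 0} :=
        isClosed_eq (by fun_prop) continuous_const
      have : closure (Set.range fun x => c (P x)) ⊆ {y : UniformSpace.Completion E |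
          inner ℂ (G - ((T : ℂ) + ν) • h) y = 0} := by
        refine closure_minimal ?_ hcl
        rintro _ ⟨x, rfl⟩
        have h0 := hG x
        have h1 : ((S - (ν : ℂ) • (LinearMap.id : E →ₗ[ℂ] E)) x : E) = P x - ((T : ℂ) + ν) • x := by
          rw [hPa]; simp [add_smul]; abel
        rw [h1] at h0
        change inner ℂ G (c _) = 0 at h0
        rw [csub, csmul, inner_sub_right, inner_smul_right, ← e1 x] at h0
        change inner ℂ _ (c (P x)) = 0
        rw [inner_sub_left, inner_smul_left]
        simpa using h0
      exact this (by rw [hdense.closure_eq]; trivial)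
    exact inner_self_eq_zero.1 (this _)
  have e3 : Filter.Tendsto (fun k => c (S (w k) - (ν : ℂ) • w k)) Filter.atTop (nhds 0) := by
    have : Filter.Tendsto (fun k => c (P (w k)) - ((T : ℂ) + ν) • c (w k)) Filter.atTop
        (nhds (G - ((T : ℂ) + ν) • h)) := hlim.sub (hh.const_smul _)
    rw [← e2, sub_self] at this
    refine this.congr fun k => ?_
    rw [← csmul, ← csub, hPa, add_smul]
    congr 1; abel
  have e4 : h = 0 := by
    have t1 := e3.norm
    have t2 := hh.norm
    rw [norm_zero] at t1
    have : q * ‖h‖ ≤ 0 := by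
      refine le_of_tendsto_of_tendsto' (t2.const_mul q) t1 fun k => ?_
      rw [cnorm, cnorm]; exact hν _
    have h5 : ‖h‖ ≤ 0 := by nlinarith [norm_nonneg h]
    exact norm_le_zero_iff.1 h5
  rw [e2, e4, smul_zero]

end DenseRange

section Ladder

universe w

/-- Approximate annihilation operators `b j` with formal adjoints `b' j` satisfying the
canonical commutation relations with frequencies `2 a j` up to errors of size `η`. -/
structure IsLadder {n : ℕ} {E : Type w} [NormedAddCommGroup E] [InnerProductSpace ℂ E]
    (a : Fin n → ℝ) (η : ℝ) (b b' : Fin n → E →ₗ[ℂ] E) : Prop where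
  adj : ∀ j x y, inner ℂ (b j x) y = inner ℂ x (b' j y)
  comm_adj : ∀ j k x,
    ‖b j (b' k x) - b' k (b j x) - (if j = k then ((2 * a j : ℝ) : ℂ) else 0) • x‖ ≤ η * ‖x‖
  comm : ∀ j k x, ‖b j (b k x) - b k (b j x)‖ ≤ η * ‖x‖

/-- The number operator `∑ j, b' j b j`. -/
def numberOp {n : ℕ} {E : Type w} [NormedAddCommGroup E] [InnerProductSpace ℂ E]
    (b b' : Fin n → E →ₗ[ℂ] E) : E →ₗ[ℂ] E := ∑ j, b' j ∘ₗ b j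

variable {n : ℕ} {E : Type w} [NormedAddCommGroup E] [InnerProductSpace ℂ E]
  {a : Fin n → ℝ} {η : ℝ} {b b' : Fin n → E →ₗ[ℂ] E}

theorem numberOp_apply (b b' : Fin n → E →ₗ[ℂ] E) (x : E) :
    numberOp b b' x = ∑ j, b' j (b j x) := by simp [numberOp]

theorem re_inner_self (x : E) : (inner ℂ x x).re = ‖x‖ ^ 2 := inner_self_eq_norm_sq (𝕜 := ℂ) x

namespace IsLadder

theorem adj' (h : IsLadder a η b b') (j : Fin n) (x y : E) :
    inner ℂ (b' j x) y = inner ℂ x (b j y) := by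
  rw [← inner_conj_symm, ← h.adj, inner_conj_symm]

theorem inner_numberOp_right (h : IsLadder a η b b') (x y : E) :
    inner ℂ x (numberOp b b' y) = ∑ j, inner ℂ (b j x) (b j y) := by
  rw [numberOp_apply, inner_sum]
  exact Finset.sum_congr rfl fun j _ => (h.adj j _ _).symm

theorem inner_numberOp_left (h : IsLadder a η b b') (x y : E) :
    inner ℂ (numberOp b b' x) y = ∑ j, inner ℂ (b j x) (b j y) := by
  rw [numberOp_apply, sum_inner]
  exact Finset.sum_congr rfl fun j _ => h.adj' j _ _

theorem numberOp_symm (h : IsLadder a η b b') (x y : E) :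
    inner ℂ (numberOp b b' x) y = inner ℂ x (numberOp b b' y) := by
  rw [h.inner_numberOp_left, h.inner_numberOp_right]

theorem re_inner_numberOp (h : IsLadder a η b b') (x : E) :
    (inner ℂ (numberOp b b' x) x).re = ∑ j, ‖b j x‖ ^ 2 := by
  rw [h.inner_numberOp_left, Complex.re_sum]
  refine Finset.sum_congr rfl fun j _ => ?_
  exact re_inner_self _

theorem re_inner_sub (h : IsLadder a η b b') (ν : ℝ) (x : E) :
    (inner ℂ (numberOp b b' x - (ν : ℂ) • x) x).re = ∑ j, ‖b j x‖ ^ 2 - ν * ‖x‖ ^ 2 := by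
  rw [inner_sub_left, Complex.sub_re, h.re_inner_numberOp, inner_smul_left,
    Complex.conj_ofReal, Complex.re_ofReal_mul, re_inner_self]

theorem norm_adj_sq_le (h : IsLadder a η b b') (j : Fin n) (x : E) :
    ‖b' j x‖ ^ 2 ≤ ‖b j x‖ ^ 2 + (2 * a j + η) * ‖x‖ ^ 2 := by
  have h1 : inner ℂ (b' j x) (b' j x) = inner ℂ
      (b j (b' j x) - b' j (b j x) - (if j = j then ((2 * a j : ℝ) : ℂ) else 0) • x) x
      + inner ℂ (b j x) (b j x) + ((2 * a j : ℝ) : ℂ) * inner ℂ x x := by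
    rw [if_pos rfl, inner_sub_left, inner_sub_left, inner_smul_left, h.adj' j (b j x) x,
      h.adj j (b' j x) x, Complex.conj_ofReal]
    ring
  have h2 := congrArg Complex.re h1
  rw [Complex.add_re, Complex.add_re, Complex.re_ofReal_mul] at h2
  simp only [re_inner_self, ↓reduceIte] at h2
  have h3 := (Complex.re_le_norm _).trans (norm_inner_le_norm (𝕜 := ℂ)
    (b j (b' j x) - b' j (b j x) - (if j = j then ((2 * a j : ℝ) : ℂ) else 0) • x) x)
  have h4 := mul_le_mul_of_nonneg_right (h.comm_adj j j x) (norm_nonneg x)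
  simp only [↓reduceIte] at h3 h4
  nlinarith

theorem mul_norm_le (h : IsLadder a η b b') {ν q : ℝ} (hν : ν ≤ -q) (x : E) :
    q * ‖x‖ ≤ ‖numberOp b b' x - (ν : ℂ) • x‖ := by
  have h1 := h.re_inner_sub ν x
  have h2 : (inner ℂ (numberOp b b' x - (ν : ℂ) • x) x).re
      ≤ ‖numberOp b b' x - (ν : ℂ) • x‖ * ‖x‖ :=
    (Complex.re_le_norm _).trans (norm_inner_le_norm _ _)
  have h3 : 0 ≤ ∑ j, ‖b j x‖ ^ 2 := Finset.sum_nonneg fun _ _ => sq_nonneg _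
  rcases (norm_nonneg x).eq_or_lt with h0 | h0
  · rw [← h0]; simp
  · have : (q * ‖x‖) * ‖x‖ ≤ ‖numberOp b b' x - (ν : ℂ) • x‖ * ‖x‖ := by nlinarith
    exact le_of_mul_le_mul_right this h0

theorem inner_shift (h : IsLadder a η b b') (ν : ℝ) (j : Fin n) (v w : E) :
    inner ℂ (b j v) (numberOp b b' w - ((ν - 2 * a j : ℝ) : ℂ) • w) =
      inner ℂ (numberOp b b' v - (ν : ℂ) • v) (b' j w)
      + ∑ k, inner ℂ (b k (b j v) - b j (b k v)) (b k w)
      - ∑ k, inner ℂ (b k v)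
        (b k (b' j w) - b' j (b k w) - (if k = j then ((2 * a k : ℝ) : ℂ) else 0) • w) := by
  have h1 : ∑ k, inner ℂ (b k v) ((if k = j then ((2 * a k : ℝ) : ℂ) else 0) • w)
      = ((2 * a j : ℝ) : ℂ) * inner ℂ (b j v) w := by
    rw [Finset.sum_eq_single j]
    · rw [if_pos rfl, inner_smul_right]
    · intro k _ hk; rw [if_neg hk, zero_smul, inner_zero_right]
    · simp
  simp only [inner_sub_right, inner_sub_left, Finset.sum_sub_distrib, h1]
  rw [h.inner_numberOp_right, h.inner_numberOp_left, inner_smul_left, inner_smul_right]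
  have h2 : ∑ k, inner ℂ (b k v) (b' j (b k w)) = ∑ k, inner ℂ (b j (b k v)) (b k w) :=
    Finset.sum_congr rfl fun k _ => (h.adj j _ _).symm
  rw [h2, ← h.adj]
  push_cast
  simp only [Complex.conj_ofReal]
  ring

theorem norm_lower_le (h : IsLadder a η b b') {b₀ K' M : ℝ} (hb₀ : 0 < b₀)
    (ha : ∀ j, 0 ≤ a j) (hM : 0 ≤ M) (hMK : 2 * (2 * b₀ + K') ≤ M ^ 2) (hη : 0 ≤ η) (hηb : η ≤ b₀) {ν q : ℝ}
    (hq : 0 < q) (hqb : q ≤ b₀) (hν : 0 < ν) (hνK : ν ≤ K') (hηq : 2 * n ^ 2 * η ≤ q / 4)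
    (hlow : ∀ j x, q * ‖x‖ ≤ ‖numberOp b b' x - ((ν - 2 * a j : ℝ) : ℂ) • x‖)
    (hdense : ∀ j, DenseRange
      (numberOp b b' - ((ν - 2 * a j : ℝ) : ℂ) • (LinearMap.id : E →ₗ[ℂ] E))) (v : E) :
    q * Real.sqrt (∑ j, ‖b j v‖ ^ 2) ≤
      2 * n ^ 2 * M * (‖numberOp b b' v - (ν : ℂ) • v‖ + η * ‖v‖) := by
  set f := numberOp b b' v - (ν : ℂ) • v
  set G := Real.sqrt (∑ j, ‖b j v‖ ^ 2) with hG
  have hG0 : 0 ≤ G := Real.sqrt_nonneg _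
  have hS0 : 0 ≤ ∑ j, ‖b j v‖ ^ 2 := Finset.sum_nonneg fun _ _ => sq_nonneg _
  have hG2 : G ^ 2 = ∑ j, ‖b j v‖ ^ 2 := Real.sq_sqrt hS0
  have hgG : ∀ j, ‖b j v‖ ≤ G := fun j => by
    refine Real.le_sqrt_of_sq_le ?_
    exact Finset.single_le_sum (f := fun j => ‖b j v‖ ^ 2) (fun _ _ => sq_nonneg _)
      (Finset.mem_univ j)
  have hw : ∀ j, ∃ w, ‖numberOp b b' w - ((ν - 2 * a j : ℝ) : ℂ) • w - b j v‖
      ≤ 1 / 4 * ‖b j v‖ := fun j => by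
    obtain ⟨w, hw⟩ := (hdense j).exists_norm_sub_le (ρ := 1 / 4) (by norm_num) (b j v)
    exact ⟨w, by simpa using hw⟩
  choose w hw using hw
  have hFw : ∀ j, ‖numberOp b b' (w j) - ((ν - 2 * a j : ℝ) : ℂ) • w j‖ ≤ 5 / 4 * G := fun j => by
    have h1 := norm_add_le (numberOp b b' (w j) - ((ν - 2 * a j : ℝ) : ℂ) • w j - b j v) (b j v)
    rw [sub_add_cancel] at h1
    linarith [hw j, hgG j]
  have hwn : ∀ j, q * ‖w j‖ ≤ 5 / 4 * G := fun j => (hlow j _).trans (hFw j)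
  have hQ : ∀ j, (∑ k, ‖b k (w j)‖ ^ 2 + (2 * a j + η) * ‖w j‖ ^ 2) * q ^ 2 ≤ (M * G) ^ 2 := by
    intro j
    have h1 := h.re_inner_sub (ν - 2 * a j) (w j)
    have h2 := (Complex.re_le_norm _).trans (norm_inner_le_norm (𝕜 := ℂ)
      (numberOp b b' (w j) - ((ν - 2 * a j : ℝ) : ℂ) • w j) (w j))
    rw [h1] at h2
    have h3 := mul_le_mul_of_nonneg_right (hFw j) (norm_nonneg (w j))
    have h4 : ∑ k, ‖b k (w j)‖ ^ 2 + (2 * a j + η) * ‖w j‖ ^ 2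
        ≤ 5 / 4 * G * ‖w j‖ + (K' + b₀) * ‖w j‖ ^ 2 := by
      nlinarith [sq_nonneg ‖w j‖]
    have h5 : (q * ‖w j‖) ^ 2 ≤ (5 / 4 * G) ^ 2 :=
      pow_le_pow_left₀ (by positivity) (hwn j) 2
    have h6 : q * (G * (q * ‖w j‖)) ≤ b₀ * (G * (5 / 4 * G)) := by
      have := hwn j; gcongr
    have hK0 : 0 ≤ K' + b₀ := by linarith
    calc _ ≤ (5 / 4 * G * ‖w j‖ + (K' + b₀) * ‖w j‖ ^ 2) * q ^ 2 := by gcongr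
      _ = 5 / 4 * (q * (G * (q * ‖w j‖))) + (K' + b₀) * (q * ‖w j‖) ^ 2 := by ring
      _ ≤ 5 / 4 * (b₀ * (G * (5 / 4 * G))) + (K' + b₀) * (5 / 4 * G) ^ 2 := by gcongr
      _ = 25 / 16 * (2 * b₀ + K') * G ^ 2 := by ring
      _ ≤ M ^ 2 * G ^ 2 := by
        have : 25 / 16 * (2 * b₀ + K') ≤ M ^ 2 := by nlinarith
        gcongr
      _ = _ := by ring
  have hbw : ∀ j k, ‖b k (w j)‖ * q ≤ M * G := by
    intro j k
    refine le_of_sq_le_sq ?_ (by positivity)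
    refine le_trans ?_ (hQ j)
    rw [mul_pow]
    gcongr
    have h1 := Finset.single_le_sum (f := fun k => ‖b k (w j)‖ ^ 2) (fun _ _ => sq_nonneg _)
      (Finset.mem_univ k)
    have h2 : 0 ≤ (2 * a j + η) * ‖w j‖ ^ 2 := by have := ha j; positivity
    linarith
  have hb'w : ∀ j, ‖b' j (w j)‖ * q ≤ M * G := by
    intro j
    refine le_of_sq_le_sq ?_ (by positivity)
    refine le_trans ?_ (hQ j)
    rw [mul_pow]
    gcongr
    have h1 := Finset.single_le_sum (f := fun k => ‖b k (w j)‖ ^ 2) (fun _ _ => sq_nonneg _)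
      (Finset.mem_univ j)
    linarith [h.norm_adj_sq_le j (w j)]
  have hj : ∀ j, 3 / 4 * ‖b j v‖ ^ 2 * q ≤
      M * G * ‖f‖ + n * (η * ‖v‖ * (M * G)) + n * (2 * η * G ^ 2) := by
    intro j
    have e := congrArg Complex.re (h.inner_shift ν j v (w j))
    have l1 : 3 / 4 * ‖b j v‖ ^ 2 ≤
        (inner ℂ (b j v) (numberOp b b' (w j) - ((ν - 2 * a j : ℝ) : ℂ) • w j)).re := by
      have t : inner ℂ (b j v) (numberOp b b' (w j) - ((ν - 2 * a j : ℝ) : ℂ) • w j) =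
          inner ℂ (b j v) (numberOp b b' (w j) - ((ν - 2 * a j : ℝ) : ℂ) • w j - b j v)
          + inner ℂ (b j v) (b j v) := by rw [← inner_add_right, sub_add_cancel]
      rw [t, Complex.add_re]
      have t1 := (Complex.abs_re_le_norm _).trans (norm_inner_le_norm (𝕜 := ℂ) (b j v)
        (numberOp b b' (w j) - ((ν - 2 * a j : ℝ) : ℂ) • w j - b j v))
      have t2 := mul_le_mul_of_nonneg_left (hw j) (norm_nonneg (b j v))
      have t3 : (inner ℂ (b j v) (b j v)).re = ‖b j v‖ ^ 2 := re_inner_self _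
      rw [t3]
      have := (abs_le.1 t1).1
      nlinarith
    have l2 : (inner ℂ f (b' j (w j))).re * q ≤ M * G * ‖f‖ := by
      have t1 := (Complex.re_le_norm _).trans (norm_inner_le_norm (𝕜 := ℂ) f (b' j (w j)))
      calc _ ≤ ‖f‖ * ‖b' j (w j)‖ * q := by gcongr
        _ = ‖f‖ * (‖b' j (w j)‖ * q) := by ring
        _ ≤ ‖f‖ * (M * G) := mul_le_mul_of_nonneg_left (hb'w j) (norm_nonneg f)
        _ = _ := by ring
    have l3 : (∑ k, inner ℂ (b k (b j v) - b j (b k v)) (b k (w j))).re * q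
        ≤ n * (η * ‖v‖ * (M * G)) := by
      rw [Complex.re_sum, Finset.sum_mul]
      refine (Finset.sum_le_card_nsmul _ _ (η * ‖v‖ * (M * G)) fun k _ => ?_).trans (by simp)
      have t1 := (Complex.re_le_norm _).trans (norm_inner_le_norm (𝕜 := ℂ)
        (b k (b j v) - b j (b k v)) (b k (w j)))
      calc _ ≤ ‖b k (b j v) - b j (b k v)‖ * ‖b k (w j)‖ * q := by gcongr
        _ = ‖b k (b j v) - b j (b k v)‖ * (‖b k (w j)‖ * q) := by ring
        _ ≤ (η * ‖v‖) * (M * G) :=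
          mul_le_mul (h.comm k j v) (hbw j k) (by positivity) (by positivity)
    have l4 : -(∑ k, inner ℂ (b k v)
        (b k (b' j (w j)) - b' j (b k (w j)) -
          (if k = j then ((2 * a k : ℝ) : ℂ) else 0) • w j)).re * q ≤ n * (2 * η * G ^ 2) := by
      rw [Complex.re_sum, ← Finset.sum_neg_distrib, Finset.sum_mul]
      refine (Finset.sum_le_card_nsmul _ _ (2 * η * G ^ 2) fun k _ => ?_).trans (by simp)
      have t1 := (neg_le_abs _).trans ((Complex.abs_re_le_norm _).trans
        (norm_inner_le_norm (𝕜 := ℂ) (b k v) (b k (b' j (w j)) - b' j (b k (w j)) -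
          (if k = j then ((2 * a k : ℝ) : ℂ) else 0) • w j)))
      have t2 := hgG k
      have t3 := h.comm_adj k j (w j)
      have t4 := hwn j
      calc _ ≤ ‖b k v‖ * ‖b k (b' j (w j)) - b' j (b k (w j)) -
            (if k = j then ((2 * a k : ℝ) : ℂ) else 0) • w j‖ * q := by gcongr
        _ ≤ G * (η * ‖w j‖) * q := by gcongr
        _ = η * G * (q * ‖w j‖) := by ring
        _ ≤ η * G * (5 / 4 * G) := by gcongr
        _ ≤ _ := by nlinarith [mul_nonneg hη (sq_nonneg G)]
    rw [Complex.sub_re, Complex.add_re] at e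
    rw [e] at l1
    have := mul_le_mul_of_nonneg_right l1 hq.le
    linarith
  have hsum : 3 / 4 * G ^ 2 * q ≤
      n * (M * G * ‖f‖ + n * (η * ‖v‖ * (M * G)) + n * (2 * η * G ^ 2)) := by
    have := Finset.sum_le_sum fun j (_ : j ∈ Finset.univ) => hj j
    rw [← Finset.sum_mul, ← Finset.mul_sum, ← hG2] at this
    simpa [mul_add] using this
  have hn : (n : ℝ) ≤ n ^ 2 := by exact_mod_cast Nat.le_self_pow two_ne_zero n
  rcases hG0.eq_or_lt with h0 | h0
  · rw [← h0]; simp; positivity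
  · have h1 : n * (M * G * ‖f‖) ≤ n ^ 2 * (M * G * ‖f‖) := by gcongr
    have h2 : 2 * n ^ 2 * η * G ^ 2 ≤ q / 4 * G ^ 2 := by gcongr
    have : (q * G) * G ≤ (2 * n ^ 2 * M * (‖f‖ + η * ‖v‖)) * G := by nlinarith
    exact le_of_mul_le_mul_right this h0

set_option maxHeartbeats 800000 in
/-- Away from the Landau levels `∑ 2 k_j a_j`, the number operator of an approximate ladder is
bounded below by a fixed multiple of the distance. -/
theorem exists_gap (n : ℕ) (b₀ K' : ℝ) (hb₀ : 0 < b₀) (m : ℕ) :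
    ∃ θ : ℝ, 0 < θ ∧ θ ≤ 1 ∧
      ∀ (E : Type w) [NormedAddCommGroup E] [InnerProductSpace ℂ E] (a : Fin n → ℝ) (η : ℝ)
        (b b' : Fin n → E →ₗ[ℂ] E), IsLadder a η b b' → (∀ j, b₀ ≤ a j) →
        (∃ T : ℝ, 0 < T ∧ DenseRange (numberOp b b' + (T : ℂ) • (LinearMap.id : E →ₗ[ℂ] E))) →
        ∀ d ν : ℝ, 0 < d → d ≤ b₀ → 0 ≤ η → η ≤ θ * d → ν ≤ K' → ν ≤ 2 * b₀ * m →
        (∀ k : Fin n → ℕ, d ≤ |ν - ∑ j, 2 * (k j : ℝ) * a j|) →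
        ∀ v, θ * d * ‖v‖ ≤ ‖numberOp b b' v - (ν : ℂ) • v‖ := by
  induction m with
  | zero =>
    refine ⟨1, one_pos, le_rfl, ?_⟩
    intro E _ _ a η b b' h ha _ d ν hd hdb hη hηd hνK hν hk v
    rw [one_mul]
    refine h.mul_norm_le ?_ v
    have := hk 0
    simp only [Nat.cast_zero, mul_zero] at hν
    simp only [Pi.zero_apply, Nat.cast_zero, mul_zero, zero_mul, Finset.sum_const_zero, sub_zero,
      abs_of_nonpos hν] at this
    linarith
  | succ m ih =>
    obtain ⟨θ, hθ0, hθ1, ih⟩ := ih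
    set M := 2 * (2 * b₀ + |K'|) + 1 with hM
    have hM1 : 1 ≤ M := by have := abs_nonneg K'; linarith
    set c := 2 * (n : ℝ) ^ 2 * M with hc
    have hc0 : 0 ≤ c := by positivity
    set s := min (min (1 / 4) θ) (min (θ * min 1 b₀ / (8 * (n ^ 2 + 1)))
      (b₀ * θ ^ 2 / (16 * (c ^ 2 + 1)))) with hs
    have hs0 : 0 < s := by positivity
    have hs1 : s ≤ 1 / 4 := (min_le_left _ _).trans (min_le_left _ _)
    have hs2 : s ≤ θ := (min_le_left _ _).trans (min_le_right _ _)
    have hs3 : s * (8 * (n ^ 2 + 1)) ≤ θ := by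
      have h1 : s ≤ θ * min 1 b₀ / (8 * (n ^ 2 + 1)) := (min_le_right _ _).trans (min_le_left _ _)
      rw [le_div_iff₀ (by positivity)] at h1
      exact h1.trans (by nlinarith [min_le_left 1 b₀])
    have hs4 : s * (16 * (c ^ 2 + 1)) ≤ b₀ * θ ^ 2 := by
      have h1 : s ≤ b₀ * θ ^ 2 / (16 * (c ^ 2 + 1)) := (min_le_right _ _).trans (min_le_right _ _)
      rwa [le_div_iff₀ (by positivity)] at h1
    refine ⟨s, hs0, by linarith, ?_⟩
    intro E _ _ a η b b' h ha hT d ν hd hdb hη hηd hνK hν hk v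
    have hk0 := hk 0
    simp only [Pi.zero_apply, Nat.cast_zero, mul_zero, zero_mul, Finset.sum_const_zero,
      sub_zero] at hk0
    rcases le_or_gt ν 0 with hν0 | hν0
    · rw [abs_of_nonpos hν0] at hk0
      refine h.mul_norm_le ?_ v
      nlinarith
    rw [abs_of_pos hν0] at hk0
    have hη2 : η ≤ θ * d := hηd.trans (by gcongr)
    have hηb : η ≤ b₀ := hη2.trans (by nlinarith)
    have hdense : ∀ q : ℝ, 0 < q →
        (∀ j x, q * ‖x‖ ≤ ‖numberOp b b' x - ((ν - 2 * a j : ℝ) : ℂ) • x‖) → ∀ j,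
        DenseRange (numberOp b b' - ((ν - 2 * a j : ℝ) : ℂ) • (LinearMap.id : E →ₗ[ℂ] E)) := by
      intro q hq hlow j
      obtain ⟨T, hT0, hT⟩ := hT
      refine denseRange_sub_of_lower_bound _ h.numberOp_symm hT0 (fun x => ?_) hT hq (hlow j)
      have := h.mul_norm_le (ν := -T) (q := T) le_rfl x
      simpa using this
    by_contra hcon
    push Not at hcon
    set f := numberOp b b' v - (ν : ℂ) • v with hf
    set G := Real.sqrt (∑ j, ‖b j v‖ ^ 2) with hG
    have hG0 : 0 ≤ G := Real.sqrt_nonneg _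
    have hG2 : G ^ 2 = ∑ j, ‖b j v‖ ^ 2 :=
      Real.sq_sqrt (Finset.sum_nonneg fun _ _ => sq_nonneg _)
    have hv : 0 < ‖v‖ := by
      by_contra hv
      have : ‖v‖ = 0 := le_antisymm (not_lt.1 hv) (norm_nonneg v)
      rw [this, mul_zero] at hcon
      exact absurd hcon (not_lt.2 (norm_nonneg _))
    have hen : ν * ‖v‖ ^ 2 ≤ G ^ 2 + ‖f‖ * ‖v‖ := by
      have h1 := h.re_inner_sub ν v
      have h2 := (neg_le_abs _).trans ((Complex.abs_re_le_norm _).trans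
        (norm_inner_le_norm (𝕜 := ℂ) f v))
      rw [h1] at h2
      rw [hG2]; linarith
    have hMK : 2 * (2 * b₀ + K') ≤ M ^ 2 := by nlinarith [le_abs_self K']
    have hfη : ‖f‖ + η * ‖v‖ ≤ 2 * s * d * ‖v‖ := by nlinarith
    have hf2 : ‖f‖ * ‖v‖ ≤ s * d * ‖v‖ ^ 2 := by nlinarith
    have hsc : s * (4 * c ^ 2) ≤ b₀ * θ ^ 2 / 4 := by linarith [hs4, hs0]
    have hθ2 : b₀ * θ ^ 2 ≤ b₀ := mul_le_of_le_one_right hb₀.le (pow_le_one₀ hθ0.le hθ1)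
    rcases le_or_gt ν b₀ with hνb | hνb
    · have hlow : ∀ j x, b₀ * ‖x‖ ≤ ‖numberOp b b' x - ((ν - 2 * a j : ℝ) : ℂ) • x‖ :=
        fun j x => h.mul_norm_le (by linarith [ha j]) x
      have key := h.norm_lower_le hb₀ (fun j => hb₀.le.trans (ha j)) (by linarith) hMK hη hηb hb₀
        le_rfl hν0 hνK (by
          have : 8 * (n : ℝ) ^ 2 * η ≤ (s * (8 * n ^ 2)) * d := by
            calc _ ≤ 8 * (n : ℝ) ^ 2 * (s * d) := by gcongr
              _ = _ := by ring
          have h2 : (s * (8 * n ^ 2)) * d ≤ 1 * b₀ := by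
            gcongr; linarith
          linarith) hlow (hdense b₀ hb₀ hlow) v
      have k2 : b₀ * G ≤ c * (2 * s * d * ‖v‖) := key.trans (by gcongr)
      have k3 : (b₀ * G) ^ 2 ≤ (c * (2 * s * d * ‖v‖)) ^ 2 :=
        pow_le_pow_left₀ (by positivity) k2 2
      have k4 : b₀ ^ 2 * G ^ 2 ≤ b₀ ^ 2 * (d / 4 * ‖v‖ ^ 2) := by
        calc b₀ ^ 2 * G ^ 2 ≤ (c * (2 * s * d * ‖v‖)) ^ 2 := by linarith
          _ = (s * (4 * c ^ 2)) * (s * d * (d * ‖v‖ ^ 2)) := by ring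
          _ ≤ b₀ * (1 / 4 * b₀ * (d * ‖v‖ ^ 2)) := by
            have : s * (4 * c ^ 2) ≤ b₀ := by linarith
            have : s * d ≤ 1 / 4 * b₀ := by gcongr
            gcongr
          _ = _ := by ring
      have k5 : G ^ 2 ≤ d / 4 * ‖v‖ ^ 2 := le_of_mul_le_mul_left k4 (by positivity)
      have : 0 < d * ‖v‖ ^ 2 := by positivity
      have k6 := mul_le_mul_of_nonneg_right hk0 (sq_nonneg ‖v‖)
      have k7 : s * d * ‖v‖ ^ 2 ≤ 1 / 4 * d * ‖v‖ ^ 2 := by gcongr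
      linarith
    · have hlow : ∀ j x, θ * d * ‖x‖ ≤ ‖numberOp b b' x - ((ν - 2 * a j : ℝ) : ℂ) • x‖ := by
        intro j
        refine ih E a η b b' h ha hT d (ν - 2 * a j) hd hdb hη hη2 ?_ ?_ ?_
        · linarith [ha j]
        · push_cast at hν; linarith [ha j]
        · intro k
          have := hk (k + Pi.single j 1)
          convert this using 2
          have : ∀ i, (((k + Pi.single j 1 : Fin n → ℕ) i : ℕ) : ℝ) =
              k i + if i = j then 1 else 0 := fun i => by
            rw [Pi.add_apply, Pi.single_apply]; push_cast; rfl
          simp only [this, mul_add, add_mul, Finset.sum_add_distrib]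
          simp
          ring
      have hq0 : 0 < θ * d := by positivity
      have key := h.norm_lower_le hb₀ (fun j => hb₀.le.trans (ha j)) (by linarith) hMK hη hηb hq0
        (by nlinarith) hν0 hνK (by
          have : 8 * (n : ℝ) ^ 2 * η ≤ (s * (8 * n ^ 2)) * d := by
            calc _ ≤ 8 * (n : ℝ) ^ 2 * (s * d) := by gcongr
              _ = _ := by ring
          have h2 : (s * (8 * n ^ 2)) * d ≤ θ * d := by
            gcongr; linarith
          linarith) hlow (hdense _ hq0 hlow) v
      have k2 : θ * d * G ≤ c * (2 * s * d * ‖v‖) := key.trans (by gcongr)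
      have k3 : (θ * d * G) ^ 2 ≤ (c * (2 * s * d * ‖v‖)) ^ 2 :=
        pow_le_pow_left₀ (by positivity) k2 2
      have k4 : (θ * d) ^ 2 * G ^ 2 ≤ (θ * d) ^ 2 * (b₀ / 4 * ‖v‖ ^ 2) := by
        calc (θ * d) ^ 2 * G ^ 2 ≤ (c * (2 * s * d * ‖v‖)) ^ 2 := by linarith
          _ = (s * (4 * c ^ 2)) * (s * d ^ 2 * ‖v‖ ^ 2) := by ring
          _ ≤ (b₀ * θ ^ 2) * (1 / 4 * d ^ 2 * ‖v‖ ^ 2) := by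
            have : 0 ≤ b₀ * θ ^ 2 := by positivity
            have : s * (4 * c ^ 2) ≤ b₀ * θ ^ 2 := by linarith
            gcongr
          _ = _ := by ring
      have k5 : G ^ 2 ≤ b₀ / 4 * ‖v‖ ^ 2 := le_of_mul_le_mul_left k4 (by positivity)
      have k6 : 0 < ‖v‖ ^ 2 := by positivity
      have k7 : s * d * ‖v‖ ^ 2 ≤ 1 / 4 * b₀ * ‖v‖ ^ 2 := by gcongr
      have k8 := mul_lt_mul_of_pos_right hνb k6
      have k9 : 0 < b₀ * ‖v‖ ^ 2 := by positivity
      linarith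

end IsLadder

end Ladder

section RealFrame

universe w

variable {E : Type w} [NormedAddCommGroup E] [InnerProductSpace ℂ E]

/-- Complex combinations of a real frame of operators. -/
def frameComb {ι : Type} [Fintype ι] (c : ι → ℂ) (e : ι → E →ₗ[ℂ] E) : E →ₗ[ℂ] E :=
  ∑ k, c k • e k

theorem frameComb_apply {ι : Type} [Fintype ι] (c : ι → ℂ) (e : ι → E →ₗ[ℂ] E) (x : E) :
    frameComb c e x = ∑ k, c k • e k x := by simp [frameComb]

theorem frameComb_frameComb {ι : Type} [Fintype ι] (c c' : ι → ℂ) (e : ι → E →ₗ[ℂ] E) (x : E) :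
    frameComb c e (frameComb c' e x) = ∑ k, ∑ m, (c k * c' m) • e k (e m x) := by
  simp only [frameComb_apply, map_sum, map_smul, Finset.smul_sum, smul_smul]
  rw [Finset.sum_comm]
  simp only [mul_comm]

theorem norm_frameComb_comm_le {ι : Type} [Fintype ι] {c c' : ι → ℂ} {e : ι → E →ₗ[ℂ] E}
    {K : Matrix ι ι ℝ} {η : ℝ} {s : ℂ}
    (hcomm : ∀ j k x, ‖e j (e k x) - e k (e j x) - (Complex.I * (K j k : ℂ)) • x‖ ≤ η * ‖x‖)
    (hc : ∀ k, ‖c k‖ ≤ 2) (hc' : ∀ k, ‖c' k‖ ≤ 2)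
    (hs : ∑ k, ∑ m, c k * c' m * (Complex.I * (K k m : ℂ)) = s) (x : E) :
    ‖frameComb c e (frameComb c' e x) - frameComb c' e (frameComb c e x) - s • x‖
      ≤ 4 * (Fintype.card ι) ^ 2 * η * ‖x‖ := by
  have h1 : frameComb c e (frameComb c' e x) - frameComb c' e (frameComb c e x) - s • x =
      ∑ k, ∑ m, (c k * c' m) • (e k (e m x) - e m (e k x) - (Complex.I * (K k m : ℂ)) • x) := by
    rw [frameComb_frameComb, frameComb_frameComb, Finset.sum_comm (f := fun k m =>
      (c' k * c m) • e k (e m x)), ← hs]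
    simp only [smul_sub, Finset.sum_sub_distrib, Finset.sum_smul, smul_smul, mul_comm (c' _) (c _)]
  rw [h1]
  have h2 : ∀ k m, ‖(c k * c' m) • (e k (e m x) - e m (e k x) - (Complex.I * (K k m : ℂ)) • x)‖
      ≤ 4 * (η * ‖x‖) := fun k m => by
    rw [norm_smul, norm_mul]
    have := mul_le_mul (hc k) (hc' m) (norm_nonneg _) (by norm_num)
    exact mul_le_mul (by linarith) (hcomm k m x) (norm_nonneg _) (by norm_num)
  refine (norm_sum_le_of_le _ fun k _ => norm_sum_le_of_le _ fun m _ => h2 k m).trans ?_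
  simp
  exact le_of_eq (by ring)

/-- Coefficients diagonalising a constant antisymmetric form `K` into `n` oscillators with
frequencies `a j`. -/
structure IsDiagonalizing {n : ℕ} {ι : Type} [Fintype ι] [DecidableEq ι] (K : Matrix ι ι ℝ)
    (a : Fin n → ℝ) (w : Fin n → ι → ℂ) : Prop where
  complete : ∀ k m, ∑ j, (w j k * star (w j m) + star (w j k) * w j m) = if k = m then 1 else 0
  diag : ∀ j l, ∑ k, ∑ m, star (w j k) * w l m * (Complex.I * (K k m : ℂ)) =
    if j = l then (a j : ℂ) else 0
  null : ∀ j l, ∑ k, ∑ m, star (w j k) * star (w l m) * (Complex.I * (K k m : ℂ)) = 0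
  le_one : ∀ j k, ‖w j k‖ ≤ 1

theorem exists_gap_frame (n : ℕ) (ι : Type) [Fintype ι] [DecidableEq ι] (b₀ K' : ℝ)
    (hb₀ : 0 < b₀) :
    ∃ θ : ℝ, 0 < θ ∧ θ ≤ 1 ∧
      ∀ (E : Type w) [NormedAddCommGroup E] [InnerProductSpace ℂ E] (a : Fin n → ℝ) (η : ℝ)
        (K : Matrix ι ι ℝ) (w : Fin n → ι → ℂ) (e : ι → E →ₗ[ℂ] E), IsDiagonalizing K a w →
        (∀ k x y, inner ℂ (e k x) y = inner ℂ x (e k y)) →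
        (∀ j k x, ‖e j (e k x) - e k (e j x) - (Complex.I * (K j k : ℂ)) • x‖ ≤ η * ‖x‖) →
        (∀ j, b₀ ≤ a j) →
        (∃ T₀ : ℝ, ∀ T : ℝ, T₀ ≤ T →
          DenseRange (∑ k, e k ∘ₗ e k + (T : ℂ) • (LinearMap.id : E →ₗ[ℂ] E))) →
        ∀ d μ : ℝ, 0 < d → d ≤ b₀ → 0 ≤ η → η ≤ θ * d → μ ≤ K' →
        (∀ k : Fin n → ℕ, d ≤ |μ - ∑ j, (2 * (k j : ℝ) + 1) * a j|) →
        ∀ v, θ * d * ‖v‖ ≤ ‖∑ k, e k (e k v) - (μ : ℂ) • v‖ := by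
  obtain ⟨m, hm⟩ := exists_nat_ge (K' / (2 * b₀))
  rw [div_le_iff₀ (by positivity)] at hm
  obtain ⟨θ, hθ0, hθ1, hgap⟩ := IsLadder.exists_gap.{w} n b₀ K' hb₀ m
  set N : ℝ := (Fintype.card ι : ℝ)
  set r : ℝ := 4 * (N ^ 2 + 1) * (n + 2) with hr
  have hr2 : 2 ≤ r := by
    have : (0 : ℝ) ≤ n := by positivity
    nlinarith [sq_nonneg N]
  refine ⟨θ / r, by positivity, (div_le_self hθ0.le (by linarith)).trans hθ1, ?_⟩
  intro E _ _ a η K w e hw hsymm hcomm ha hdense d μ hd hdb hη hηd hμ hk v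
  set b : Fin n → E →ₗ[ℂ] E := fun j => frameComb (fun k => (Real.sqrt 2 : ℂ) * star (w j k)) e
    with hb
  set b' : Fin n → E →ₗ[ℂ] E := fun j => frameComb (fun k => (Real.sqrt 2 : ℂ) * w j k) e
    with hb'
  have hs2 : (Real.sqrt 2 : ℂ) * (Real.sqrt 2 : ℂ) = 2 := by
    rw [← Complex.ofReal_mul, Real.mul_self_sqrt (by norm_num)]; norm_num
  have hsq : Real.sqrt 2 ≤ 2 := Real.sqrt_le_iff.2 (by norm_num)
  have hn1 : ∀ j k, ‖(Real.sqrt 2 : ℂ) * w j k‖ ≤ 2 := fun j k => by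
    rw [norm_mul, Complex.norm_real, Real.norm_of_nonneg (Real.sqrt_nonneg 2)]
    calc _ ≤ 2 * 1 := mul_le_mul hsq (hw.le_one j k) (norm_nonneg _) (by norm_num)
      _ = 2 := by norm_num
  have hn2 : ∀ j k, ‖(Real.sqrt 2 : ℂ) * star (w j k)‖ ≤ 2 := fun j k => by
    have := hn1 j k
    rwa [norm_mul, norm_star, ← norm_mul]
  set η' := 4 * N ^ 2 * η with hη'
  have hη'0 : 0 ≤ η' := by positivity
  have hladder : IsLadder a η' b b' := by
    refine ⟨fun j x y => ?_, fun j l x => ?_, fun j l x => ?_⟩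
    · simp only [hb, hb', frameComb_apply, sum_inner, inner_sum, inner_smul_left, inner_smul_right,
        hsymm]
      simp
    · refine norm_frameComb_comm_le hcomm (hn2 j) (hn1 l) ?_ x
      have := congrArg (fun z => 2 * z) (hw.diag j l)
      simp only [Finset.mul_sum] at this
      rw [show (if j = l then ((2 * a j : ℝ) : ℂ) else 0) = 2 * (if j = l then (a j : ℂ) else 0) by
        split_ifs <;> simp, ← this]
      refine Finset.sum_congr rfl fun k _ => Finset.sum_congr rfl fun m _ => ?_
      linear_combination (star (w j k) * w l m * (Complex.I * (K k m : ℂ))) * hs2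
    · have := norm_frameComb_comm_le hcomm (hn2 j) (hn2 l) (s := 0) (by
        have := congrArg (fun z => 2 * z) (hw.null j l)
        simp only [Finset.mul_sum, mul_zero] at this
        rw [← this]
        refine Finset.sum_congr rfl fun k _ => Finset.sum_congr rfl fun m _ => ?_
        linear_combination (star (w j k) * star (w l m) * (Complex.I * (K k m : ℂ))) * hs2) x
      rw [zero_smul, sub_zero] at this
      exact this
  have hsum : ∀ x, ∑ j, (b' j (b j x) + b j (b' j x)) = (2 : ℂ) • ∑ k, e k (e k x) := by
    intro x
    simp only [hb, hb', frameComb_frameComb, ← Finset.sum_add_distrib, ← add_smul]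
    rw [Finset.sum_comm]
    rw [Finset.smul_sum]
    refine Finset.sum_congr rfl fun k _ => ?_
    rw [Finset.sum_comm]
    rw [Finset.sum_eq_single k]
    · rw [← Finset.sum_smul]
      congr 1
      have := congrArg (fun z => 2 * z) (hw.complete k k)
      simp only [Finset.mul_sum, if_true, mul_one] at this
      rw [← this]
      refine Finset.sum_congr rfl fun j _ => ?_
      linear_combination (w j k * star (w j k) + star (w j k) * w j k) * hs2
    · intro m _ hm
      rw [← Finset.sum_smul]
      have := congrArg (fun z => 2 * z) (hw.complete k m)
      simp only [Finset.mul_sum, if_neg hm.symm, mul_zero] at this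
      convert zero_smul ℂ _
      rw [← this]
      refine Finset.sum_congr rfl fun j _ => ?_
      linear_combination (w j k * star (w j m) + star (w j k) * w j m) * hs2
    · simp
  set H : E →ₗ[ℂ] E := ∑ k, e k ∘ₗ e k with hH
  have hHa : ∀ x, H x = ∑ k, e k (e k x) := fun x => by simp [hH]
  set sa := ∑ j, a j with hsa
  have hsa0 : 0 ≤ sa := Finset.sum_nonneg fun j _ => hb₀.le.trans (ha j)
  set R : E →ₗ[ℂ] E := numberOp b b' + (sa : ℂ) • LinearMap.id - H with hR
  have hRa : ∀ x, R x = numberOp b b' x + (sa : ℂ) • x - H x := fun x => by simp [hR]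
  have hRn : ∀ x, ‖R x‖ ≤ n * η' / 2 * ‖x‖ := by
    intro x
    have h1 : (2 : ℂ) • R x = -∑ j, (b j (b' j x) - b' j (b j x) -
        (if j = j then ((2 * a j : ℝ) : ℂ) else 0) • x) := by
      rw [hRa, smul_sub, hHa, ← hsum, smul_add, smul_smul, numberOp_apply, two_smul]
      simp only [if_true, Finset.sum_sub_distrib, Finset.sum_add_distrib, ← Finset.sum_smul]
      rw [← Complex.ofReal_sum, ← Finset.mul_sum, ← hsa]
      push_cast
      abel
    have h2 : ‖(2 : ℂ) • R x‖ ≤ n * (η' * ‖x‖) := by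
      rw [h1, norm_neg]
      exact (norm_sum_le_of_le _ fun j _ => hladder.comm_adj j j x).trans (by simp)
    rw [norm_smul] at h2
    norm_num at h2
    linarith
  have hHpos : ∀ (T : ℝ) x, T * ‖x‖ ≤ ‖H x + (T : ℂ) • x‖ := by
    intro T x
    have h1 : (inner ℂ (H x + (T : ℂ) • x) x).re = ∑ k, ‖e k x‖ ^ 2 + T * ‖x‖ ^ 2 := by
      rw [hHa, inner_add_left, sum_inner, inner_smul_left, Complex.conj_ofReal, Complex.add_re,
        Complex.re_ofReal_mul, re_inner_self, Complex.re_sum]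
      congr 1
      exact Finset.sum_congr rfl fun k _ => by rw [hsymm, re_inner_self]
    have h2 := (Complex.re_le_norm _).trans (norm_inner_le_norm (𝕜 := ℂ) (H x + (T : ℂ) • x) x)
    have h3 : 0 ≤ ∑ k, ‖e k x‖ ^ 2 := Finset.sum_nonneg fun _ _ => sq_nonneg _
    rcases (norm_nonneg x).eq_or_lt with h0 | h0
    · rw [← h0]; simp
    · exact le_of_mul_le_mul_right (by nlinarith) h0
  have hT : ∃ T : ℝ, 0 < T ∧
      DenseRange (numberOp b b' + (T : ℂ) • (LinearMap.id : E →ₗ[ℂ] E)) := by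
    obtain ⟨T₀, hT₀⟩ := hdense
    set T' := max T₀ (n * η' + 1) with hT'
    have hT'1 : n * η' + 1 ≤ T' := le_max_right _ _
    have hnη : 0 ≤ n * η' := by positivity
    refine ⟨T' + sa, by linarith, ?_⟩
    have := denseRange_perturb _ R hRn (T := T') (by linarith) (fun x => hHpos T' x)
      (hT₀ T' (le_max_left _ _))
    convert this using 2
    rw [hR]; push_cast; rw [add_smul]; abel
  have hηr : η' * (n + 2) ≤ θ * d := by
    have h1 : η * r ≤ θ * d := by
      have : η * r ≤ θ / r * d * r := by gcongr
      calc _ ≤ _ := this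
        _ = θ * d := by field_simp
    have h2 : η' * (n + 2) ≤ η * r := by
      rw [hη', hr]; nlinarith [mul_nonneg hη (by positivity : (0 : ℝ) ≤ n + 2)]
    linarith
  have hn0 : (0 : ℝ) ≤ n := by positivity
  have key := hgap E a η' b b' hladder ha hT d (μ - sa) hd hdb hη'0 (by nlinarith) (by linarith)
    (by linarith) (fun k => by
      convert hk k using 2
      rw [sub_sub, hsa, ← Finset.sum_add_distrib]
      congr 1
      exact Finset.sum_congr rfl fun j _ => by ring) v
  have h1 : numberOp b b' v - ((μ - sa : ℝ) : ℂ) • v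
      = (∑ k, e k (e k v) - (μ : ℂ) • v) + R v := by
    rw [hRa, hHa]; push_cast; rw [sub_smul]; abel
  rw [h1] at key
  have h2 := norm_add_le (∑ k, e k (e k v) - (μ : ℂ) • v) (R v)
  have h3 := hRn v
  have h4 : n * η' / 2 * ‖v‖ ≤ θ * d / 2 * ‖v‖ := by
    have : n * η' ≤ θ * d := by nlinarith
    exact mul_le_mul_of_nonneg_right (by linarith) (norm_nonneg v)
  have h5 : θ / r * d * ‖v‖ ≤ θ / 2 * d * ‖v‖ := by gcongr
  linarith

end RealFrame

section Diagonalizing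

theorem exists_equiv_of_map_univ_eq {α β γ : Type*} [Fintype α] [Fintype β] [DecidableEq γ]
    (f : α → γ) (g : β → γ)
    (h : Multiset.map f Finset.univ.val = Multiset.map g Finset.univ.val) :
    ∃ σ : α ≃ β, ∀ x, g (σ x) = f x := by
  classical
  have hc : ∀ c, Fintype.card {x // f x = c} = Fintype.card {y // g y = c} := by
    intro c
    have := congrArg (Multiset.count c) h
    rw [Multiset.count_map, Multiset.count_map] at this
    rw [Fintype.card_subtype, Fintype.card_subtype, Finset.card_def, Finset.card_def]
    simpa [eq_comm] using this
  exact ⟨Equiv.ofFiberEquiv fun c => Fintype.equivOfCardEq (hc c), fun x =>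
    Equiv.ofFiberEquiv_map _ x⟩

/-- An antisymmetric real matrix with characteristic polynomial `∏ (X² + a_j²)` is the form of
`n` harmonic oscillators with frequencies `a j`. -/
theorem exists_isDiagonalizing {n : ℕ} {ι : Type} [Fintype ι] [DecidableEq ι] (K : Matrix ι ι ℝ)
    (hK : ∀ j k, K j k = -K k j) (a : Fin n → ℝ) (ha : ∀ j, 0 < a j)
    (hchar : K.charpoly = ∏ j, (X ^ 2 + C (a j ^ 2))) : ∃ w, IsDiagonalizing K a w := by
  obtain ⟨M, hMdef⟩ : ∃ M : Matrix ι ι ℂ, ∀ j k, M j k = Complex.I * (K j k : ℂ) :=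
    ⟨Matrix.of fun j k => Complex.I * (K j k : ℂ), fun _ _ => rfl⟩
  have hM : M.IsHermitian := by
    ext j k
    simp [hMdef, conjTranspose_apply, hK k j]
  have hcard : Fintype.card ι = 2 * n := by
    have := congrArg natDegree hchar
    rw [charpoly_natDegree_eq_dim, natDegree_prod _ _ fun j _ =>
      (monic_X_pow_add_C (a j ^ 2) two_ne_zero).ne_zero] at this
    simp only [natDegree_X_pow_add_C, Finset.sum_const, Finset.card_univ, Fintype.card_fin,
      smul_eq_mul] at this
    omega
  let lam : Fin n ⊕ Fin n → ℝ := Sum.elim a fun j => -a j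
  have hMchar : M.charpoly = ∏ s, (X - C ((lam s : ℝ) : ℂ)) := by
    refine Polynomial.funext fun z => ?_
    have h1 : (K.map (Complex.ofRealHom : ℝ →+* ℂ)).charpoly =
        ∏ j, (X ^ 2 + C ((a j : ℂ) ^ 2)) := by
      rw [Matrix.charpoly_map, hchar, Polynomial.map_prod]
      simp
    have h2 := congrArg (eval (-Complex.I * z)) h1
    rw [Matrix.eval_charpoly] at h2 ⊢
    have h3 : scalar ι z - M =
        Complex.I • (scalar ι (-Complex.I * z) - K.map (Complex.ofRealHom : ℝ →+* ℂ)) := by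
      ext j k
      by_cases hjk : j = k
      · subst hjk
        simp [hMdef, mul_sub, ← mul_assoc, Matrix.sub_apply]
      · simp [hMdef, Matrix.sub_apply, Matrix.diagonal_apply_ne _ hjk]
    rw [h3, Matrix.det_smul, h2, hcard, pow_mul, Complex.I_sq, eval_prod, eval_prod,
      Fintype.prod_sum_type]
    rw [← Finset.prod_mul_distrib, show ((-1 : ℂ)) ^ n = ∏ _j : Fin n, (-1 : ℂ) by simp,
      ← Finset.prod_mul_distrib]
    refine Finset.prod_congr rfl fun j _ => ?_
    simp only [lam, Sum.elim_inl, Sum.elim_inr, eval_add, eval_pow, eval_X, eval_C, eval_sub]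
    push_cast
    ring_nf
    rw [Complex.I_sq]; ring
  obtain ⟨σ, hσ⟩ := exists_equiv_of_map_univ_eq lam hM.eigenvalues (by
    have h1 := hM.roots_charpoly_eq_eigenvalues
    rw [hMchar, Polynomial.roots_prod _ _ (by
      simp [Finset.prod_ne_zero_iff, Polynomial.X_sub_C_ne_zero])] at h1
    simp only [roots_X_sub_C, Multiset.bind_singleton] at h1
    have h2 := congrArg (Multiset.map Complex.re) h1
    simpa [Multiset.map_map, Function.comp_def] using h2)
  let x : Fin n → ι → ℂ := fun j => (hM.eigenvectorBasis (σ (Sum.inl j))).ofLp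
  have hx : ∀ j, M *ᵥ x j = (a j : ℂ) • x j := by
    intro j
    have := hM.mulVec_eigenvectorBasis (σ (Sum.inl j))
    rw [hσ] at this
    simpa [lam] using this
  have hconj : ∀ j, M *ᵥ (star (x j)) = -(a j : ℂ) • star (x j) := by
    intro j
    have := congrArg star (hx j)
    rw [star_mulVec, star_smul, ← mulVec_transpose] at this
    have hMt : Mᴴᵀ = -M := by
      ext k m
      simp [hMdef]
    rw [hMt, neg_mulVec] at this
    rw [neg_smul, neg_eq_iff_eq_neg.1 this]
    simp
  have horth : ∀ j l, star (x j) ⬝ᵥ x l = if j = l then 1 else 0 := by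
    intro j l
    have := orthonormal_iff_ite.1 hM.eigenvectorBasis.orthonormal (σ (Sum.inl j)) (σ (Sum.inl l))
    rw [EuclideanSpace.inner_eq_star_dotProduct, dotProduct_comm] at this
    simpa [x] using this
  have hnull : ∀ j l, star (x j) ⬝ᵥ star (x l) = 0 := by
    intro j l
    have h1 : star (x j) ⬝ᵥ (M *ᵥ star (x l)) = -(a l : ℂ) * (star (x j) ⬝ᵥ star (x l)) := by
      rw [hconj, dotProduct_smul, smul_eq_mul]
    have h2 : star (x j) ⬝ᵥ (M *ᵥ star (x l)) = (a j : ℂ) * (star (x j) ⬝ᵥ star (x l)) := by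
      rw [dotProduct_mulVec]
      have := congrArg star (hx j)
      rw [star_mulVec, hM.eq] at this
      rw [this, star_smul, smul_dotProduct]
      simp
    rw [h1] at h2
    have h3 : ((a j + a l : ℝ) : ℂ) * (star (x j) ⬝ᵥ star (x l)) = 0 := by
      push_cast; linear_combination -h2
    rcases mul_eq_zero.1 h3 with h | h
    · have := Complex.ofReal_eq_zero.1 h
      linarith [ha j, ha l]
    · exact h
  have hcomplete : ∀ k m, ∑ j, (x j k * star (x j m) + star (x j k) * x j m)
      = if k = m then 1 else 0 := by
    let U : Matrix (Fin n ⊕ Fin n) ι ℂ := Sum.elim x fun j => star (x j)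
    have hU : U * Uᴴ = 1 := by
      ext s t
      have hst : (U * Uᴴ) s t = star (U t) ⬝ᵥ U s := by
        rw [dotProduct_comm]; rfl
      rw [hst]
      rcases s with j | j <;> rcases t with l | l
      · simp only [U, Sum.elim_inl, horth, Matrix.one_apply, Sum.inl.injEq, eq_comm]
      · simp only [U, Sum.elim_inl, Sum.elim_inr, star_star]
        rw [← star_star (x l ⬝ᵥ x j), ← star_dotProduct_star, hnull]
        simp
      · simp only [U, Sum.elim_inl, Sum.elim_inr, hnull]
        simp
      · simp only [U, Sum.elim_inr, star_star, Matrix.one_apply, Sum.inr.injEq]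
        rw [dotProduct_comm, horth]
    have hU' := (mul_eq_one_comm_of_card_eq _ _ _ (by
      rw [Fintype.card_sum, Fintype.card_fin, hcard]; ring)).1 hU
    intro k m
    have := congrFun (congrFun hU' m) k
    rw [Matrix.mul_apply, Fintype.sum_sum_type, ← Finset.sum_add_distrib] at this
    rw [Matrix.one_apply] at this
    simp only [eq_comm (a := k)]
    rw [← this]
    refine Finset.sum_congr rfl fun j _ => ?_
    change _ = star (x j m) * x j k + star (star (x j) m) * star (x j) k
    rw [Pi.star_apply, Pi.star_apply, star_star]
    ring
  refine ⟨x, hcomplete, ?_, ?_, ?_⟩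
  · intro j l
    have : ∑ k, ∑ m, star (x j k) * x l m * (Complex.I * (K k m : ℂ)) = star (x j) ⬝ᵥ (M *ᵥ x l) := by
      simp only [dotProduct, mulVec, Finset.mul_sum, hMdef, Pi.star_apply]
      exact Finset.sum_congr rfl fun k _ => Finset.sum_congr rfl fun m _ => by ring
    rw [this, hx, dotProduct_smul, horth]
    split_ifs with h <;> simp [h]
  · intro j l
    have : ∑ k, ∑ m, star (x j k) * star (x l m) * (Complex.I * (K k m : ℂ)) =
        star (x j) ⬝ᵥ (M *ᵥ star (x l)) := by
      simp only [dotProduct, mulVec, Finset.mul_sum, hMdef, Pi.star_apply]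
      exact Finset.sum_congr rfl fun k _ => Finset.sum_congr rfl fun m _ => by ring
    rw [this, hconj, dotProduct_smul, hnull, smul_zero]
  · intro j k
    have h1 := congrArg Complex.re (hcomplete k k)
    rw [if_pos rfl, Complex.re_sum] at h1
    have h2 : ∀ i, (x i k * star (x i k) + star (x i k) * x i k).re = 2 * ‖x i k‖ ^ 2 := by
      intro i
      rw [Complex.sq_norm, Complex.normSq_apply]
      simp
      ring
    simp only [h2, Complex.one_re] at h1
    have h3 := Finset.single_le_sum (f := fun i => 2 * ‖x i k‖ ^ 2)
      (fun _ _ => by positivity) (Finset.mem_univ j)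
    nlinarith [norm_nonneg (x j k)]

end Diagonalizing

section OrthonormalFrame

variable {ι : Type*} [Fintype ι] [DecidableEq ι]

open scoped MatrixOrder in
/-- A uniformly positive matrix has an orthonormal frame (the columns of `L`) with quantitative
bounds on the frame and its inverse. -/
theorem exists_orthonormal_frame (G : Matrix ι ι ℝ) (ε C : ℝ) (hε : 0 < ε) (hs : G.IsSymm)
    (hpos : ∀ v : ι → ℝ, ε * ∑ j, v j ^ 2 ≤ ∑ j, ∑ l, G j l * v j * v l)
    (hC : ∀ j, G j j ≤ C) :
    ∃ L M : Matrix ι ι ℝ, M * L = 1 ∧ L * M = 1 ∧ G⁻¹ = L * Lᵀ ∧ G = Mᵀ * M ∧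
      (∀ j k, L j k ^ 2 ≤ ε⁻¹) ∧ (∀ j k, M j k ^ 2 ≤ C) := by
  have hquad : ∀ v : ι → ℝ, v ⬝ᵥ (G *ᵥ v) = ∑ j, ∑ l, G j l * v j * v l := by
    intro v
    simp only [dotProduct, mulVec, Finset.mul_sum]
    exact Finset.sum_congr rfl fun j _ => Finset.sum_congr rfl fun l _ => by ring
  have hpd : G.PosDef := by
    refine Matrix.PosDef.of_dotProduct_mulVec_pos (by simpa [IsHermitian] using hs.eq) fun v hv => ?_
    have h2 : 0 < ∑ j, v j ^ 2 := by
      obtain ⟨j, hj⟩ := Function.ne_iff.mp hv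
      exact Finset.sum_pos' (fun _ _ => sq_nonneg _) ⟨j, Finset.mem_univ _, by
        simpa using pow_pos (abs_pos.mpr hj) 2⟩
    rw [star_trivial, hquad]
    exact lt_of_lt_of_le (mul_pos hε h2) (hpos v)
  obtain ⟨M, hM⟩ := CStarAlgebra.nonneg_iff_eq_star_mul_self.mp hpd.posSemidef.nonneg
  have hGM : G = Mᵀ * M := by simpa [star_eq_conjTranspose] using hM
  have hu : IsUnit M.det := by
    have : G.det ≠ 0 := hpd.det_pos.ne'
    rw [hGM, det_mul, det_transpose] at this
    exact isUnit_iff_ne_zero.mpr fun h => this (by rw [h, zero_mul])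
  refine ⟨M⁻¹, M, mul_nonsing_inv M hu, nonsing_inv_mul M hu, ?_, hGM, ?_, ?_⟩
  · rw [hGM, Matrix.mul_inv_rev, transpose_nonsing_inv]
  · intro j k
    have h1 := hpos (fun i => M⁻¹ i k)
    have h2 : ∑ j, ∑ l, G j l * M⁻¹ j k * M⁻¹ l k = ((M⁻¹)ᵀ * G * M⁻¹) k k := by
      simp only [mul_apply, transpose_apply, Finset.sum_mul]
      rw [Finset.sum_comm]
      exact Finset.sum_congr rfl fun j _ => Finset.sum_congr rfl fun l _ => by ring
    have h3 : (M⁻¹)ᵀ * G * M⁻¹ = 1 := by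
      rw [hGM, ← Matrix.mul_assoc, ← transpose_mul, Matrix.mul_assoc, mul_nonsing_inv M hu]
      simp
    rw [h2, h3, one_apply_eq] at h1
    have h4 : M⁻¹ j k ^ 2 ≤ ∑ i, M⁻¹ i k ^ 2 :=
      Finset.single_le_sum (f := fun i => M⁻¹ i k ^ 2) (fun _ _ => sq_nonneg _)
        (Finset.mem_univ j)
    rw [← one_div ε, le_div_iff₀ hε]
    nlinarith
  · intro j k
    refine le_trans ?_ (hC k)
    rw [hGM, mul_apply]
    refine le_trans (le_of_eq ?_) (Finset.single_le_sum
      (f := fun i => Mᵀ k i * M i k) (fun i _ => ?_) (Finset.mem_univ j))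
    · simp [sq]
    · simpa using mul_self_nonneg (M i k)

theorem charpoly_frame {G L : Matrix ι ι ℝ} (B : Matrix ι ι ℝ) (h : G⁻¹ = L * Lᵀ) :
    (Lᵀ * B * L).charpoly = (G⁻¹ * B).charpoly := by
  rw [Matrix.charpoly_mul_comm, h, Matrix.mul_assoc]

end OrthonormalFrame

section TestFunctions

open scoped ContDiff ComplexConjugate

variable {ι : Type} [Fintype ι]

/-- The space of compactly supported smooth functions, as a submodule. -/
def testSubmodule (ι : Type) [Fintype ι] : Submodule ℂ ((ι → ℝ) → ℂ) where
  carrier := {u | ContDiff ℝ ∞ u ∧ HasCompactSupport u}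
  add_mem' ha hb := ⟨ha.1.add hb.1, ha.2.add hb.2⟩
  zero_mem' := ⟨contDiff_const, HasCompactSupport.zero⟩
  smul_mem' c _ hu := ⟨contDiff_const.smul hu.1, hu.2.smul_left (f := fun _ => c)⟩

/-- Compactly supported smooth functions on `ℝ^ι`, to be equipped with the `L²` inner product. -/
def TestFn (ι : Type) [Fintype ι] : Type := testSubmodule ι

namespace TestFn

instance : AddCommGroup (TestFn ι) := inferInstanceAs (AddCommGroup (testSubmodule ι))
instance : Module ℂ (TestFn ι) := inferInstanceAs (Module ℂ (testSubmodule ι))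
instance : FunLike (TestFn ι) (ι → ℝ) ℂ := ⟨fun u => u.1, Subtype.coe_injective⟩

/-- Bundle a compactly supported smooth function. -/
def mk (u : (ι → ℝ) → ℂ) (h : ContDiff ℝ ∞ u) (hc : HasCompactSupport u) : TestFn ι := ⟨u, h, hc⟩

@[simp] theorem mk_apply (u : (ι → ℝ) → ℂ) (h : ContDiff ℝ ∞ u) (hc : HasCompactSupport u)
    (Z : ι → ℝ) : mk u h hc Z = u Z := rfl

theorem smooth (u : TestFn ι) : ContDiff ℝ ∞ u := u.2.1
theorem compact (u : TestFn ι) : HasCompactSupport u := u.2.2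
theorem cont (u : TestFn ι) : Continuous u := u.smooth.continuous
theorem diff (u : TestFn ι) (Z : ι → ℝ) : DifferentiableAt ℝ u Z :=
  u.smooth.differentiable (by simp) Z

@[ext] theorem ext {u v : TestFn ι} (h : ∀ Z, u Z = v Z) : u = v := DFunLike.ext _ _ h

@[simp] theorem add_apply (u v : TestFn ι) (Z : ι → ℝ) : (u + v) Z = u Z + v Z := rfl
@[simp] theorem sub_apply (u v : TestFn ι) (Z : ι → ℝ) : (u - v) Z = u Z - v Z := rfl
@[simp] theorem zero_apply (Z : ι → ℝ) : (0 : TestFn ι) Z = 0 := rfl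
@[simp] theorem smul_apply (c : ℂ) (u : TestFn ι) (Z : ι → ℝ) : (c • u) Z = c * u Z := rfl

@[simp] theorem sum_apply {κ : Type*} (s : Finset κ) (f : κ → TestFn ι) (Z : ι → ℝ) :
    (∑ i ∈ s, f i) Z = ∑ i ∈ s, f i Z := by
  classical
  induction s using Finset.induction_on with
  | empty => simp
  | insert a s ha ih => simp [Finset.sum_insert ha, ih]

theorem integrable_inner (u v : TestFn ι) : Integrable fun Z => conj (u Z) * v Z := by
  have hc : Continuous fun Z => conj (u Z) * v Z :=
    (Complex.continuous_conj.comp u.cont).mul v.cont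
  have hs : HasCompactSupport fun Z => conj (u Z) * v Z := v.compact.mul_left
  exact hc.integrable_of_hasCompactSupport hs

theorem integral_conj_mul_self (u : TestFn ι) :
    ∫ Z, conj (u Z) * u Z = ((∫ Z, ‖u Z‖ ^ 2 : ℝ) : ℂ) := by
  have : (fun Z => conj (u Z) * u Z) = fun Z => ((‖u Z‖ ^ 2 : ℝ) : ℂ) := by
    funext Z
    rw [mul_comm, Complex.mul_conj, Complex.normSq_eq_norm_sq]
  rw [this, integral_complex_ofReal]

theorem compact_norm_sq (u : TestFn ι) : HasCompactSupport fun Z => ‖u Z‖ ^ 2 :=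
  u.compact.comp_left (g := fun z : ℂ => ‖z‖ ^ 2) (by simp)

theorem integrable_norm_sq (u : TestFn ι) : Integrable fun Z => ‖u Z‖ ^ 2 := by
  have hc : Continuous fun Z => ‖u Z‖ ^ 2 := u.cont.norm.pow 2
  exact hc.integrable_of_hasCompactSupport u.compact_norm_sq

/-- The `L²` inner product on test functions. -/
@[reducible] def core : InnerProductSpace.Core ℂ (TestFn ι) where
  inner u v := ∫ Z, conj (u Z) * v Z
  conj_inner_symm u v := by
    rw [← integral_conj]
    exact integral_congr_ae (Filter.Eventually.of_forall fun Z => by simp [mul_comm])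
  re_inner_nonneg u := by
    rw [integral_conj_mul_self]
    simpa using integral_nonneg fun Z => sq_nonneg ‖u Z‖
  add_left u v w := by
    rw [← integral_add (integrable_inner u w) (integrable_inner v w)]
    exact integral_congr_ae (Filter.Eventually.of_forall fun Z => by simp [add_mul])
  smul_left u v r := by
    rw [← integral_const_mul]
    exact integral_congr_ae (Filter.Eventually.of_forall fun Z => by simp [mul_assoc])
  definite u h := by
    have h2 := integral_conj_mul_self u
    have h3 : ∫ Z, ‖u Z‖ ^ 2 = 0 := by
      have := h2.symm.trans h
      exact_mod_cast this
    ext Z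
    by_contra hZ
    have hc : Continuous fun Z => ‖u Z‖ ^ 2 := u.cont.norm.pow 2
    have hz : ‖u Z‖ ^ 2 ≠ 0 := pow_ne_zero 2 (norm_ne_zero_iff.2 hZ)
    have := hc.integral_pos_of_hasCompactSupport_nonneg_nonzero
      (μ := volume) u.compact_norm_sq (fun Z => sq_nonneg ‖u Z‖) hz
    exact absurd h3 this.ne'

instance : NormedAddCommGroup (TestFn ι) := core.toNormedAddCommGroup
instance : InnerProductSpace ℂ (TestFn ι) := InnerProductSpace.ofCore core.toCore

theorem inner_def (u v : TestFn ι) : inner ℂ u v = ∫ Z, conj (u Z) * v Z := rfl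

theorem norm_sq (u : TestFn ι) : ‖u‖ ^ 2 = ∫ Z, ‖u Z‖ ^ 2 := by
  have h2 := integral_conj_mul_self u
  have h1 := inner_self_eq_norm_sq_to_K (𝕜 := ℂ) u
  rw [inner_def, h2] at h1
  have h3 : ((‖u‖ ^ 2 : ℝ) : ℂ) = ((∫ Z, ‖u Z‖ ^ 2 : ℝ) : ℂ) := by
    rw [h1]; push_cast; rfl
  exact Complex.ofReal_injective h3

/-- Pointwise control of squares gives control of squared norms. -/
theorem norm_sq_le_sum {κ : Type*} (s : Finset κ) (u : TestFn ι) (c : κ → ℝ) (v : κ → TestFn ι)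
    (h : ∀ Z, ‖u Z‖ ^ 2 ≤ ∑ i ∈ s, c i * ‖v i Z‖ ^ 2) : ‖u‖ ^ 2 ≤ ∑ i ∈ s, c i * ‖v i‖ ^ 2 := by
  have : ∑ i ∈ s, c i * ‖v i‖ ^ 2 = ∫ Z, ∑ i ∈ s, c i * ‖v i Z‖ ^ 2 := by
    rw [integral_finsetSum _ fun i _ => (v i).integrable_norm_sq.const_mul (c i)]
    exact Finset.sum_congr rfl fun i _ => by rw [norm_sq, integral_const_mul]
  rw [this, norm_sq]
  exact integral_mono u.integrable_norm_sq
    (integrable_finsetSum _ fun i _ => (v i).integrable_norm_sq.const_mul (c i)) h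

theorem sum_norm_sq_le_sum {κ κ' : Type*} (s : Finset κ) (s' : Finset κ') (u : κ → TestFn ι)
    (c : κ' → ℝ) (v : κ' → TestFn ι)
    (h : ∀ Z, ∑ i ∈ s, ‖u i Z‖ ^ 2 ≤ ∑ i ∈ s', c i * ‖v i Z‖ ^ 2) :
    ∑ i ∈ s, ‖u i‖ ^ 2 ≤ ∑ i ∈ s', c i * ‖v i‖ ^ 2 := by
  have h1 : ∑ i ∈ s', c i * ‖v i‖ ^ 2 = ∫ Z, ∑ i ∈ s', c i * ‖v i Z‖ ^ 2 := by
    rw [integral_finsetSum _ fun i _ => (v i).integrable_norm_sq.const_mul (c i)]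
    exact Finset.sum_congr rfl fun i _ => by rw [norm_sq, integral_const_mul]
  have h2 : ∑ i ∈ s, ‖u i‖ ^ 2 = ∫ Z, ∑ i ∈ s, ‖u i Z‖ ^ 2 := by
    rw [integral_finsetSum _ fun i _ => (u i).integrable_norm_sq]
    exact Finset.sum_congr rfl fun i _ => norm_sq _
  rw [h1, h2]
  exact integral_mono (integrable_finsetSum _ fun i _ => (u i).integrable_norm_sq)
    (integrable_finsetSum _ fun i _ => (v i).integrable_norm_sq.const_mul (c i)) h

theorem norm_le_of_forall_le {C : ℝ} (hC : 0 ≤ C) (u v : TestFn ι)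
    (h : ∀ Z, ‖u Z‖ ≤ C * ‖v Z‖) : ‖u‖ ≤ C * ‖v‖ := by
  have := norm_sq_le_sum {()} u (fun _ => C ^ 2) (fun _ => v) fun Z => by
    simpa [← mul_pow] using pow_le_pow_left₀ (norm_nonneg _) (h Z) 2
  rw [Finset.sum_singleton, ← mul_pow] at this
  exact le_of_sq_le_sq this (by positivity)

/-- Multiplication by a smooth function. -/
def mulOp (f : (ι → ℝ) → ℂ) (hf : ContDiff ℝ ∞ f) : TestFn ι →ₗ[ℂ] TestFn ι where
  toFun u := mk (fun Z => f Z * u Z) (hf.mul u.smooth) u.compact.mul_left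
  map_add' u v := by ext; simp [mul_add]
  map_smul' c u := by ext; simp; ring

@[simp] theorem mulOp_apply (f : (ι → ℝ) → ℂ) (hf : ContDiff ℝ ∞ f) (u : TestFn ι) (Z : ι → ℝ) :
    mulOp f hf u Z = f Z * u Z := rfl

/-- Directional derivative. -/
def dirOp (v : ι → ℝ) : TestFn ι →ₗ[ℂ] TestFn ι where
  toFun u := mk (fun Z => fderiv ℝ u Z v)
    ((u.smooth.fderiv_right (m := ∞) (by simp)).clm_apply contDiff_const)
    (u.compact.fderiv_apply (𝕜 := ℝ) v)
  map_add' u w := by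
    ext Z
    have : fderiv ℝ (u + w) Z = fderiv ℝ u Z + fderiv ℝ w Z := fderiv_add (u.diff Z) (w.diff Z)
    simp [this]
  map_smul' c u := by
    ext Z
    have : fderiv ℝ (c • u) Z = c • fderiv ℝ u Z := fderiv_const_smul (u.diff Z) c
    simp [this]

theorem dirOp_apply (v : ι → ℝ) (u : TestFn ι) (Z : ι → ℝ) :
    dirOp v u Z = fderiv ℝ u Z v := rfl

theorem _root_.ContDiff.complex_ofReal {α : (ι → ℝ) → ℝ} (hα : ContDiff ℝ ∞ α) :
    ContDiff ℝ ∞ fun Z => (α Z : ℂ) := Complex.ofRealCLM.contDiff.comp hα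

/-- The magnetic derivative `i h ∂_v + α`. -/
def magOp (h : ℝ) (v : ι → ℝ) (α : (ι → ℝ) → ℝ) (hα : ContDiff ℝ ∞ α) :
    TestFn ι →ₗ[ℂ] TestFn ι :=
  (Complex.I * h) • dirOp v + mulOp (fun Z => (α Z : ℂ)) hα.complex_ofReal

theorem magOp_apply (h : ℝ) (v : ι → ℝ) (α : (ι → ℝ) → ℝ) (hα : ContDiff ℝ ∞ α) (u : TestFn ι)
    (Z : ι → ℝ) : magOp h v α hα u Z = Complex.I * h * fderiv ℝ u Z v + α Z * u Z := rfl

theorem inner_dirOp (v : ι → ℝ) (u w : TestFn ι) :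
    inner ℂ u (dirOp v w) = - inner ℂ (dirOp v u) w := by
  have hd : ∀ Z, fderiv ℝ (fun Z => conj (u Z)) Z v = conj (fderiv ℝ u Z v) := by
    intro Z
    have := (Complex.conjCLE.toContinuousLinearMap.hasFDerivAt (x := u Z)).comp Z
      (u.diff Z).hasFDerivAt
    exact congrArg (fun L => L v) this.fderiv
  have h0 : ∀ Z, DifferentiableAt ℝ (fun Z => conj (u Z)) Z := fun Z =>
    Complex.conjCLE.toContinuousLinearMap.differentiableAt.comp Z (u.diff Z)
  have := integral_mul_fderiv_eq_neg_fderiv_mul_of_integrable (μ := volume)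
    (f := fun Z => conj (u Z)) (g := w) (v := v) (𝕜 := ℂ) ?_ ?_ ?_ (fun Z _ => h0 Z)
    (fun Z _ => w.diff Z)
  · simp only [hd] at this
    exact this
  · simp only [hd]
    exact integrable_inner (dirOp v u) w
  · exact integrable_inner u (dirOp v w)
  · exact integrable_inner u w

theorem inner_mulOp (f : (ι → ℝ) → ℂ) (hf : ContDiff ℝ ∞ f) (hr : ∀ Z, conj (f Z) = f Z)
    (u w : TestFn ι) : inner ℂ (mulOp f hf u) w = inner ℂ u (mulOp f hf w) := by
  rw [inner_def, inner_def]
  refine integral_congr_ae (Filter.Eventually.of_forall fun Z => ?_)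
  simp [hr]
  ring

theorem inner_magOp (h : ℝ) (v : ι → ℝ) (α : (ι → ℝ) → ℝ) (hα : ContDiff ℝ ∞ α) (u w : TestFn ι) :
    inner ℂ (magOp h v α hα u) w = inner ℂ u (magOp h v α hα w) := by
  simp only [magOp, LinearMap.add_apply, LinearMap.smul_apply, inner_add_left, inner_add_right,
    inner_smul_left, inner_smul_right, inner_dirOp]
  rw [inner_mulOp _ _ (fun Z => by simp)]
  simp

theorem fderiv_mulOp (f : (ι → ℝ) → ℂ) (hf : ContDiff ℝ ∞ f) (u : TestFn ι) (Z v : ι → ℝ) :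
    fderiv ℝ (mulOp f hf u) Z v = fderiv ℝ f Z v * u Z + f Z * fderiv ℝ u Z v := by
  have : fderiv ℝ (mulOp f hf u) Z = _ :=
    fderiv_fun_mul (hf.differentiable (by simp) Z) (u.diff Z)
  rw [this]
  simp
  ring

theorem dirOp_comm (v w : ι → ℝ) (u : TestFn ι) : dirOp v (dirOp w u) = dirOp w (dirOp v u) := by
  ext Z
  have hs : IsSymmSndFDerivAt ℝ u Z := u.smooth.contDiffAt.isSymmSndFDerivAt
    (by simpa using WithTop.coe_le_coe.2 (le_top : (2 : ℕ∞) ≤ ⊤))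
  have h1 : ∀ v w : ι → ℝ, dirOp v (dirOp w u) Z = fderiv ℝ (fderiv ℝ u) Z v w := by
    intro v w
    have hd : DifferentiableAt ℝ (fderiv ℝ u) Z :=
      (u.smooth.fderiv_right (m := ∞) (by simp)).differentiable (by simp) Z
    have : fderiv ℝ (dirOp w u) Z v = fderiv ℝ (fun Z => fderiv ℝ u Z w) Z v := rfl
    rw [dirOp_apply, this, fderiv_clm_apply hd (differentiableAt_const _)]
    simp
  rw [h1, h1, hs.eq]

theorem magOp_commutator (h : ℝ) (v w : ι → ℝ) (α β : (ι → ℝ) → ℝ) (hα : ContDiff ℝ ∞ α)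
    (hβ : ContDiff ℝ ∞ β) (u : TestFn ι) (Z : ι → ℝ) :
    (magOp h v α hα (magOp h w β hβ u) - magOp h w β hβ (magOp h v α hα u)) Z =
      Complex.I * (h * (fderiv ℝ β Z v - fderiv ℝ α Z w) : ℝ) * u Z := by
  have hof : ∀ (γ : (ι → ℝ) → ℝ), ContDiff ℝ ∞ γ → ∀ v,
      fderiv ℝ (fun Z => (γ Z : ℂ)) Z v = (fderiv ℝ γ Z v : ℝ) := by
    intro γ hγ v
    have := (Complex.ofRealCLM.hasFDerivAt (x := γ Z)).comp Z
      (hγ.differentiable (by simp) Z).hasFDerivAt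
    exact congrArg (fun L => L v) this.fderiv
  have e := congrArg (fun f : TestFn ι => f Z) (dirOp_comm v w u)
  simp only [magOp, LinearMap.add_apply, LinearMap.smul_apply, map_add, map_smul, add_apply,
    sub_apply, smul_apply, mulOp_apply, dirOp_apply _ (mulOp _ _ _), fderiv_mulOp, hof α hα,
    hof β hβ]
  simp only [e, dirOp_apply]
  push_cast
  ring

end TestFn
end TestFunctions

section RadialGauge

open scoped ContDiff

/-- A parametric integral over `[0, 1]` of a smooth function is smooth. -/
theorem contDiff_intervalIntegral_param {X : Type*} [NormedAddCommGroup X] [NormedSpace ℝ X]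
    (F : ℝ × X → ℝ) (hF : ContDiff ℝ ∞ F) :
    ContDiff ℝ ∞ fun x => ∫ s in (0 : ℝ)..1, F (s, x) := by
  let χ : ContDiffBump (0 : ℝ) := ⟨1, 2, by norm_num, by norm_num⟩
  have hg : ContDiff ℝ ∞ (Function.uncurry fun (x : X) (t : ℝ) => χ t * F (-t, x)) := by
    refine (χ.contDiff.comp contDiff_snd).mul (hF.comp ?_)
    exact (contDiff_snd.neg).prodMk contDiff_fst
  have key := contDiffOn_convolution_right_with_param_comp (𝕜 := ℝ) (n := ⊤) (μ := volume)
    (ContinuousLinearMap.mul ℝ ℝ) (s := Set.univ) (v := fun _ : X => (0 : ℝ)) contDiffOn_const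
    (f := (Set.Ioc (0 : ℝ) 1).indicator fun _ => (1 : ℝ))
    (g := fun x t => χ t * F (-t, x)) (k := Metric.closedBall 0 2) isOpen_univ
    (isCompact_closedBall _ _) (fun x t _ ht => by
      have : χ t = 0 := χ.zero_of_le_dist (by
        simpa using (not_le.1 (by simpa using ht)).le)
      simp [this])
    ((locallyIntegrable_const 1).indicator measurableSet_Ioc) hg.contDiffOn
  rw [contDiffOn_univ] at key
  convert key using 2 with x
  rw [convolution_def, intervalIntegral.integral_of_le zero_le_one, ← integral_indicator
    measurableSet_Ioc]
  refine integral_congr_ae (Filter.Eventually.of_forall fun t => ?_)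
  by_cases ht : t ∈ Set.Ioc (0 : ℝ) 1
  · have : χ (-t) = 1 := χ.one_of_mem_closedBall (by
      rw [mem_closedBall_zero_iff, norm_neg, Real.norm_eq_abs, abs_of_pos ht.1]
      exact ht.2)
    simp [ht, this]
  · simp [ht]

variable {ι : Type} [Fintype ι]

theorem hasDerivAt_ray (f : (ι → ℝ) → ℝ) (hf : ContDiff ℝ ∞ f) (y x : ι → ℝ) (s : ℝ) :
    HasDerivAt (fun s : ℝ => f (y + s • x)) (fderiv ℝ f (y + s • x) x) s := by
  have h1 : HasDerivAt (fun s : ℝ => y + s • x) x s := by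
    simpa using ((hasDerivAt_id s).smul_const x).const_add y
  exact ((hf.differentiable (by simp) _).hasFDerivAt.comp_hasDerivAt s h1)

theorem contDiff_fderiv_single {f : (ι → ℝ) → ℝ} (hf : ContDiff ℝ ∞ f) (v : ι → ℝ) :
    ContDiff ℝ ∞ fun Z => fderiv ℝ f Z v :=
  (hf.fderiv_right (m := ∞) (by simp)).clm_apply contDiff_const

variable [DecidableEq ι]

/-- The curvature `∂_j A_k - ∂_k A_j` of a one-form. -/
def curvature (A : ι → (ι → ℝ) → ℝ) (Z : ι → ℝ) : Matrix ι ι ℝ := fun j k =>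
  fderiv ℝ (A k) Z (Pi.single j 1) - fderiv ℝ (A j) Z (Pi.single k 1)

theorem fderiv_eq_sum_single (f : (ι → ℝ) → ℝ) (Z x : ι → ℝ) :
    fderiv ℝ f Z x = ∑ k, x k * fderiv ℝ f Z (Pi.single k 1) := by
  conv_lhs => rw [pi_eq_sum_univ' x, map_sum]
  exact Finset.sum_congr rfl fun k _ => by
    rw [map_smul, smul_eq_mul]

theorem curvature_sub_gradient (A : ι → (ι → ℝ) → ℝ) (hA : ∀ j, ContDiff ℝ ∞ (A j))
    (φ : (ι → ℝ) → ℝ) (hφ : ContDiff ℝ ∞ φ) :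
    curvature (fun j Z => A j Z - fderiv ℝ φ Z (Pi.single j 1)) = curvature A := by
  funext Z j k
  have hs : IsSymmSndFDerivAt ℝ φ Z := hφ.contDiffAt.isSymmSndFDerivAt
    (by simpa using WithTop.coe_le_coe.2 (le_top : (2 : ℕ∞) ≤ ⊤))
  have hd : DifferentiableAt ℝ (fderiv ℝ φ) Z :=
    (hφ.fderiv_right (m := ∞) (by simp)).differentiable (by simp) Z
  have h2 : ∀ v w, fderiv ℝ (fun Z => fderiv ℝ φ Z w) Z v = fderiv ℝ (fderiv ℝ φ) Z v w := by
    intro v w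
    rw [fderiv_clm_apply hd (differentiableAt_const _)]
    simp
  have h3 : ∀ j v, fderiv ℝ (fun Z => A j Z - fderiv ℝ φ Z (Pi.single j 1)) Z v =
      fderiv ℝ (A j) Z v - fderiv ℝ (fderiv ℝ φ) Z v (Pi.single j 1) := by
    intro j v
    rw [fderiv_fun_sub ((hA j).differentiable (by simp) Z)
      ((contDiff_fderiv_single hφ _).differentiable (by simp) Z), ← h2]
    rfl
  simp only [curvature, h3, hs.eq (Pi.single j 1)]
  ring

/-- The radial gauge: after subtracting a gradient, a one-form agrees with its linear model up to
a quadratic error controlled by the oscillation of the curvature. -/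
theorem exists_radial_gauge (A : ι → (ι → ℝ) → ℝ) (hA : ∀ j, ContDiff ℝ ∞ (A j)) (y : ι → ℝ)
    (C : ℝ) (hC : 0 ≤ C)
    (hB : ∀ Z j k, |curvature A Z j k - curvature A y j k| ≤ C * ‖Z - y‖) :
    ∃ φ : (ι → ℝ) → ℝ, ContDiff ℝ ∞ φ ∧ ∀ Z j,
      |A j Z - fderiv ℝ φ Z (Pi.single j 1) - 2⁻¹ * ∑ k, curvature A y k j * (Z k - y k)| ≤
        Fintype.card ι * C * ‖Z - y‖ ^ 2 := by
  let φ : (ι → ℝ) → ℝ := fun Z => ∫ s in (0 : ℝ)..1, ∑ k, A k (y + s • (Z - y)) * (Z k - y k)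
  have hφ : ContDiff ℝ ∞ φ := by
    refine contDiff_intervalIntegral_param
      (fun q : ℝ × (ι → ℝ) => ∑ k, A k (y + q.1 • (q.2 - y)) * (q.2 k - y k)) ?_
    refine ContDiff.sum fun k _ => ((hA k).comp ?_).mul ?_
    · exact contDiff_const.add (contDiff_fst.smul (contDiff_snd.sub contDiff_const))
    · exact ((contDiff_apply ℝ ℝ k).comp contDiff_snd).sub contDiff_const
  refine ⟨φ, hφ, ?_⟩
  set A' : ι → (ι → ℝ) → ℝ := fun j Z => A j Z - fderiv ℝ φ Z (Pi.single j 1) with hA'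
  have hA's : ∀ j, ContDiff ℝ ∞ (A' j) := fun j => (hA j).sub (contDiff_fderiv_single hφ _)
  have hcurv : curvature A' = curvature A := curvature_sub_gradient A hA φ hφ
  have hrad0 : ∀ x, ∑ k, x k * A' k (y + x) = 0 := by
    intro x
    have hfun : ∀ t : ℝ, φ (y + t • x) = ∫ s in (0 : ℝ)..t, ∑ k, A k (y + s • x) * x k := by
      intro t
      have := intervalIntegral.smul_integral_comp_mul_right (a := 0) (b := 1)
        (fun s => ∑ k, A k (y + s • x) * x k) t
      rw [zero_mul, one_mul] at this
      rw [← this, smul_eq_mul, ← intervalIntegral.integral_const_mul]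
      simp only [φ]
      refine intervalIntegral.integral_congr fun s _ => ?_
      simp only [add_sub_cancel_left, Pi.add_apply, Pi.smul_apply, smul_eq_mul, smul_smul,
        Finset.mul_sum]
      exact Finset.sum_congr rfl fun k _ => by ring
    have hcont : Continuous fun s : ℝ => ∑ k, A k (y + s • x) * x k :=
      continuous_finsetSum _ fun k _ => ((hA k).continuous.comp (by fun_prop)).mul
        continuous_const
    have h1 : HasDerivAt (fun t : ℝ => φ (y + t • x)) (∑ k, A k (y + (1 : ℝ) • x) * x k) 1 := by
      simp only [hfun]
      exact intervalIntegral.integral_hasDerivAt_right (hcont.intervalIntegrable _ _)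
        (hcont.stronglyMeasurableAtFilter _ _) hcont.continuousAt
    have h2 := (hasDerivAt_ray φ hφ y x 1).unique h1
    rw [one_smul, fderiv_eq_sum_single] at h2
    simp only [hA', mul_sub, Finset.sum_sub_distrib, h2]
    rw [sub_eq_zero]
    exact Finset.sum_congr rfl fun k _ => mul_comm _ _
  have hrad : ∀ Z, ∑ k, (Z k - y k) * A' k Z = 0 := by
    intro Z
    simpa using hrad0 (Z - y)
  have hrad' : ∀ Z j, A' j Z + ∑ k, (Z k - y k) * fderiv ℝ (A' k) Z (Pi.single j 1) = 0 := by
    intro Z j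
    have h1 : HasFDerivAt (fun Z => ∑ k, (Z k - y k) * A' k Z)
        (∑ k, ((Z k - y k) • fderiv ℝ (A' k) Z +
          A' k Z • (ContinuousLinearMap.proj k : (ι → ℝ) →L[ℝ] ℝ))) Z := by
      refine HasFDerivAt.fun_sum fun k _ => ?_
      exact ((ContinuousLinearMap.proj (R := ℝ) (φ := fun _ : ι => ℝ) k).hasFDerivAt.sub_const
        (y k)).mul ((hA's k).differentiable (by simp) Z).hasFDerivAt
    have h2 : HasFDerivAt (fun Z => ∑ k, (Z k - y k) * A' k Z) (0 : (ι → ℝ) →L[ℝ] ℝ) Z := by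
      simp only [hrad]
      exact hasFDerivAt_const _ _
    have h3 := congrArg (fun L => L (Pi.single j 1)) (h1.unique h2)
    simp only [_root_.sum_apply, _root_.add_apply,
      _root_.smul_apply, ContinuousLinearMap.proj_apply, smul_eq_mul,
      Finset.sum_add_distrib, _root_.zero_apply] at h3
    rw [add_comm]
    convert h3 using 2
    simp [Pi.single_apply]
  intro Z j
  set x := Z - y with hx
  let G : ℝ → ℝ := fun s => s * A' j (y + s • x) - s ^ 2 * (2⁻¹ * ∑ k, curvature A y k j * x k)
  have hG : ∀ s, HasDerivAt G (s * ∑ k, x k *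
      (curvature A (y + s • x) k j - curvature A y k j)) s := by
    intro s
    have h1 := ((hasDerivAt_id s).mul (hasDerivAt_ray (A' j) (hA's j) y x s)).sub
      (((hasDerivAt_id s).pow 2).mul_const (2⁻¹ * ∑ k, curvature A y k j * x k))
    refine HasDerivAt.congr_deriv h1 ?_
    have h2 := hrad' (y + s • x) j
    rw [fderiv_eq_sum_single (A' j), ← hcurv]
    have h3 : A' j (y + s • x) =
        - (s * ∑ k, x k * fderiv ℝ (A' k) (y + s • x) (Pi.single j 1)) := by
      rw [Finset.mul_sum, ← add_eq_zero_iff_eq_neg, ← h2]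
      congr 1
      exact Finset.sum_congr rfl fun k _ => by simp; ring
    simp only [id, h3, curvature, mul_sub, Finset.sum_sub_distrib, Nat.cast_ofNat, one_mul]
    have h4 : ∑ k, (fderiv ℝ (A' j) y (Pi.single k 1) * x k - fderiv ℝ (A' k) y (Pi.single j 1)
      * x k) = ∑ k, x k * fderiv ℝ (A' j) y (Pi.single k 1) -
        ∑ k, x k * fderiv ℝ (A' k) y (Pi.single j 1) := by
      rw [Finset.sum_sub_distrib]
      congr 1 <;> exact Finset.sum_congr rfl fun k _ => mul_comm _ _
    simp only [sub_mul, h4]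
    ring
  have hmvt := Convex.norm_image_sub_le_of_norm_hasDerivWithin_le (f := G)
    (s := Set.Icc (0 : ℝ) 1) (x := 0) (y := 1) (C := Fintype.card ι * C * ‖x‖ ^ 2)
    (fun s _ => (hG s).hasDerivWithinAt) (fun s hs => ?_) (convex_Icc 0 1)
    (by simp) (by simp)
  · simp only [G, one_smul, one_pow, one_mul, zero_mul, sub_zero, norm_one, mul_one, ne_eq,
      OfNat.ofNat_ne_zero, not_false_eq_true, zero_pow, Real.norm_eq_abs] at hmvt
    have hxZ : y + x = Z := by rw [hx]; abel
    rw [hxZ] at hmvt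
    exact hmvt
  · rw [norm_mul, Real.norm_eq_abs, abs_of_nonneg hs.1]
    have h1 : ∀ k, ‖x k * (curvature A (y + s • x) k j - curvature A y k j)‖ ≤ C * ‖x‖ ^ 2 := by
      intro k
      rw [norm_mul]
      have h2 := hB (y + s • x) k j
      rw [add_sub_cancel_left, norm_smul, Real.norm_eq_abs, abs_of_nonneg hs.1] at h2
      have h3 : C * (s * ‖x‖) ≤ C * ‖x‖ :=
        mul_le_mul_of_nonneg_left (mul_le_of_le_one_left (norm_nonneg _) hs.2) hC
      calc _ ≤ ‖x‖ * (C * ‖x‖) := mul_le_mul (norm_le_pi_norm x k) (h2.trans h3)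
            (abs_nonneg _) (norm_nonneg _)
        _ = _ := by ring
    calc _ ≤ 1 * ∑ k : ι, C * ‖x‖ ^ 2 := mul_le_mul hs.2
          ((norm_sum_le _ _).trans (Finset.sum_le_sum fun k _ => h1 k)) (norm_nonneg _) zero_le_one
      _ = _ := by simp; ring

end RadialGauge

section CutoffPotential

open scoped ContDiff

variable {ι : Type} [Fintype ι]

theorem exists_bound_of_compactSupport {X : Type*} [TopologicalSpace X] {f : X → ℝ}
    (hf : Continuous f) (hc : HasCompactSupport f) : ∃ C, 0 ≤ C ∧ ∀ x, |f x| ≤ C := by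
  obtain ⟨C, hC⟩ := hf.bounded_above_of_compact_support hc
  exact ⟨max C 0, le_max_right _ _, fun x => (hC x).trans (le_max_left _ _)⟩

/-- A fixed cutoff function on `ℝ^ι`. -/
def cutoff (ι : Type) [Fintype ι] : ContDiffBump (0 : ι → ℝ) := ⟨1, 2, by norm_num, by norm_num⟩

theorem cutoff_contDiff : ContDiff ℝ ∞ (cutoff ι : (ι → ℝ) → ℝ) := (cutoff ι).contDiff

theorem cutoff_eq_one {x : ι → ℝ} (hx : ‖x‖ ≤ 1) : cutoff ι x = 1 :=
  (cutoff ι).one_of_mem_closedBall (mem_closedBall_zero_iff.2 hx)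

theorem tsupport_cutoff : tsupport (cutoff ι : (ι → ℝ) → ℝ) = Metric.closedBall 0 2 :=
  (cutoff ι).tsupport_eq

theorem cutoff_fderiv_eq_zero {x : ι → ℝ} (hx : 2 < ‖x‖) (v : ι → ℝ) :
    fderiv ℝ (cutoff ι : (ι → ℝ) → ℝ) x v = 0 := by
  have : x ∉ tsupport (fderiv ℝ (cutoff ι : (ι → ℝ) → ℝ)) := fun h => by
    have := tsupport_fderiv_subset ℝ h
    rw [tsupport_cutoff, mem_closedBall_zero_iff] at this
    linarith
  rw [image_eq_zero_of_notMem_tsupport this]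
  rfl

theorem cutoff_eq_zero {x : ι → ℝ} (hx : 2 ≤ ‖x‖) : cutoff ι x = 0 :=
  (cutoff ι).zero_of_le_dist (by rw [dist_zero_right]; exact hx)

/-- The cutoff rescaled to the ball of radius `r` about `y`. -/
def cutoffAt (y : ι → ℝ) (r : ℝ) (Z : ι → ℝ) : ℝ := cutoff ι (r⁻¹ • (Z - y))

theorem cutoffAt_contDiff (y : ι → ℝ) (r : ℝ) : ContDiff ℝ ∞ (cutoffAt y r) :=
  by
  have : ContDiff ℝ ∞ fun Z : ι → ℝ => r⁻¹ • (Z - y) := by fun_prop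
  exact cutoff_contDiff.comp this

theorem cutoffAt_fderiv (y : ι → ℝ) (r : ℝ) (Z v : ι → ℝ) :
    fderiv ℝ (cutoffAt y r) Z v =
      r⁻¹ * fderiv ℝ (cutoff ι : (ι → ℝ) → ℝ) (r⁻¹ • (Z - y)) v := by
  have h1 : HasFDerivAt (fun Z : ι → ℝ => r⁻¹ • (Z - y))
      (r⁻¹ • ContinuousLinearMap.id ℝ (ι → ℝ)) Z :=
    ((hasFDerivAt_id Z).sub_const y).const_smul r⁻¹
  have h2 := (cutoff_contDiff.differentiable (by simp) (r⁻¹ • (Z - y))).hasFDerivAt.comp Z h1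
  have h3 : fderiv ℝ (cutoffAt y r) Z = _ := h2.fderiv
  rw [h3]
  simp

theorem norm_inv_smul_sub {r : ℝ} (hr : 0 < r) (Z y : ι → ℝ) :
    ‖r⁻¹ • (Z - y)‖ = ‖Z - y‖ / r := by
  rw [norm_smul, norm_inv, Real.norm_eq_abs, abs_of_pos hr]
  ring

theorem cutoffAt_eq_one {y Z : ι → ℝ} {r : ℝ} (hr : 0 < r) (h : ‖Z - y‖ ≤ r) :
    cutoffAt y r Z = 1 :=
  cutoff_eq_one (by rwa [norm_inv_smul_sub hr, div_le_one hr])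

theorem cutoffAt_eq_zero {y Z : ι → ℝ} {r : ℝ} (hr : 0 < r) (h : 2 * r ≤ ‖Z - y‖) :
    cutoffAt y r Z = 0 :=
  cutoff_eq_zero (by rwa [norm_inv_smul_sub hr, le_div_iff₀ hr])

theorem cutoffAt_fderiv_eq_zero {y Z : ι → ℝ} {r : ℝ} (hr : 0 < r) (h : 2 * r < ‖Z - y‖)
    (v : ι → ℝ) : fderiv ℝ (cutoffAt y r) Z v = 0 := by
  rw [cutoffAt_fderiv, cutoff_fderiv_eq_zero, mul_zero]
  rwa [norm_inv_smul_sub hr, lt_div_iff₀ hr]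

theorem cutoffAt_hasCompactSupport (y : ι → ℝ) {r : ℝ} (hr : 0 < r) :
    HasCompactSupport (cutoffAt y r) := by
  refine HasCompactSupport.intro (isCompact_closedBall y (2 * r)) fun Z hZ => ?_
  rw [mem_closedBall_iff_norm, not_le] at hZ
  exact cutoffAt_eq_zero hr hZ.le

theorem cutoffAt_mem_Icc (y : ι → ℝ) (r : ℝ) (Z : ι → ℝ) : cutoffAt y r Z ∈ Set.Icc (0 : ℝ) 1 :=
  ⟨(cutoff ι).nonneg, (cutoff ι).le_one⟩

theorem exists_cutoff_fderiv_bound [DecidableEq ι] : ∃ C, 0 ≤ C ∧ ∀ (x : ι → ℝ) (j : ι),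
    |fderiv ℝ (cutoff ι : (ι → ℝ) → ℝ) x (Pi.single j 1)| ≤ C := by
  have : ∀ j : ι, ∃ C, 0 ≤ C ∧ ∀ x, |fderiv ℝ (cutoff ι : (ι → ℝ) → ℝ) x (Pi.single j 1)| ≤ C :=
    fun j => exists_bound_of_compactSupport (contDiff_fderiv_single cutoff_contDiff _).continuous
      ((cutoff ι).hasCompactSupport.fderiv_apply (𝕜 := ℝ) _)
  choose C hC0 hC using this
  exact ⟨∑ j, C j, Finset.sum_nonneg fun j _ => hC0 j, fun x j => (hC j x).trans
    (Finset.single_le_sum (fun j _ => hC0 j) (Finset.mem_univ j))⟩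

/-- Near any point, and up to a gauge transformation, a one-form with Lipschitz curvature extends
to a global one-form with nearly constant curvature, equal to a linear one outside a compact set. -/
theorem exists_local_potential (ι : Type) [Fintype ι] [DecidableEq ι] (C : ℝ) (hC : 0 ≤ C) :
    ∃ C', 0 ≤ C' ∧ ∀ (A : ι → (ι → ℝ) → ℝ), (∀ j, ContDiff ℝ ∞ (A j)) → ∀ (y : ι → ℝ) (r : ℝ),
      0 < r → (∀ Z j k, |curvature A Z j k - curvature A y j k| ≤ C * ‖Z - y‖) →
      ∃ (φ : (ι → ℝ) → ℝ) (At : ι → (ι → ℝ) → ℝ) (ℓ : Matrix ι ι ℝ) (β : ι → (ι → ℝ) → ℝ),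
        ContDiff ℝ ∞ φ ∧ (∀ j, ContDiff ℝ ∞ (At j)) ∧
        (∀ Z, ‖Z - y‖ ≤ r → ∀ j, At j Z = A j Z - fderiv ℝ φ Z (Pi.single j 1)) ∧
        (∀ Z j k, |curvature At Z j k - curvature A y j k| ≤ C' * r) ∧
        (∀ j, ContDiff ℝ ∞ (β j) ∧ HasCompactSupport (β j)) ∧
        (∀ j Z, At j Z = ∑ k, ℓ j k * (Z k - y k) + β j Z) := by
  obtain ⟨Cχ, hCχ0, hCχ⟩ := exists_cutoff_fderiv_bound (ι := ι)
  refine ⟨2 * C + 8 * Cχ * (Fintype.card ι * C), by positivity, fun A hA y r hr hB => ?_⟩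
  obtain ⟨φ, hφ, hbound⟩ := exists_radial_gauge A hA y C hC hB
  set N : ℝ := ((Fintype.card ι : ℕ) : ℝ) with hN
  let B0 := curvature A y
  have hB0 : ∀ j k, B0 j k = - B0 k j := fun j k => by simp [B0, curvature]
  let lin : ι → (ι → ℝ) → ℝ := fun j Z => 2⁻¹ * ∑ k, B0 k j * (Z k - y k)
  let θ : ι → (ι → ℝ) → ℝ := fun j Z => A j Z - fderiv ℝ φ Z (Pi.single j 1) - lin j Z
  have hlin : ∀ j, ContDiff ℝ ∞ (lin j) := fun j => contDiff_const.mul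
    (ContDiff.sum fun k _ => contDiff_const.mul ((contDiff_apply ℝ ℝ k).sub contDiff_const))
  have hlind : ∀ j k Z, fderiv ℝ (lin j) Z (Pi.single k 1) = 2⁻¹ * B0 k j := by
    intro j k Z
    have : HasFDerivAt (lin j) ((2⁻¹ : ℝ) • ∑ m, B0 m j •
        (ContinuousLinearMap.proj m : (ι → ℝ) →L[ℝ] ℝ)) Z := by
      refine HasFDerivAt.const_mul (HasFDerivAt.fun_sum fun m _ => ?_) _
      exact ((ContinuousLinearMap.proj (R := ℝ) (φ := fun _ : ι => ℝ) m).hasFDerivAt.sub_const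
        (y m)).const_mul _
    rw [this.fderiv]
    simp [Pi.single_apply]
  have hθ : ∀ j, ContDiff ℝ ∞ (θ j) := fun j =>
    ((hA j).sub (contDiff_fderiv_single hφ _)).sub (hlin j)
  have hθb : ∀ j Z, |θ j Z| ≤ N * C * ‖Z - y‖ ^ 2 := fun j Z => hbound Z j
  have hθc : ∀ Z j k, curvature θ Z j k = curvature A Z j k - B0 j k := by
    intro Z j k
    have h1 : curvature (fun j Z => A j Z - fderiv ℝ φ Z (Pi.single j 1)) = curvature A :=
      curvature_sub_gradient A hA φ hφ
    have h2 : ∀ j v, fderiv ℝ (θ j) Z v =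
        fderiv ℝ (fun Z => A j Z - fderiv ℝ φ Z (Pi.single j 1)) Z v - fderiv ℝ (lin j) Z v := by
      intro j v
      have : fderiv ℝ (θ j) Z = _ := fderiv_fun_sub
        (((hA j).sub (contDiff_fderiv_single hφ _)).differentiable (by simp) Z)
        ((hlin j).differentiable (by simp) Z)
      rw [this]
      rfl
    rw [← h1]
    simp only [curvature, h2, hlind]
    rw [hB0 k j]
    ring
  let β : ι → (ι → ℝ) → ℝ := fun j Z => cutoffAt y r Z * θ j Z
  have hβ : ∀ j, ContDiff ℝ ∞ (β j) := fun j => (cutoffAt_contDiff y r).mul (hθ j)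
  refine ⟨φ, fun j Z => lin j Z + β j Z, fun j k => 2⁻¹ * B0 k j, β, hφ,
    fun j => (hlin j).add (hβ j), ?_, ?_, fun j => ⟨hβ j, (cutoffAt_hasCompactSupport y hr).mul_right⟩,
    ?_⟩
  · intro Z hZ j
    simp only [β, θ, cutoffAt_eq_one hr hZ]
    ring
  · intro Z j k
    have hd : ∀ j v, fderiv ℝ (fun Z => lin j Z + β j Z) Z v = fderiv ℝ (lin j) Z v +
        (fderiv ℝ (cutoffAt y r) Z v * θ j Z + cutoffAt y r Z * fderiv ℝ (θ j) Z v) := by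
      intro j v
      have h1 : fderiv ℝ (β j) Z = _ := fderiv_fun_mul
        ((cutoffAt_contDiff y r).differentiable (by simp) Z) ((hθ j).differentiable (by simp) Z)
      rw [fderiv_fun_add ((hlin j).differentiable (by simp) Z)
        ((hβ j).differentiable (by simp) Z), h1]
      simp
      ring
    have heq : curvature (fun j Z => lin j Z + β j Z) Z j k - curvature A y j k =
        cutoffAt y r Z * curvature θ Z j k +
          (fderiv ℝ (cutoffAt y r) Z (Pi.single j 1) * θ k Z -
            fderiv ℝ (cutoffAt y r) Z (Pi.single k 1) * θ j Z) := by
      simp only [curvature, hd, hlind]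
      change _ - B0 j k = _
      rw [hB0 k j]
      ring
    rw [heq]
    rcases lt_or_ge (2 * r) ‖Z - y‖ with hZ | hZ
    · rw [cutoffAt_eq_zero hr hZ.le, cutoffAt_fderiv_eq_zero hr hZ, cutoffAt_fderiv_eq_zero hr hZ]
      simp only [zero_mul, sub_zero, add_zero, abs_zero]
      positivity
    · have hsq : ‖Z - y‖ ^ 2 ≤ 4 * r ^ 2 := by
        have := pow_le_pow_left₀ (norm_nonneg _) hZ 2
        linarith [this, mul_pow 2 r 2]
      have hNC : 0 ≤ N * C := by positivity
      have h1 : ∀ j k, |fderiv ℝ (cutoffAt y r) Z (Pi.single j 1) * θ k Z| ≤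
          4 * Cχ * (N * C) * r := by
        intro j k
        rw [abs_mul, cutoffAt_fderiv, abs_mul, abs_of_pos (inv_pos.2 hr)]
        calc _ ≤ r⁻¹ * Cχ * (N * C * (4 * r ^ 2)) := by
              refine mul_le_mul (mul_le_mul_of_nonneg_left (hCχ _ _) (by positivity))
                ((hθb k Z).trans (mul_le_mul_of_nonneg_left hsq hNC)) (abs_nonneg _)
                (by positivity)
          _ = _ := by field_simp
      have h2 : |cutoffAt y r Z * curvature θ Z j k| ≤ 2 * C * r := by
        rw [abs_mul, hθc, abs_of_nonneg (cutoffAt_mem_Icc y r Z).1]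
        calc _ ≤ 1 * (C * (2 * r)) := mul_le_mul (cutoffAt_mem_Icc y r Z).2
              ((hB Z j k).trans (mul_le_mul_of_nonneg_left hZ hC)) (abs_nonneg _) zero_le_one
          _ = _ := by ring
      calc _ ≤ 2 * C * r + (4 * Cχ * (N * C) * r + 4 * Cχ * (N * C) * r) :=
            (abs_add_le _ _).trans (add_le_add h2
              ((abs_sub _ _).trans (add_le_add (h1 j k) (h1 k j))))
        _ = _ := by ring
  · intro j Z
    simp only [lin, Finset.mul_sum]
    congr 1
    exact Finset.sum_congr rfl fun k _ => by ring

end CutoffPotential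

section EllipticEstimate

variable {ι : Type} [Fintype ι] {E : Type*} [NormedAddCommGroup E] [InnerProductSpace ℂ E]

theorem sum_norm_sq_symm_eq (e : ι → E →ₗ[ℂ] E)
    (hsym : ∀ k x y, inner ℂ (e k x) y = inner ℂ x (e k y)) (x : E) :
    ∑ k, ‖e k x‖ ^ 2 = (inner ℂ x (∑ k, e k (e k x))).re := by
  rw [inner_sum, Complex.re_sum]
  exact Finset.sum_congr rfl fun k _ => by rw [← hsym, re_inner_self]

theorem sum_norm_sq_symm_le (e : ι → E →ₗ[ℂ] E)
    (hsym : ∀ k x y, inner ℂ (e k x) y = inner ℂ x (e k y)) (x : E) :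
    ∑ k, ‖e k x‖ ^ 2 ≤ ‖∑ k, e k (e k x)‖ * ‖x‖ := by
  rw [sum_norm_sq_symm_eq e hsym, mul_comm]
  exact (Complex.re_le_norm _).trans (norm_inner_le_norm _ _)

/-- Second order products are controlled by the sum of squares, up to commutators. -/
theorem norm_symm_symm_le (e : ι → E →ₗ[ℂ] E)
    (hsym : ∀ k x y, inner ℂ (e k x) y = inner ℂ x (e k y)) {F : ℝ} (hF : 0 ≤ F)
    (hcomm : ∀ j k x, ‖e j (e k x) - e k (e j x)‖ ≤ F * ‖x‖) (x : E) (j k : ι) :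
    ‖e j (e k x)‖ ≤ 2 * ‖∑ k, e k (e k x)‖ + 2 * (Fintype.card ι * F) * ‖x‖ := by
  set a := ‖∑ k, e k (e k x)‖ with ha
  set b := ‖x‖ with hb
  set N : ℝ := ((Fintype.card ι : ℕ) : ℝ) with hN
  have ha0 : 0 ≤ a := norm_nonneg _
  have hb0 : 0 ≤ b := norm_nonneg _
  have hN0 : 0 ≤ N := Nat.cast_nonneg _
  have hid : ∀ j k, ‖e j (e k x)‖ ^ 2 = (inner ℂ (e j (e j x)) (e k (e k x))).re -
      (inner ℂ (e k (e j x) - e j (e k x)) (e j (e k x))).re -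
      (inner ℂ (e j x) (e j (e k (e k x)) - e k (e j (e k x)))).re := by
    intro j k
    rw [inner_sub_left, inner_sub_right, ← hsym j (e j x), ← hsym k (e j x), ← re_inner_self]
    simp only [Complex.sub_re]
    ring
  have hle : ∀ j k, ‖e j (e k x)‖ ^ 2 ≤ (inner ℂ (e j (e j x)) (e k (e k x))).re +
      (‖e j (e k x)‖ ^ 2 / 2 + F ^ 2 * b ^ 2 / 2) +
      F * (‖e j x‖ ^ 2 / 2 + ‖e k x‖ ^ 2 / 2) := by
    intro j k
    have h1 : -(inner ℂ (e k (e j x) - e j (e k x)) (e j (e k x))).re ≤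
        F * b * ‖e j (e k x)‖ := by
      rw [← Complex.neg_re]
      refine (Complex.re_le_norm _).trans ?_
      rw [norm_neg]
      exact (norm_inner_le_norm _ _).trans
        (mul_le_mul_of_nonneg_right (hcomm k j x) (norm_nonneg _))
    have h2 : -(inner ℂ (e j x) (e j (e k (e k x)) - e k (e j (e k x)))).re ≤
        ‖e j x‖ * (F * ‖e k x‖) := by
      rw [← Complex.neg_re]
      refine (Complex.re_le_norm _).trans ?_
      rw [norm_neg]
      exact (norm_inner_le_norm _ _).trans
        (mul_le_mul_of_nonneg_left (hcomm j k (e k x)) (norm_nonneg _))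
    have h3 : F * b * ‖e j (e k x)‖ ≤ ‖e j (e k x)‖ ^ 2 / 2 + F ^ 2 * b ^ 2 / 2 := by
      linarith [sq_nonneg (F * b - ‖e j (e k x)‖)]
    have h4 : ‖e j x‖ * (F * ‖e k x‖) ≤ F * (‖e j x‖ ^ 2 / 2 + ‖e k x‖ ^ 2 / 2) := by
      have : ‖e j x‖ * ‖e k x‖ ≤ ‖e j x‖ ^ 2 / 2 + ‖e k x‖ ^ 2 / 2 := by
        linarith [sq_nonneg (‖e j x‖ - ‖e k x‖)]
      linarith [mul_le_mul_of_nonneg_left this hF]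
    linarith [hid j k]
  set S := ∑ j, ∑ k, ‖e j (e k x)‖ ^ 2 with hS
  set Q := ∑ k, ‖e k x‖ ^ 2 with hQ
  have hQle : Q ≤ a * b := sum_norm_sq_symm_le e hsym x
  have hmain : S ≤ a ^ 2 + (S / 2 + N * (N * (F ^ 2 * b ^ 2 / 2))) + F * (N * Q) := by
    have hsum := Finset.sum_le_sum fun j (_ : j ∈ Finset.univ) =>
      Finset.sum_le_sum fun k (_ : k ∈ Finset.univ) => hle j k
    have hin : ∑ j, ∑ k, (inner ℂ (e j (e j x)) (e k (e k x))).re = a ^ 2 := by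
      rw [ha, ← re_inner_self, sum_inner, Complex.re_sum]
      exact Finset.sum_congr rfl fun j _ => by rw [inner_sum, Complex.re_sum]
    refine hsum.trans (le_of_eq ?_)
    simp only [Finset.sum_add_distrib, ← Finset.mul_sum, ← Finset.sum_div, hin, ← hS,
      Finset.sum_const, Finset.card_univ, nsmul_eq_mul, ← hN, ← hQ]
    ring
  have hFN : F * (N * Q) ≤ F * N * (a * b) := by
    rw [← mul_assoc]
    exact mul_le_mul_of_nonneg_left hQle (by positivity)
  have hSle : S ≤ (2 * a + 2 * (N * F) * b) ^ 2 := by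
    have h0 : 0 ≤ (N * F * b) ^ 2 := sq_nonneg _
    have h1 : 0 ≤ N * F * b * a := by positivity
    linarith [sq_nonneg a]
  have hterm : ‖e j (e k x)‖ ^ 2 ≤ S :=
    (Finset.single_le_sum (f := fun k => ‖e j (e k x)‖ ^ 2) (fun _ _ => sq_nonneg _)
      (Finset.mem_univ k)).trans
    (Finset.single_le_sum (f := fun j => ∑ k, ‖e j (e k x)‖ ^ 2)
      (fun _ _ => Finset.sum_nonneg fun _ _ => sq_nonneg _) (Finset.mem_univ j))
  exact le_of_sq_le_sq (hterm.trans hSle) (by positivity)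

end EllipticEstimate

section Resolvent

open scoped ContDiff ComplexConjugate SchwartzMap LineDeriv Laplacian

variable {ι : Type} [Fintype ι]

theorem exists_schwartz_resolvent (f : 𝓢(EuclideanSpace ℝ ι, ℂ)) :
    ∃ w : 𝓢(EuclideanSpace ℝ ι, ℂ), w - ((2 * Real.pi) ^ 2)⁻¹ • Δ w = f := by
  let m : EuclideanSpace ℝ ι → ℝ := fun x => (1 + ‖x‖ ^ 2) ^ (-1 : ℝ)
  let q : EuclideanSpace ℝ ι → ℝ := fun x => ‖x‖ ^ 2
  have hm : m.HasTemperateGrowth := Function.hasTemperateGrowth_one_add_norm_sq_rpow _ _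
  have hq : q.HasTemperateGrowth := Function.hasTemperateGrowth_norm_sq _
  refine ⟨SchwartzMap.fourierMultiplierCLM ℂ m f, ?_⟩
  have h1 : Δ (SchwartzMap.fourierMultiplierCLM ℂ m f) = -(2 * Real.pi) ^ 2 •
      SchwartzMap.fourierMultiplierCLM ℂ q (SchwartzMap.fourierMultiplierCLM ℂ m f) :=
    SchwartzMap.laplacian_eq_fourierMultiplierCLM _
  have h2 : ∀ u : 𝓢(EuclideanSpace ℝ ι, ℂ), u = SchwartzMap.fourierMultiplierCLM ℂ
      (fun _ : EuclideanSpace ℝ ι => (1 : ℝ)) u := fun u => by simp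
  have hpi : (2 * Real.pi) ^ 2 ≠ 0 := by positivity
  rw [h1, smul_smul, mul_neg, inv_mul_cancel₀ hpi, neg_one_smul, sub_neg_eq_add,
    SchwartzMap.fourierMultiplierCLM_fourierMultiplierCLM_apply hq hm]
  have h3 := SchwartzMap.fourierMultiplierCLM_sum (𝕜 := ℝ) ℂ (s := Finset.univ)
    (g := fun b : Bool => if b then m else q * m) (by
      intro i _
      cases i
      · simpa using hq.mul hm
      · simpa using hm)
  have h4 : (∑ b : Bool, (fun b : Bool => if b then m else q * m) b ·) =
      fun _ : EuclideanSpace ℝ ι => (1 : ℝ) := by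
    funext x
    have : (1 + ‖x‖ ^ 2) ≠ 0 := by positivity
    simp only [Fintype.sum_bool, m, q, if_true, Real.rpow_neg_one]
    simp
    field_simp
  conv_rhs => rw [h2 f, ← h4, h3]
  simp

theorem integrable_schwartz_norm_sq (u : 𝓢(ι → ℝ, ℂ)) : Integrable fun Z => ‖u Z‖ ^ 2 := by
  have := (u.memLp 2 volume).integrable_norm_pow (by norm_num)
  simpa using this

/-- Solvability of constant coefficient elliptic equations, with energy estimate. -/
theorem exists_schwartz_solution (b : Module.Basis ι ℝ (ι → ℝ)) {T : ℝ} (hT : 0 < T)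
    (f : TestFn ι) : ∃ w : 𝓢(ι → ℝ, ℂ),
      (∀ Z, T * w Z - ∑ k, (∂_{b k} (∂_{b k} w)) Z = f Z) ∧
      ∫ Z, ‖w Z‖ ^ 2 ≤ T⁻¹ * (T⁻¹ * ‖f‖ ^ 2) ∧
      ∀ k, ∫ Z, ‖(∂_{b k} w) Z‖ ^ 2 ≤ T⁻¹ * ‖f‖ ^ 2 := by
  classical
  let σ : ℝ := Real.sqrt T / (2 * Real.pi)
  have hσ : σ ≠ 0 := by positivity
  have hσ2 : σ ^ 2 = T * ((2 * Real.pi) ^ 2)⁻¹ := by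
    rw [div_pow, Real.sq_sqrt hT.le, div_eq_mul_inv]
  let G₀ : (ι → ℝ) ≃ₗ[ℝ] EuclideanSpace ℝ ι :=
    (b.equivFun.trans (WithLp.linearEquiv 2 ℝ (ι → ℝ)).symm).trans
      (LinearEquiv.smulOfNeZero ℝ _ σ hσ)
  let G : (ι → ℝ) ≃L[ℝ] EuclideanSpace ℝ ι := G₀.toContinuousLinearEquiv
  have hG : ∀ k, G (b k) = σ • EuclideanSpace.basisFun ι ℝ k := by
    intro k
    change σ • (WithLp.toLp 2 (b.equivFun (b k))) = _
    rw [EuclideanSpace.basisFun_apply]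
    congr 1
    ext i
    simp [eq_comm]
  obtain ⟨w₀, hw₀⟩ := exists_schwartz_resolvent
    (SchwartzMap.compCLMOfContinuousLinearEquiv ℂ G.symm (f.compact.toSchwartzMap f.smooth))
  let w : 𝓢(ι → ℝ, ℂ) := SchwartzMap.compCLMOfContinuousLinearEquiv ℂ G (((T⁻¹ : ℝ) : ℂ) • w₀)
  have hdd : ∀ k, ∂_{b k} (∂_{b k} w) = SchwartzMap.compCLMOfContinuousLinearEquiv ℂ G
      (((T⁻¹ : ℝ) : ℂ) • (σ ^ 2 • ∂_{EuclideanSpace.basisFun ι ℝ k}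
        (∂_{EuclideanSpace.basisFun ι ℝ k} w₀))) := by
    intro k
    simp only [w, SchwartzMap.lineDerivOp_compCLMOfContinuousLinearEquiv, hG]
    congr 1
    simp only [LineDeriv.lineDerivOp_smul, LineDeriv.lineDerivOp_left_smul, smul_smul, sq]
  have heq : ∀ Z, T * w Z - ∑ k, (∂_{b k} (∂_{b k} w)) Z = f Z := by
    intro Z
    have h1 := congrArg (fun u : 𝓢(EuclideanSpace ℝ ι, ℂ) => u (G Z)) hw₀
    rw [SchwartzMap.laplacian_eq_sum (EuclideanSpace.basisFun ι ℝ)] at h1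
    simp only [hdd]
    simp only [SchwartzMap.compCLMOfContinuousLinearEquiv_apply, Function.comp,
      _root_.sub_apply, _root_.smul_apply, _root_.sum_apply, w, G.symm_apply_apply] at h1 ⊢
    have hT' : (T : ℂ) ≠ 0 := by exact_mod_cast hT.ne'
    change _ = f Z at h1
    rw [← h1, hσ2]
    simp only [Complex.real_smul, smul_eq_mul, ← Finset.mul_sum]
    push_cast
    field_simp
  let L : ℂ →L[ℝ] ℂ →L[ℝ] ℂ :=
    (ContinuousLinearMap.mul ℝ ℂ).comp Complex.conjCLE.toContinuousLinearMap
  have hL : ∀ x y, L x y = conj x * y := fun x y => rfl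
  have hLi : ∀ u v : 𝓢(ι → ℝ, ℂ), Integrable fun Z => conj (u Z) * v Z := fun u v =>
    (SchwartzMap.pairing L u v).integrable
  have hn : ∀ z : ℂ, conj z * z = ((‖z‖ ^ 2 : ℝ) : ℂ) := fun z => by
    rw [mul_comm, Complex.mul_conj, Complex.normSq_eq_norm_sq]
  have hparts : ∀ k, ∫ Z, conj (w Z) * (∂_{b k} (∂_{b k} w)) Z =
      -((∫ Z, ‖(∂_{b k} w) Z‖ ^ 2 : ℝ) : ℂ) := by
    intro k
    have := SchwartzMap.integral_bilinear_lineDerivOp_right_eq_neg_left (μ := volume)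
      w (∂_{b k} w) L (b k)
    simp only [hL, hn] at this
    rw [this, integral_complex_ofReal]
  have hf : ∀ Z, conj (w Z) * f Z = T * (conj (w Z) * w Z) -
      ∑ k, conj (w Z) * (∂_{b k} (∂_{b k} w)) Z := by
    intro Z
    rw [← heq, mul_sub, Finset.mul_sum]
    ring
  have hint : ∫ Z, conj (w Z) * f Z = ((T * (∫ Z, ‖w Z‖ ^ 2) +
      ∑ k, ∫ Z, ‖(∂_{b k} w) Z‖ ^ 2 : ℝ) : ℂ) := by
    simp only [hf]
    rw [integral_sub ((hLi w w).const_mul _) (integrable_finsetSum _ fun k _ => hLi _ _),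
      integral_finsetSum _ fun k _ => hLi _ _, integral_const_mul]
    simp only [hparts, hn]
    rw [integral_complex_ofReal]
    push_cast
    simp
  have hw2 := integrable_schwartz_norm_sq w
  have hre : T * (∫ Z, ‖w Z‖ ^ 2) + ∑ k, ∫ Z, ‖(∂_{b k} w) Z‖ ^ 2 ≤
      T / 2 * (∫ Z, ‖w Z‖ ^ 2) + T⁻¹ / 2 * ‖f‖ ^ 2 := by
    calc _ = (∫ Z, conj (w Z) * f Z).re := by rw [hint, Complex.ofReal_re]
      _ ≤ ‖∫ Z, conj (w Z) * f Z‖ := Complex.re_le_norm _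
      _ ≤ ∫ Z, ‖conj (w Z) * f Z‖ := norm_integral_le_integral_norm _
      _ ≤ ∫ Z, (T / 2 * ‖w Z‖ ^ 2 + T⁻¹ / 2 * ‖f Z‖ ^ 2) := by
          refine integral_mono (hLi w (f.compact.toSchwartzMap f.smooth)).norm
            ((hw2.const_mul _).add (f.integrable_norm_sq.const_mul _)) fun Z => ?_
          have h1 : ‖conj (w Z) * f Z‖ = ‖w Z‖ * ‖f Z‖ := by rw [norm_mul, RCLike.norm_conj]
          have h2 : T / 2 * ‖w Z‖ ^ 2 + T⁻¹ / 2 * ‖f Z‖ ^ 2 - ‖w Z‖ * ‖f Z‖ =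
              T⁻¹ / 2 * (T * ‖w Z‖ - ‖f Z‖) ^ 2 := by
            field_simp
            ring
          have h3 : 0 ≤ T⁻¹ / 2 * (T * ‖w Z‖ - ‖f Z‖) ^ 2 := by positivity
          simp only [h1]
          linarith
      _ = _ := by
          rw [integral_add (hw2.const_mul _) (f.integrable_norm_sq.const_mul _),
            integral_const_mul, integral_const_mul, TestFn.norm_sq]
  have h0 : 0 ≤ ∫ Z, ‖w Z‖ ^ 2 := integral_nonneg fun Z => sq_nonneg _
  have hk0 : ∀ k, 0 ≤ ∫ Z, ‖(∂_{b k} w) Z‖ ^ 2 := fun k => integral_nonneg fun Z => sq_nonneg _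
  have hf0 : 0 ≤ T⁻¹ * ‖f‖ ^ 2 := by positivity
  refine ⟨w, heq, ?_, fun k => ?_⟩
  · have : T * ∫ Z, ‖w Z‖ ^ 2 ≤ T⁻¹ * ‖f‖ ^ 2 := by
      linarith [Finset.sum_nonneg fun k (_ : k ∈ Finset.univ) => hk0 k]
    rwa [inv_mul_eq_div T (_ * _), le_div_iff₀' hT]
  · have := Finset.single_le_sum (fun k _ => hk0 k) (Finset.mem_univ k)
    have h2 : 0 ≤ T * ∫ Z, ‖w Z‖ ^ 2 := by positivity
    linarith

end Resolvent

section Lattice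

open scoped ContDiff ComplexConjugate

variable {ι : Type} [Fintype ι]

/-- The point of index `i` in the cubic lattice of mesh `r`. -/
def latticePt (r : ℝ) (i : ι → ℤ) : ι → ℝ := fun j => r * i j

theorem card_filter_latticePt_le [DecidableEq ι] {r : ℝ} (hr : 0 < r) (R : ℕ)
    (s : Finset (ι → ℤ)) (Z : ι → ℝ) :
    (s.filter fun i => ‖Z - latticePt r i‖ ≤ R * r).card ≤ (2 * R + 1) ^ Fintype.card ι := by
  let t : ι → Finset ℤ := fun j => Finset.Icc (⌊Z j / r⌋ - R + 1) (⌊Z j / r⌋ + R) ∪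
    {⌊Z j / r⌋ - R}
  have ht : ∀ j, (t j).card ≤ 2 * R + 1 := by
    intro j
    refine (Finset.card_union_le _ _).trans ?_
    simp only [Int.card_Icc, Finset.card_singleton]
    omega
  refine (Finset.card_le_card (t := Fintype.piFinset t) fun i hi => ?_).trans ?_
  · rw [Fintype.mem_piFinset]
    intro j
    have h1 := (norm_le_pi_norm (Z - latticePt r i) j).trans (Finset.mem_filter.1 hi).2
    simp only [Pi.sub_apply, latticePt, Real.norm_eq_abs] at h1
    have h2 : |Z j / r - i j| ≤ R := by
      have : Z j - r * i j = r * (Z j / r - i j) := by field_simp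
      rw [this, abs_mul, abs_of_pos hr, mul_comm] at h1
      exact le_of_mul_le_mul_right h1 hr
    obtain ⟨h3, h4⟩ := abs_le.1 h2
    have h5 : i j ≤ ⌊Z j / r⌋ + R := by
      have : i j - (R : ℤ) ≤ ⌊Z j / r⌋ := Int.le_floor.2 (by push_cast; linarith)
      linarith
    have h6 : ⌊Z j / r⌋ - R ≤ i j := by
      have : ((⌊Z j / r⌋ - R : ℤ) : ℝ) ≤ (i j : ℝ) := by
        push_cast
        linarith [Int.floor_le (Z j / r)]
      exact_mod_cast this
    simp only [t, Finset.mem_union, Finset.mem_Icc, Finset.mem_singleton]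
    omega
  · rw [Fintype.card_piFinset]
    exact (Finset.prod_le_prod' fun j _ => ht j).trans (by simp)

theorem exists_finset_latticePt [DecidableEq ι] {r : ℝ} (hr : 0 < r) (ρ : ℝ) :
    ∃ s : Finset (ι → ℤ), ∀ Z, ‖Z‖ ≤ ρ → ∃ i ∈ s, ‖Z - latticePt r i‖ ≤ r := by
  refine ⟨Fintype.piFinset fun _ => Finset.Icc ⌊-ρ / r⌋ ⌊ρ / r⌋, fun Z hZ =>
    ⟨fun j => ⌊Z j / r⌋, ?_, ?_⟩⟩
  · rw [Fintype.mem_piFinset]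
    intro j
    have h := abs_le.1 ((norm_le_pi_norm Z j).trans hZ)
    exact Finset.mem_Icc.2 ⟨Int.floor_le_floor (by gcongr; exact h.1),
      Int.floor_le_floor (by gcongr; exact h.2)⟩
  · refine (pi_norm_le_iff_of_nonneg hr.le).2 fun j => ?_
    have h1 := Int.floor_le (Z j / r)
    have h2 := Int.lt_floor_add_one (Z j / r)
    have h3 : Z j = r * (Z j / r) := by field_simp
    rw [Pi.sub_apply, latticePt, Real.norm_eq_abs, abs_le]
    have h4 := mul_le_mul_of_nonneg_left h1 hr.le
    have h5 := mul_le_mul_of_nonneg_left h2.le hr.le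
    constructor <;> linarith

theorem sum_latticePt_le [DecidableEq ι] {r : ℝ} (hr : 0 < r) (R : ℕ) (s : Finset (ι → ℤ))
    (Z : ι → ℝ) (c : (ι → ℤ) → ℝ) {B : ℝ}
    (hc : ∀ i, c i ≤ B) (h0 : ∀ i, R * r < ‖Z - latticePt r i‖ → c i = 0) (hB : 0 ≤ B) :
    ∑ i ∈ s, c i ≤ (2 * R + 1) ^ Fintype.card ι * B := by
  have : ∑ i ∈ s, c i = ∑ i ∈ s.filter fun i => ‖Z - latticePt r i‖ ≤ R * r, c i := by
    refine (Finset.sum_filter_of_ne fun i _ hi => ?_).symm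
    by_contra h
    exact hi (h0 i (not_le.1 h))
  rw [this]
  calc _ ≤ ∑ i ∈ s.filter fun i => ‖Z - latticePt r i‖ ≤ R * r, B :=
        Finset.sum_le_sum fun i _ => hc i
    _ = (s.filter fun i => ‖Z - latticePt r i‖ ≤ R * r).card * B := by
        rw [Finset.sum_const, nsmul_eq_mul]
    _ ≤ _ := by
        refine mul_le_mul_of_nonneg_right ?_ hB
        exact_mod_cast card_filter_latticePt_le hr R s Z

/-- Almost orthogonality of functions supported near lattice points. -/
theorem TestFn.norm_sum_sq_le [DecidableEq ι] {r : ℝ} (hr : 0 < r) (R : ℕ) (s : Finset (ι → ℤ))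
    (u : (ι → ℤ) → TestFn ι) (h0 : ∀ i Z, R * r < ‖Z - latticePt r i‖ → u i Z = 0) :
    ‖∑ i ∈ s, u i‖ ^ 2 ≤ (2 * R + 1) ^ Fintype.card ι * ∑ i ∈ s, ‖u i‖ ^ 2 := by
  rw [Finset.mul_sum]
  refine TestFn.norm_sq_le_sum s _ (fun _ => (2 * R + 1 : ℝ) ^ Fintype.card ι) u fun Z => ?_
  set s' := s.filter fun i => ‖Z - latticePt r i‖ ≤ R * r with hs'
  have h1 : (∑ i ∈ s, u i) Z = ∑ i ∈ s', u i Z := by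
    rw [TestFn.sum_apply]
    refine (Finset.sum_filter_of_ne fun i _ hi => ?_).symm
    by_contra h
    exact hi (h0 i Z (not_le.1 h))
  have h2 : ‖(∑ i ∈ s, u i) Z‖ ^ 2 ≤ (∑ i ∈ s', ‖u i Z‖) ^ 2 := by
    rw [h1]
    exact pow_le_pow_left₀ (norm_nonneg _) (norm_sum_le _ _) 2
  have h3 : (s'.card : ℝ) ≤ (2 * R + 1) ^ Fintype.card ι := by
    exact_mod_cast card_filter_latticePt_le hr R s Z
  calc _ ≤ (s'.card : ℝ) * ∑ i ∈ s', ‖u i Z‖ ^ 2 := h2.trans sq_sum_le_card_mul_sum_sq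
    _ ≤ (2 * R + 1) ^ Fintype.card ι * ∑ i ∈ s, ‖u i Z‖ ^ 2 :=
        mul_le_mul h3 (Finset.sum_le_sum_of_subset_of_nonneg (Finset.filter_subset _ _)
          fun _ _ _ => sq_nonneg _) (Finset.sum_nonneg fun _ _ => sq_nonneg _) (by positivity)
    _ = _ := Finset.mul_sum _ _ _

end Lattice

section MagneticLeibniz

open scoped ContDiff ComplexConjugate

namespace TestFn

variable {ι : Type} [Fintype ι]

theorem contDiff_fderiv_apply {f : (ι → ℝ) → ℂ} (hf : ContDiff ℝ ∞ f) (v : ι → ℝ) :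
    ContDiff ℝ ∞ fun Z => fderiv ℝ f Z v :=
  (hf.fderiv_right (m := ∞) (by simp)).clm_apply contDiff_const

theorem magOp_mulOp (h : ℝ) (v : ι → ℝ) (α : (ι → ℝ) → ℝ) (hα : ContDiff ℝ ∞ α)
    (f : (ι → ℝ) → ℂ) (hf : ContDiff ℝ ∞ f) (u : TestFn ι) :
    magOp h v α hα (mulOp f hf u) = mulOp f hf (magOp h v α hα u) +
      (Complex.I * h) • mulOp (fun Z => fderiv ℝ f Z v) (contDiff_fderiv_apply hf v) u := by
  ext Z
  rw [magOp_apply, fderiv_mulOp]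
  simp only [mulOp_apply, add_apply, smul_apply, magOp_apply]
  ring

theorem dirOp_eq_zero_of_isOpen (v : ι → ℝ) {u : TestFn ι} {O : Set (ι → ℝ)} (hO : IsOpen O)
    (hu : ∀ Z ∈ O, u Z = 0) : ∀ Z ∈ O, dirOp v u Z = 0 := by
  intro Z hZ
  have h1 : (u : (ι → ℝ) → ℂ) =ᶠ[nhds Z] fun _ => 0 :=
    Filter.eventually_of_mem (hO.mem_nhds hZ) hu
  rw [dirOp_apply, h1.fderiv_eq]
  simp

theorem magOp_eq_zero_of_isOpen (h : ℝ) (v : ι → ℝ) (α : (ι → ℝ) → ℝ) (hα : ContDiff ℝ ∞ α)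
    {u : TestFn ι} {O : Set (ι → ℝ)} (hO : IsOpen O) (hu : ∀ Z ∈ O, u Z = 0) :
    ∀ Z ∈ O, magOp h v α hα u Z = 0 := by
  intro Z hZ
  rw [magOp_apply, ← dirOp_apply, dirOp_eq_zero_of_isOpen v hO hu Z hZ, hu Z hZ]
  simp

theorem dirOp_translate (v z : ι → ℝ) {u u' : TestFn ι} (h : ∀ Z, u' Z = u (Z - z)) (Z : ι → ℝ) :
    dirOp v u' Z = dirOp v u (Z - z) := by
  have : (u' : (ι → ℝ) → ℂ) = fun Z => u (Z - z) := funext h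
  rw [dirOp_apply, dirOp_apply, this, fderiv_comp_sub]

theorem exists_bound (u : TestFn ι) : ∃ C, 0 ≤ C ∧ ∀ Z, ‖u Z‖ ≤ C := by
  obtain ⟨C, hC⟩ := u.cont.bounded_above_of_compact_support u.compact
  exact ⟨max C 0, le_max_right _ _, fun Z => (hC Z).trans (le_max_left _ _)⟩

theorem norm_mulOp_eq (f : (ι → ℝ) → ℂ) (hf : ContDiff ℝ ∞ f) (h1 : ∀ Z, ‖f Z‖ = 1)
    (u : TestFn ι) : ‖mulOp f hf u‖ = ‖u‖ := by
  have : ‖mulOp f hf u‖ ^ 2 = ‖u‖ ^ 2 := by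
    rw [norm_sq, norm_sq]
    simp [h1]
  exact (pow_left_inj₀ (norm_nonneg _) (norm_nonneg _) two_ne_zero).1 this

end TestFn
end MagneticLeibniz

section MagneticDensity

open scoped ContDiff ComplexConjugate SchwartzMap LineDeriv

open TestFn

variable {ι : Type} [Fintype ι]

/-- The cutoff of scale `r` about `y` as a test function. -/
def cutoffFn (y : ι → ℝ) (r : ℝ) (hr : 0 < r) : TestFn ι :=
  mk (fun Z => (cutoffAt y r Z : ℂ)) (cutoffAt_contDiff y r).complex_ofReal
    ((cutoffAt_hasCompactSupport y hr).comp_left (g := fun x : ℝ => (x : ℂ)) (by simp))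

theorem cutoffFn_apply (y : ι → ℝ) (r : ℝ) (hr : 0 < r) (Z : ι → ℝ) :
    cutoffFn y r hr Z = (cutoffAt y r Z : ℂ) := rfl

theorem magOp_comp_apply (v : ι → ℝ) (α : (ι → ℝ) → ℝ) (hα : ContDiff ℝ ∞ α) (u : TestFn ι)
    (Z : ι → ℝ) : magOp 1 v α hα (magOp 1 v α hα u) Z =
      -(dirOp v (dirOp v u) Z) + Complex.I * (fderiv ℝ α Z v : ℝ) * u Z +
        2 * Complex.I * α Z * dirOp v u Z + α Z * (α Z * u Z) := by
  have hof : fderiv ℝ (fun Z => (α Z : ℂ)) Z v = (fderiv ℝ α Z v : ℝ) := by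
    have := (Complex.ofRealCLM.hasFDerivAt (x := α Z)).comp Z
      (hα.differentiable (by simp) Z).hasFDerivAt
    exact congrArg (fun L => L v) this.fderiv
  simp only [magOp, LinearMap.add_apply, LinearMap.smul_apply, map_add, map_smul,
    TestFn.add_apply, TestFn.smul_apply, mulOp_apply, dirOp_apply _ (mulOp _ _ _), fderiv_mulOp, hof]
  rw [dirOp_apply v u]
  push_cast
  linear_combination (dirOp v (dirOp v u) Z) * Complex.I_sq

/-- Uniform bounds for the action of magnetic derivatives on cutoffs, after subtraction of the
value of the potential at the centre. -/
theorem exists_magOp_cutoff_bound (v : ι → ι → ℝ) (α : ι → (ι → ℝ) → ℝ)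
    (hα : ∀ k, ContDiff ℝ ∞ (α k)) {Cα : ℝ} (hCα : 0 ≤ Cα)
    (hlip : ∀ k Z Z', |α k Z - α k Z'| ≤ Cα * ‖Z - Z'‖)
    (hder : ∀ k Z, |fderiv ℝ (α k) Z (v k)| ≤ Cα) :
    ∃ C, 0 ≤ C ∧ ∀ (z : ι → ℝ) (k : ι) (Z : ι → ℝ),
      ‖magOp 1 (v k) (fun Z => α k Z - α k z) ((hα k).sub contDiff_const)
        (cutoffFn z 2 two_pos) Z‖ ≤ C ∧
      ‖magOp 1 (v k) (fun Z => α k Z - α k z) ((hα k).sub contDiff_const)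
        (magOp 1 (v k) (fun Z => α k Z - α k z) ((hα k).sub contDiff_const)
        (cutoffFn z 2 two_pos)) Z‖ ≤ C := by
  have h1 : ∀ k, ∃ C, 0 ≤ C ∧ ∀ Z, ‖dirOp (v k) (cutoffFn 0 2 two_pos) Z‖ ≤ C ∧
      ‖dirOp (v k) (dirOp (v k) (cutoffFn 0 2 two_pos)) Z‖ ≤ C := by
    intro k
    obtain ⟨C1, h1, h1'⟩ := exists_bound (dirOp (v k) (cutoffFn 0 2 two_pos))
    obtain ⟨C2, h2, h2'⟩ := exists_bound (dirOp (v k) (dirOp (v k) (cutoffFn 0 2 two_pos)))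
    exact ⟨max C1 C2, le_max_of_le_left h1, fun Z =>
      ⟨(h1' Z).trans (le_max_left _ _), (h2' Z).trans (le_max_right _ _)⟩⟩
  choose D hD0 hD using h1
  set D' := ∑ k, D k with hD'
  have hDle : ∀ k, D k ≤ D' := fun k =>
    Finset.single_le_sum (fun k _ => hD0 k) (Finset.mem_univ k)
  have hD'0 : 0 ≤ D' := Finset.sum_nonneg fun k _ => hD0 k
  refine ⟨(D' + 4 * Cα) + (D' + Cα + 2 * (4 * Cα) * D' + 4 * Cα * (4 * Cα)), by positivity,
    fun z k Z => ?_⟩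
  set α' : (ι → ℝ) → ℝ := fun Z => α k Z - α k z with hα'
  have hα's : ContDiff ℝ ∞ α' := (hα k).sub contDiff_const
  set χ := cutoffFn z 2 two_pos with hχ
  have htr : ∀ Z, χ Z = cutoffFn 0 2 two_pos (Z - z) := by
    intro Z
    simp [hχ, cutoffFn_apply, cutoffAt]
  have hd1 := dirOp_translate (v k) z htr
  have hd2 := dirOp_translate (v k) z hd1
  have hb1 : ‖dirOp (v k) χ Z‖ ≤ D' := by rw [hd1]; exact (hD k _).1.trans (hDle k)
  have hb2 : ‖dirOp (v k) (dirOp (v k) χ) Z‖ ≤ D' := by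
    rw [hd2]; exact (hD k _).2.trans (hDle k)
  have hb0 : ‖χ Z‖ ≤ 1 := by
    rw [hχ, cutoffFn_apply, Complex.norm_real, Real.norm_eq_abs,
      abs_of_nonneg (cutoffAt_mem_Icc _ _ _).1]
    exact (cutoffAt_mem_Icc _ _ _).2
  rcases lt_or_ge 4 ‖Z - z‖ with hZ | hZ
  · have hO : IsOpen {Z : ι → ℝ | 4 < ‖Z - z‖} :=
      isOpen_lt continuous_const (continuous_id.sub continuous_const).norm
    have hu : ∀ Z ∈ {Z : ι → ℝ | 4 < ‖Z - z‖}, χ Z = 0 := by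
      intro Z hZ
      have h4 : 4 < ‖Z - z‖ := hZ
      rw [hχ, cutoffFn_apply, cutoffAt_eq_zero two_pos (by linarith)]
      simp
    have h1 := magOp_eq_zero_of_isOpen 1 (v k) α' hα's hO hu
    have h2 := magOp_eq_zero_of_isOpen 1 (v k) α' hα's hO h1
    rw [h1 Z hZ, h2 Z hZ, norm_zero]
    exact ⟨by positivity, by positivity⟩
  · have ha : ‖(α' Z : ℂ)‖ ≤ 4 * Cα := by
      rw [Complex.norm_real, Real.norm_eq_abs]
      have := (hlip k Z z).trans (mul_le_mul_of_nonneg_left hZ hCα)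
      linarith
    have had : ‖((fderiv ℝ α' Z (v k) : ℝ) : ℂ)‖ ≤ Cα := by
      rw [Complex.norm_real, Real.norm_eq_abs, hα', fderiv_sub_const]
      exact hder k Z
    constructor
    · rw [magOp_apply, ← dirOp_apply]
      have h1 : ‖Complex.I * (1 : ℝ) * dirOp (v k) χ Z‖ ≤ D' := by simpa using hb1
      have h2 : ‖(α' Z : ℂ) * χ Z‖ ≤ 4 * Cα * 1 := by
        rw [norm_mul]; exact mul_le_mul ha hb0 (norm_nonneg _) (by positivity)
      refine (norm_add_le _ _).trans ?_
      have h3 : 0 ≤ D' + Cα + 2 * (4 * Cα) * D' + 4 * Cα * (4 * Cα) := by positivity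
      linarith
    · rw [magOp_comp_apply]
      have h1 : ‖-(dirOp (v k) (dirOp (v k) χ) Z)‖ ≤ D' := by rwa [norm_neg]
      have h2 : ‖Complex.I * ((fderiv ℝ α' Z (v k) : ℝ) : ℂ) * χ Z‖ ≤ Cα * 1 := by
        rw [norm_mul, norm_mul, Complex.norm_I, one_mul]
        exact mul_le_mul had hb0 (norm_nonneg _) hCα
      have h3 : ‖2 * Complex.I * (α' Z : ℂ) * dirOp (v k) χ Z‖ ≤ 2 * (4 * Cα) * D' := by
        rw [norm_mul, norm_mul, norm_mul, Complex.norm_I, mul_one, Complex.norm_ofNat]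
        exact mul_le_mul (mul_le_mul_of_nonneg_left ha two_pos.le) hb1 (norm_nonneg _)
          (by positivity)
      have h4 : ‖(α' Z : ℂ) * ((α' Z : ℂ) * χ Z)‖ ≤ 4 * Cα * (4 * Cα * 1) := by
        rw [norm_mul, norm_mul]
        exact mul_le_mul ha (mul_le_mul ha hb0 (norm_nonneg _) (by positivity)) (by positivity)
          (by positivity)
      refine (norm_add_le _ _).trans ((add_le_add ((norm_add_le _ _).trans (add_le_add
        ((norm_add_le _ _).trans (add_le_add h1 h2)) h3)) h4).trans ?_)
      linarith [mul_nonneg two_pos.le hCα]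

end MagneticDensity

section LocalParametrix

open scoped ContDiff ComplexConjugate SchwartzMap LineDeriv

open TestFn

variable {ι : Type} [Fintype ι]

/-- The unimodular function `exp(iφ)`. -/
def phase (φ : (ι → ℝ) → ℝ) (Z : ι → ℝ) : ℂ := Complex.exp (Complex.I * φ Z)

theorem phase_contDiff {φ : (ι → ℝ) → ℝ} (hφ : ContDiff ℝ ∞ φ) : ContDiff ℝ ∞ (phase φ) :=
  (contDiff_const.mul hφ.complex_ofReal).cexp

theorem norm_phase (φ : (ι → ℝ) → ℝ) (Z : ι → ℝ) : ‖phase φ Z‖ = 1 := by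
  rw [phase, mul_comm]
  exact Complex.norm_exp_ofReal_mul_I _

theorem phase_mul_neg (φ : (ι → ℝ) → ℝ) (Z : ι → ℝ) : phase φ Z * phase (-φ) Z = 1 := by
  rw [phase, phase, ← Complex.exp_add]
  simp

theorem fderiv_phase {φ : (ι → ℝ) → ℝ} (hφ : ContDiff ℝ ∞ φ) (Z v : ι → ℝ) :
    fderiv ℝ (phase φ) Z v = Complex.I * (fderiv ℝ φ Z v : ℝ) * phase φ Z := by
  have h1 := (Complex.ofRealCLM.hasFDerivAt (x := φ Z)).comp Z
      (hφ.differentiable (by simp) Z).hasFDerivAt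
  have h2 := (h1.const_mul Complex.I).cexp
  have h3 := congrArg (fun L => L v) h2.fderiv
  refine h3.trans ?_
  simp [phase]
  ring

/-- Gauge covariance of magnetic derivatives. -/
theorem magOp_phase (h : ℝ) (v : ι → ℝ) (α β : (ι → ℝ) → ℝ) (hα : ContDiff ℝ ∞ α)
    (hβ : ContDiff ℝ ∞ β) (φ : (ι → ℝ) → ℝ) (hφ : ContDiff ℝ ∞ φ)
    (hφβ : ∀ Z, β Z = α Z - h * fderiv ℝ φ Z v) (u : TestFn ι) :
    magOp h v α hα (mulOp (phase φ) (phase_contDiff hφ) u) =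
      mulOp (phase φ) (phase_contDiff hφ) (magOp h v β hβ u) := by
  ext Z
  rw [magOp_mulOp]
  simp only [TestFn.add_apply, TestFn.smul_apply, mulOp_apply, magOp_apply, fderiv_phase hφ, hφβ]
  push_cast
  linear_combination (h * phase φ Z * fderiv ℝ φ Z v * u Z) * Complex.I_sq

theorem norm_sum_two_mul_sq_le (a x y : ι → ℂ) (w : ℂ) {C : ℝ} (hx : ∀ k, ‖x k‖ ≤ C)
    (hy : ∀ k, ‖y k‖ ≤ C) : ‖∑ k, (2 * Complex.I * a k * x k + w * y k)‖ ^ 2 ≤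
      ∑ k : ι, Fintype.card ι * C ^ 2 * (8 * ‖a k‖ ^ 2 + 2 * ‖w‖ ^ 2) := by
  have h1 : ∀ k, ‖2 * Complex.I * a k * x k + w * y k‖ ≤ C * (2 * ‖a k‖ + ‖w‖) := by
    intro k
    refine (norm_add_le _ _).trans ?_
    simp only [norm_mul, Complex.norm_I, Complex.norm_ofNat, mul_one]
    have h2 := mul_le_mul_of_nonneg_left (hx k) (mul_nonneg two_pos.le (norm_nonneg (a k)))
    have h3 := mul_le_mul_of_nonneg_left (hy k) (norm_nonneg w)
    linarith
  calc _ ≤ (∑ k : ι, C * (2 * ‖a k‖ + ‖w‖)) ^ 2 :=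
        pow_le_pow_left₀ (norm_nonneg _)
          ((norm_sum_le _ _).trans (Finset.sum_le_sum fun k _ => h1 k)) 2
    _ ≤ Fintype.card ι * ∑ k : ι, (C * (2 * ‖a k‖ + ‖w‖)) ^ 2 := sq_sum_le_card_mul_sum_sq
    _ ≤ _ := by
        rw [Finset.mul_sum]
        refine Finset.sum_le_sum fun k _ => ?_
        rw [mul_pow, ← mul_assoc]
        refine mul_le_mul_of_nonneg_left ?_ (by positivity)
        linarith [sq_nonneg (2 * ‖a k‖ - ‖w‖)]

theorem norm_sq_le_of_schwartz (u : TestFn ι) (w : 𝓢(ι → ℝ, ℂ)) (D : ι → 𝓢(ι → ℝ, ℂ))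
    {M c : ℝ} (hw : ∫ Z, ‖w Z‖ ^ 2 ≤ M) (hD : ∀ k, ∫ Z, ‖D k Z‖ ^ 2 ≤ M) (hc : 0 ≤ c)
    (h : ∀ Z, ‖u Z‖ ^ 2 ≤ ∑ k : ι, c * (8 * ‖D k Z‖ ^ 2 + 2 * ‖w Z‖ ^ 2)) :
    ‖u‖ ^ 2 ≤ Fintype.card ι * (c * (10 * M)) := by
  have hi1 : ∀ k, Integrable fun Z => ‖D k Z‖ ^ 2 := fun k => integrable_schwartz_norm_sq _
  have hi : Integrable fun Z => ‖w Z‖ ^ 2 := integrable_schwartz_norm_sq _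
  have hi2 : ∀ k, Integrable fun Z => c * (8 * ‖D k Z‖ ^ 2 + 2 * ‖w Z‖ ^ 2) := fun k =>
    (((hi1 k).const_mul 8).add (hi.const_mul 2)).const_mul _
  rw [norm_sq]
  refine (integral_mono u.integrable_norm_sq (integrable_finsetSum _ fun k _ => hi2 k) h).trans ?_
  rw [integral_finsetSum _ fun k _ => hi2 k]
  calc _ ≤ ∑ k : ι, c * (10 * M) := by
        refine Finset.sum_le_sum fun k _ => ?_
        rw [integral_const_mul, integral_add ((hi1 k).const_mul 8) (hi.const_mul 2),
          integral_const_mul, integral_const_mul]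
        exact mul_le_mul_of_nonneg_left (by linarith [hD k]) hc
    _ = _ := by rw [Finset.sum_const, nsmul_eq_mul, Finset.card_univ]

set_option maxHeartbeats 400000 in
theorem exists_local_parametrix (b : Module.Basis ι ℝ (ι → ℝ)) (α : ι → (ι → ℝ) → ℝ)
    (hα : ∀ k, ContDiff ℝ ∞ (α k)) {Cα : ℝ} (hCα : 0 ≤ Cα)
    (hlip : ∀ k Z Z', |α k Z - α k Z'| ≤ Cα * ‖Z - Z'‖)
    (hder : ∀ k Z, |fderiv ℝ (α k) Z (b k)| ≤ Cα) :
    ∃ C, 0 ≤ C ∧ ∀ (z : ι → ℝ) (T : ℝ), 1 ≤ T → ∀ F : TestFn ι, (∀ Z, 2 ≤ ‖Z - z‖ → F Z = 0) →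
      ∃ W : TestFn ι,
        ‖∑ k, magOp 1 (b k) (α k) (hα k) (magOp 1 (b k) (α k) (hα k) W) + (T : ℂ) • W - F‖ ^ 2
          ≤ C / T * ‖F‖ ^ 2 ∧
        ∀ Z, 4 < ‖Z - z‖ →
          (∑ k, magOp 1 (b k) (α k) (hα k) (magOp 1 (b k) (α k) (hα k) W) + (T : ℂ) • W - F) Z
            = 0 := by
  obtain ⟨C, hC0, hC⟩ := exists_magOp_cutoff_bound (fun k => b k) α hα hCα hlip hder
  refine ⟨10 * (C * Fintype.card ι) ^ 2, by positivity, fun z T hT F hF => ?_⟩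
  have hT0 : 0 < T := by linarith
  set ψ : (ι → ℝ) → ℝ := fun Z => ∑ k, α k z * b.coord k Z with hψ
  have hψl : ψ = (∑ k, α k z • (LinearMap.toContinuousLinearMap (b.coord k))) := by
    funext Z
    simp [hψ, _root_.sum_apply, _root_.smul_apply]
  have hψs : ContDiff ℝ ∞ ψ := by rw [hψl]; exact ContinuousLinearMap.contDiff _
  have hψd : ∀ k Z, fderiv ℝ ψ Z (b k) = α k z := by
    intro k Z
    rw [hψl, ContinuousLinearMap.fderiv]
    classical
    simp [_root_.sum_apply, _root_.smul_apply, Finsupp.single_apply]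
  have hψn : ContDiff ℝ ∞ (-ψ) := hψs.neg
  set F' := mulOp (phase (-ψ)) (phase_contDiff hψn) F with hF'
  have hFF' : mulOp (phase ψ) (phase_contDiff hψs) F' = F := by
    ext Z
    rw [mulOp_apply, hF', mulOp_apply, ← mul_assoc, phase_mul_neg, one_mul]
  have hnF' : ‖F'‖ = ‖F‖ := norm_mulOp_eq _ _ (norm_phase _) _
  obtain ⟨w, hw, hw2, hdw2⟩ := exists_schwartz_solution b hT0 F'
  set χ := cutoffFn z 2 two_pos with hχ
  set e : ι → TestFn ι →ₗ[ℂ] TestFn ι := fun k =>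
    magOp 1 (b k) (fun Z => α k Z - α k z) ((hα k).sub contDiff_const) with he
  have hws : ContDiff ℝ ∞ w := w.smooth _
  set U := mulOp w hws χ with hU
  have hχF : ∀ Z, F' Z * χ Z = F' Z := by
    intro Z
    rcases le_or_gt 2 ‖Z - z‖ with h | h
    · rw [hF', mulOp_apply, hF Z h]; simp
    · rw [hχ, cutoffFn_apply, cutoffAt_eq_one two_pos h.le]; simp
  have herr : ∀ Z, (∑ k, e k (e k U) + (T : ℂ) • U - F') Z =
      ∑ k, (2 * Complex.I * (∂_{b k} w) Z * e k χ Z + w Z * e k (e k χ) Z) := by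
    intro Z
    have h1 : ∀ k, e k (e k U) Z = 2 * Complex.I * (∂_{b k} w) Z * e k χ Z
        + w Z * e k (e k χ) Z - (∂_{b k} (∂_{b k} w)) Z * χ Z := by
      intro k
      have hd : (fun Z => fderiv ℝ w Z (b k)) = ∂_{b k} w := by
        funext Z; rw [SchwartzMap.lineDerivOp_apply_eq_fderiv]
      have hdd : fderiv ℝ (fun Z => fderiv ℝ w Z (b k)) Z (b k) = (∂_{b k} (∂_{b k} w)) Z := by
        rw [hd, SchwartzMap.lineDerivOp_apply_eq_fderiv]
      have hd1 : fderiv ℝ w Z (b k) = (∂_{b k} w) Z := congrFun hd Z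
      simp only [he, hU, magOp_mulOp, map_add, map_smul, TestFn.add_apply, TestFn.smul_apply,
        mulOp_apply, hdd, hd1]
      push_cast
      linear_combination ((∂_{b k} (∂_{b k} w)) Z * χ Z) * Complex.I_sq
    have h2 := hw Z
    rw [TestFn.sub_apply, TestFn.add_apply, TestFn.sum_apply, TestFn.smul_apply,
      Finset.sum_congr rfl fun k _ => h1 k, Finset.sum_sub_distrib, ← Finset.sum_mul, ← hχF Z,
      ← h2, hU, mulOp_apply]
    ring
  have hgauge : ∑ k, magOp 1 (b k) (α k) (hα k) (magOp 1 (b k) (α k) (hα k)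
      (mulOp (phase ψ) (phase_contDiff hψs) U)) + (T : ℂ) •
      mulOp (phase ψ) (phase_contDiff hψs) U - F =
      mulOp (phase ψ) (phase_contDiff hψs) (∑ k, e k (e k U) + (T : ℂ) • U - F') := by
    have h1 : ∀ k x, magOp 1 (b k) (α k) (hα k) (mulOp (phase ψ) (phase_contDiff hψs) x) =
        mulOp (phase ψ) (phase_contDiff hψs) (e k x) := fun k x =>
      magOp_phase 1 (b k) _ _ _ _ ψ hψs (fun Z => by rw [hψd, one_mul]) x
    simp only [h1, map_sub, map_add, map_sum, map_smul, hFF']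
  refine ⟨mulOp (phase ψ) (phase_contDiff hψs) U, ?_, ?_⟩
  · rw [hgauge, norm_mulOp_eq _ _ (norm_phase _)]
    have hpt : ∀ Z, ‖(∑ k, e k (e k U) + (T : ℂ) • U - F') Z‖ ^ 2 ≤
        ∑ k : ι, Fintype.card ι * C ^ 2 * (8 * ‖(∂_{b k} w) Z‖ ^ 2 + 2 * ‖w Z‖ ^ 2) := by
      intro Z
      rw [herr]
      exact norm_sum_two_mul_sq_le _ _ _ _ (fun k => (hC z k Z).1) fun k => (hC z k Z).2
    have hT1 : T⁻¹ ≤ 1 := inv_le_one_of_one_le₀ hT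
    have hF0 : 0 ≤ T⁻¹ * ‖F‖ ^ 2 := by positivity
    rw [hnF'] at hw2
    have hw3 : ∫ Z, ‖w Z‖ ^ 2 ≤ T⁻¹ * ‖F‖ ^ 2 := hw2.trans (mul_le_of_le_one_left hF0 hT1)
    have hdw3 : ∀ k, ∫ Z, ‖(∂_{b k} w) Z‖ ^ 2 ≤ T⁻¹ * ‖F‖ ^ 2 := fun k => by
      have := hdw2 k
      rwa [hnF'] at this
    refine (norm_sq_le_of_schwartz _ w (fun k => ∂_{b k} w) hw3 hdw3 (by positivity) hpt).trans
      (le_of_eq ?_)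
    ring
  · intro Z hZ
    have hO : IsOpen {Z : ι → ℝ | 4 < ‖Z - z‖} :=
      isOpen_lt continuous_const (continuous_id.sub continuous_const).norm
    have hu : ∀ Z ∈ {Z : ι → ℝ | 4 < ‖Z - z‖}, χ Z = 0 := by
      intro Z hZ
      have h4 : 4 < ‖Z - z‖ := hZ
      rw [hχ, cutoffFn_apply, cutoffAt_eq_zero two_pos (by linarith)]
      simp
    have h1 : ∀ k, ∀ Z ∈ {Z : ι → ℝ | 4 < ‖Z - z‖}, e k χ Z = 0 := fun k =>
      magOp_eq_zero_of_isOpen 1 (b k) _ _ hO hu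
    have h2 : ∀ k, ∀ Z ∈ {Z : ι → ℝ | 4 < ‖Z - z‖}, e k (e k χ) Z = 0 := fun k =>
      magOp_eq_zero_of_isOpen 1 (b k) _ _ hO (h1 k)
    rw [hgauge, mulOp_apply, herr]
    simp [h1 _ Z hZ, h2 _ Z hZ]

end LocalParametrix

section MagneticDensityRange

open scoped ContDiff ComplexConjugate

open TestFn

variable {ι : Type} [Fintype ι]

/-- Decomposition of a test function into pieces supported near lattice points. -/
theorem exists_lattice_decomposition [DecidableEq ι] (f : TestFn ι) :
    ∃ (s : Finset (ι → ℤ)) (F : (ι → ℤ) → TestFn ι), ∑ i ∈ s, F i = f ∧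
      (∀ i Z, 2 ≤ ‖Z - latticePt 1 i‖ → F i Z = 0) ∧ ∀ i Z, ‖F i Z‖ ≤ ‖f Z‖ := by
  obtain ⟨ρ, hρ⟩ := f.compact.isBounded.exists_norm_le
  obtain ⟨s, hs⟩ := exists_finset_latticePt (ι := ι) one_pos ρ
  set S : (ι → ℝ) → ℝ := fun Z => ∑ i ∈ s, cutoffAt (latticePt 1 i) 1 Z with hS
  have hSs : ContDiff ℝ ∞ S := ContDiff.sum fun i _ => cutoffAt_contDiff _ _
  have hS1 : ∀ Z ∈ tsupport f, 1 ≤ S Z := by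
    intro Z hZ
    obtain ⟨i, hi, h⟩ := hs Z (hρ Z hZ)
    rw [← cutoffAt_eq_one one_pos h]
    exact Finset.single_le_sum (f := fun i => cutoffAt (latticePt 1 i) 1 Z)
      (fun i _ => (cutoffAt_mem_Icc _ _ _).1) hi
  have hsm : ContDiff ℝ ∞ fun Z => ((S Z : ℂ))⁻¹ * f Z := by
    refine contDiff_iff_contDiffAt.2 fun Z => ?_
    by_cases hZ : Z ∈ tsupport f
    · have : (S Z : ℂ) ≠ 0 := by
        exact_mod_cast (lt_of_lt_of_le one_pos (hS1 Z hZ)).ne'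
      exact (hSs.complex_ofReal.contDiffAt.inv this).mul f.smooth.contDiffAt
    · have h0 := notMem_tsupport_iff_eventuallyEq.1 hZ
      refine (contDiffAt_const (c := (0 : ℂ))).congr_of_eventuallyEq ?_
      filter_upwards [h0] with Z hZ
      rw [hZ]
      simp
  set F₀ := mk _ hsm f.compact.mul_left with hF₀
  have hF₀le : ∀ Z, ‖F₀ Z‖ ≤ ‖f Z‖ := by
    intro Z
    rw [hF₀, mk_apply, norm_mul]
    by_cases hZ : Z ∈ tsupport f
    · refine mul_le_of_le_one_left (norm_nonneg _) ?_
      rw [norm_inv, Complex.norm_real]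
      exact inv_le_one_of_one_le₀ ((hS1 Z hZ).trans (le_abs_self _))
    · rw [image_eq_zero_of_notMem_tsupport hZ]
      simp
  refine ⟨s, fun i => mulOp (fun Z => (cutoffAt (latticePt 1 i) 1 Z : ℂ))
    (cutoffAt_contDiff _ _).complex_ofReal F₀, ?_, fun i Z hZ => ?_, fun i Z => ?_⟩
  · ext Z
    rw [TestFn.sum_apply]
    simp only [mulOp_apply]
    rw [← Finset.sum_mul, hF₀, mk_apply, ← Complex.ofReal_sum]
    change (S Z : ℂ) * _ = _
    by_cases hZ : Z ∈ tsupport f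
    · have : (S Z : ℂ) ≠ 0 := by
        exact_mod_cast (lt_of_lt_of_le one_pos (hS1 Z hZ)).ne'
      field_simp
    · rw [image_eq_zero_of_notMem_tsupport hZ]
      simp
  · rw [mulOp_apply, cutoffAt_eq_zero one_pos (by linarith)]
    simp
  · rw [mulOp_apply, norm_mul, Complex.norm_real, Real.norm_eq_abs,
      abs_of_nonneg (cutoffAt_mem_Icc _ _ _).1]
    exact (mul_le_of_le_one_left (norm_nonneg _) (cutoffAt_mem_Icc _ _ _).2).trans (hF₀le Z)

/-- Magnetic Laplacians with potentials of linear growth have resolvents with dense range. -/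
theorem exists_denseRange_magOp_one [DecidableEq ι] (b : Module.Basis ι ℝ (ι → ℝ))
    (α : ι → (ι → ℝ) → ℝ) (hα : ∀ k, ContDiff ℝ ∞ (α k)) {Cα : ℝ} (hCα : 0 ≤ Cα)
    (hlip : ∀ k Z Z', |α k Z - α k Z'| ≤ Cα * ‖Z - Z'‖)
    (hder : ∀ k Z, |fderiv ℝ (α k) Z (b k)| ≤ Cα) :
    ∃ T₀ : ℝ, ∀ T, T₀ ≤ T → DenseRange (∑ k, magOp 1 (b k) (α k) (hα k) ∘ₗ
      magOp 1 (b k) (α k) (hα k) + (T : ℂ) • (LinearMap.id : TestFn ι →ₗ[ℂ] TestFn ι)) := by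
  obtain ⟨C, hC0, hC⟩ := exists_local_parametrix b α hα hCα hlip hder
  set N := Fintype.card ι with hN
  set M : ℝ := (2 * (4 : ℕ) + 1) ^ N * (C * (2 * (2 : ℕ) + 1) ^ N) with hM
  have hM0 : 0 ≤ M := by positivity
  refine ⟨max 1 (4 * M), fun T hT => ?_⟩
  have hT1 : 1 ≤ T := (le_max_left _ _).trans hT
  have hTM : 4 * M ≤ T := (le_max_right _ _).trans hT
  have hT0 : 0 < T := by linarith
  set P : TestFn ι →ₗ[ℂ] TestFn ι := ∑ k, magOp 1 (b k) (α k) (hα k) ∘ₗ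
      magOp 1 (b k) (α k) (hα k) + (T : ℂ) • LinearMap.id with hP
  have hPa : ∀ W, P W = ∑ k, magOp 1 (b k) (α k) (hα k) (magOp 1 (b k) (α k) (hα k) W) +
      (T : ℂ) • W := by
    intro W
    simp [hP, LinearMap.sum_apply]
  refine denseRange_of_approx P (ρ := 1 / 2) (by norm_num) (by norm_num) fun f => ?_
  obtain ⟨s, F, hFs, hF0, hFle⟩ := exists_lattice_decomposition f
  choose W hW hW0 using fun i => hC (latticePt 1 i) T hT1 (F i) (hF0 i)
  simp only [← hPa] at hW hW0
  refine ⟨∑ i ∈ s, W i, ?_⟩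
  have h1 : P (∑ i ∈ s, W i) - f = ∑ i ∈ s, (P (W i) - F i) := by
    rw [map_sum, Finset.sum_sub_distrib, hFs]
  have h2 := TestFn.norm_sum_sq_le one_pos 4 s (fun i => P (W i) - F i) fun i Z hZ =>
    hW0 i Z (by simpa using hZ)
  have h3 : ∑ i ∈ s, ‖F i‖ ^ 2 ≤ (2 * (2 : ℕ) + 1) ^ N * ‖f‖ ^ 2 := by
    have := sum_norm_sq_le_sum s {()} F (fun _ => (2 * (2 : ℕ) + 1) ^ N) (fun _ => f) fun Z => by
      rw [Finset.sum_singleton]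
      refine sum_latticePt_le one_pos 2 s Z (fun i => ‖F i Z‖ ^ 2)
        (fun i => pow_le_pow_left₀ (norm_nonneg _) (hFle i Z) 2) (fun i hi => ?_) (sq_nonneg _)
      have : F i Z = 0 := hF0 i Z (by simpa using hi.le)
      simp [this]
    simpa using this
  have h4 : ∑ i ∈ s, ‖P (W i) - F i‖ ^ 2 ≤ C / T * ((2 * (2 : ℕ) + 1) ^ N * ‖f‖ ^ 2) := by
    refine (Finset.sum_le_sum fun i _ => hW i).trans ?_
    rw [← Finset.mul_sum]
    exact mul_le_mul_of_nonneg_left h3 (by positivity)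
  have h5 : ‖P (∑ i ∈ s, W i) - f‖ ^ 2 ≤ (1 / 2 * ‖f‖) ^ 2 := by
    rw [h1]
    refine h2.trans ((mul_le_mul_of_nonneg_left h4 (by positivity)).trans ?_)
    have h6 : (2 * (4 : ℕ) + 1 : ℝ) ^ N * (C / T * ((2 * (2 : ℕ) + 1) ^ N * ‖f‖ ^ 2)) =
        M / T * ‖f‖ ^ 2 := by
      rw [hM]; ring
    have h7 : M / T ≤ 1 / 4 := by
      rw [div_le_iff₀ hT0]; linarith
    rw [h6]
    have := mul_le_mul_of_nonneg_right h7 (sq_nonneg ‖f‖)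
    linarith
  exact le_of_sq_le_sq h5 (by positivity)

theorem exists_denseRange_magOp [DecidableEq ι] (h : ℝ) (v : ι → ι → ℝ)
    (b : Module.Basis ι ℝ (ι → ℝ)) (hb : ∀ k, b k = h • v k)
    (α : ι → (ι → ℝ) → ℝ) (hα : ∀ k, ContDiff ℝ ∞ (α k)) {Cα : ℝ} 
    (hder : ∀ k Z, ‖fderiv ℝ (α k) Z‖ ≤ Cα) :
    ∃ T₀ : ℝ, ∀ T, T₀ ≤ T → DenseRange (∑ k, magOp h (v k) (α k) (hα k) ∘ₗ
      magOp h (v k) (α k) (hα k) + (T : ℂ) • (LinearMap.id : TestFn ι →ₗ[ℂ] TestFn ι)) := by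
  have he : ∀ k, magOp h (v k) (α k) (hα k) = magOp 1 (b k) (α k) (hα k) := by
    intro k
    ext u Z
    rw [magOp_apply, magOp_apply, hb, map_smul, Complex.real_smul]
    push_cast
    ring
  simp only [he]
  set c := max Cα 0 with hc
  have hc0 : 0 ≤ c := le_max_right _ _
  have hd : ∀ k Z, ‖fderiv ℝ (α k) Z‖ ≤ c := fun k Z => (hder k Z).trans (le_max_left _ _)
  have hS0 : 0 ≤ ∑ k, ‖b k‖ := Finset.sum_nonneg fun k _ => norm_nonneg _
  refine exists_denseRange_magOp_one b α hα (Cα := c + c * ∑ k, ‖b k‖) (by positivity)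
    (fun k Z Z' => ?_) (fun k Z => ?_)
  · have := convex_univ.norm_image_sub_le_of_norm_fderiv_le (𝕜 := ℝ) (f := α k) (x := Z') (y := Z)
      (fun x _ => (hα k).differentiable (by simp) x) (fun x _ => hd k x) trivial trivial
    rw [← Real.norm_eq_abs]
    refine this.trans (mul_le_mul_of_nonneg_right ?_ (norm_nonneg _))
    linarith [mul_nonneg hc0 hS0]
  · rw [← Real.norm_eq_abs]
    refine ((fderiv ℝ (α k) Z).le_opNorm (b k)).trans ?_
    have h1 := mul_le_mul (hd k Z) (Finset.single_le_sum (f := fun k => ‖b k‖)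
      (fun k _ => norm_nonneg _) (Finset.mem_univ k)) (norm_nonneg _) hc0
    linarith

end MagneticDensityRange

section FrozenCoefficients

open scoped ContDiff ComplexConjugate

open TestFn

variable {ι : Type} [Fintype ι]

/-- In a ball, gauge covariance only needs the potentials to be related there. -/
theorem magOp_phase_local (h : ℝ) (v : ι → ℝ) (α β : (ι → ℝ) → ℝ) (hα : ContDiff ℝ ∞ α)
    (hβ : ContDiff ℝ ∞ β) (φ : (ι → ℝ) → ℝ) (hφ : ContDiff ℝ ∞ φ) (y : ι → ℝ) (r : ℝ)
    (hφβ : ∀ Z, ‖Z - y‖ ≤ r → β Z = α Z - h * fderiv ℝ φ Z v) (u : TestFn ι)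
    (hu : ∀ Z, r < ‖Z - y‖ → u Z = 0) :
    magOp h v α hα (mulOp (phase φ) (phase_contDiff hφ) u) =
      mulOp (phase φ) (phase_contDiff hφ) (magOp h v β hβ u) ∧
    ∀ Z, r < ‖Z - y‖ → magOp h v β hβ u Z = 0 := by
  have hO : IsOpen {Z : ι → ℝ | r < ‖Z - y‖} :=
    isOpen_lt continuous_const (continuous_id.sub continuous_const).norm
  refine ⟨?_, magOp_eq_zero_of_isOpen h v β hβ hO hu⟩
  ext Z
  rw [magOp_mulOp]
  simp only [TestFn.add_apply, TestFn.smul_apply, mulOp_apply, magOp_apply, fderiv_phase hφ]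
  rcases le_or_gt ‖Z - y‖ r with hZ | hZ
  · rw [hφβ Z hZ]
    push_cast
    linear_combination (h * phase φ Z * fderiv ℝ φ Z v * u Z) * Complex.I_sq
  · rw [hu Z hZ]
    simp

variable [DecidableEq ι]

/-- The semiclassical magnetic derivatives `i h ∂_j + h⁻¹ A_j`. -/
def magD (h : ℝ) (A : ι → (ι → ℝ) → ℝ) (hA : ∀ j, ContDiff ℝ ∞ (A j)) (j : ι) :
    TestFn ι →ₗ[ℂ] TestFn ι :=
  magOp h (Pi.single j 1) (fun Z => h⁻¹ * A j Z) (contDiff_const.mul (hA j))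

theorem magOp_eq_sum_magD (h : ℝ) (A : ι → (ι → ℝ) → ℝ) (hA : ∀ j, ContDiff ℝ ∞ (A j))
    (v : ι → ℝ) (β : (ι → ℝ) → ℝ) (hβ : ContDiff ℝ ∞ β) (hβA : ∀ Z, β Z = h⁻¹ * ∑ j, v j * A j Z)
    (u : TestFn ι) : magOp h v β hβ u = ∑ j, (v j : ℂ) • magD h A hA j u := by
  ext Z
  have h1 : fderiv ℝ u Z v = ∑ j, (v j : ℂ) * fderiv ℝ u Z (Pi.single j 1) := by
    conv_lhs => rw [pi_eq_sum_univ' v, map_sum]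
    refine Finset.sum_congr rfl fun j _ => ?_
    rw [← Complex.real_smul, ← map_smul]
  rw [magOp_apply, TestFn.sum_apply, h1, hβA, Finset.mul_sum, Finset.mul_sum]
  push_cast
  rw [Finset.sum_mul, ← Finset.sum_add_distrib]
  refine Finset.sum_congr rfl fun j _ => ?_
  rw [TestFn.smul_apply, magD, magOp_apply]
  push_cast
  ring

theorem norm_sum_smul_le {E : Type*} [NormedAddCommGroup E] [NormedSpace ℂ E] (c : ι → ℝ)
    (x : ι → E) {a b : ℝ} (hc : ∀ j, |c j| ≤ a) (hx : ∀ j, ‖x j‖ ≤ b) (ha : 0 ≤ a) :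
    ‖∑ j, (c j : ℂ) • x j‖ ≤ Fintype.card ι * (a * b) := by
  refine (norm_sum_le _ _).trans ?_
  calc _ ≤ ∑ j : ι, a * b := Finset.sum_le_sum fun j _ => by
        rw [norm_smul, Complex.norm_real, Real.norm_eq_abs]
        exact mul_le_mul (hc j) (hx j) (norm_nonneg _) ha
    _ = _ := by rw [Finset.sum_const, nsmul_eq_mul, Finset.card_univ]

theorem abs_le_one_add_of_sq_le {x a : ℝ} (h : x ^ 2 ≤ a) : |x| ≤ a + 1 := by
  have := sq_abs x
  nlinarith [abs_nonneg x, sq_nonneg (|x| - 1)]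

/-- The magnetic Laplacian with constant metric and almost constant magnetic field. -/
theorem exists_frozen_frame_bound (n : ℕ) (ι : Type) [Fintype ι] [DecidableEq ι]
    (b₀ K' ε CG C₀ : ℝ) (hb₀ : 0 < b₀) (hε : 0 < ε) (hCG : 0 ≤ CG) (hC₀ : 0 ≤ C₀) :
    ∃ θ Cf, 0 < θ ∧ θ ≤ 1 ∧ 0 ≤ Cf ∧ ∀ (A : ι → (ι → ℝ) → ℝ) (hA : ∀ j, ContDiff ℝ ∞ (A j))
      (ℓ : Matrix ι ι ℝ) (y : ι → ℝ) (β : ι → (ι → ℝ) → ℝ),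
      (∀ j, ContDiff ℝ ∞ (β j) ∧ HasCompactSupport (β j)) →
      (∀ j Z, A j Z = ∑ k, ℓ j k * (Z k - y k) + β j Z) →
      ∀ (B : Matrix ι ι ℝ) (η : ℝ), (∀ j k, B j k = -B k j) → (∀ j k, |B j k| ≤ C₀) → 0 ≤ η →
      η ≤ 1 → (∀ Z j k, |curvature A Z j k - B j k| ≤ η) →
      ∀ (G : Matrix ι ι ℝ), G.IsSymm →
      (∀ v : ι → ℝ, ε * ∑ j, v j ^ 2 ≤ ∑ j, ∑ l, G j l * v j * v l) → (∀ j, G j j ≤ CG) →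
      ∀ (a : Fin n → ℝ), (∀ j, b₀ ≤ a j) →
      (G⁻¹ * B).charpoly = ∏ j, (X ^ 2 + C (a j ^ 2)) →
      ∀ h, 0 < h → ∀ d μ, 0 < d → d ≤ b₀ → Cf * η ≤ d → μ ≤ K' →
      (∀ k : Fin n → ℕ, d ≤ |μ - ∑ j, (2 * (k j : ℝ) + 1) * a j|) → ∀ v : TestFn ι,
      θ * d * ‖v‖ ≤ ‖∑ j, ∑ l, ((G⁻¹ j l : ℝ) : ℂ) • magD h A hA j (magD h A hA l v) -
        (μ : ℂ) • v‖ ∧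
      (∀ j l, ‖magD h A hA j (magD h A hA l v)‖ ≤ Cf *
        (‖∑ j, ∑ l, ((G⁻¹ j l : ℝ) : ℂ) • magD h A hA j (magD h A hA l v)‖ + ‖v‖)) ∧
      ∀ l, ‖magD h A hA l v‖ ≤ Cf *
        (‖∑ j, ∑ l, ((G⁻¹ j l : ℝ) : ℂ) • magD h A hA j (magD h A hA l v)‖ + ‖v‖) := by
  obtain ⟨θ, hθ0, hθ1, hθ⟩ := exists_gap_frame.{0} n ι b₀ K' hb₀
  set N : ℝ := ((Fintype.card ι : ℕ) : ℝ) with hN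
  have hN0 : 0 ≤ N := Nat.cast_nonneg _
  set c₁ : ℝ := N * (N * ε⁻¹) with hc₁
  have hε' : 0 < ε⁻¹ := inv_pos.2 hε
  have hc₁0 : 0 ≤ c₁ := by positivity
  set F : ℝ := c₁ * (C₀ + 1) with hF
  have hF0 : 0 ≤ F := by positivity
  set Cf : ℝ := c₁ / θ + N * ((CG + 1) * (N * ((CG + 1) * (2 + 2 * (N * F))))) +
    N * (CG + 1) with hCf
  have hCfa : 0 ≤ c₁ / θ := by positivity
  have hCfb : 0 ≤ N * ((CG + 1) * (N * ((CG + 1) * (2 + 2 * (N * F))))) := by positivity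
  have hCfc : 0 ≤ N * (CG + 1) := by positivity
  refine ⟨θ, Cf, hθ0, hθ1, by positivity, ?_⟩
  intro A hA ℓ y β hβ hAβ B η hB hBC hη0 hη1 hcurv G hGs hGpos hGC a ha hchar h hh d μ hd0 hd hηd
    hμ hgap v
  obtain ⟨L, M, hML, hLM, hGL, hGM, hLb, hMb⟩ := exists_orthonormal_frame G ε CG hε hGs hGpos hGC
  set D := magD h A hA with hD
  have hLL : ∀ j k j' k', |L j k * L j' k'| ≤ ε⁻¹ := by
    intro j k j' k'
    rw [abs_mul]
    have h1 := hLb j k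
    have h2 := hLb j' k'
    rw [← sq_abs] at h1 h2
    linarith [sq_nonneg (|L j k| - |L j' k'|)]
  have hframe : ∀ (X : Matrix ι ι ℝ) (c : ℝ), (∀ j k, |X j k| ≤ c) → 0 ≤ c → ∀ j k,
      |(Lᵀ * X * L) j k| ≤ c₁ * c := by
    intro X c hX hc j k
    have h1 : (Lᵀ * X * L) j k = ∑ m, ∑ l, L l j * L m k * X l m := by
      simp only [Matrix.mul_apply, Matrix.transpose_apply, Finset.sum_mul]
      exact Finset.sum_congr rfl fun m _ => Finset.sum_congr rfl fun l _ => by ring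
    rw [h1]
    refine (Finset.abs_sum_le_sum_abs _ _).trans ?_
    calc _ ≤ ∑ m : ι, ∑ l : ι, ε⁻¹ * c := Finset.sum_le_sum fun m _ =>
          (Finset.abs_sum_le_sum_abs _ _).trans (Finset.sum_le_sum fun l _ => by
            rw [abs_mul]
            exact mul_le_mul (hLL _ _ _ _) (hX _ _) (abs_nonneg _) hε'.le)
      _ = _ := by
          simp only [Finset.sum_const, nsmul_eq_mul, Finset.card_univ, hc₁, hN]
          ring
  set K := Lᵀ * B * L with hK
  have hKs : ∀ j k, K j k = -K k j := by
    have hBt : Bᵀ = -B := by ext j k; simpa using hB k j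
    have : Kᵀ = -K := by
      rw [hK, Matrix.transpose_mul, Matrix.transpose_mul, Matrix.transpose_transpose, hBt]
      simp [Matrix.mul_assoc]
    intro j k
    have := congrFun (congrFun this k) j
    simpa using this
  obtain ⟨w, hw⟩ := exists_isDiagonalizing K hKs a (fun j => hb₀.trans_le (ha j))
    (by rw [hK, charpoly_frame B hGL, hchar])
  set α : ι → (ι → ℝ) → ℝ := fun k Z => h⁻¹ * ∑ j, L j k * A j Z with hα
  have hαs : ∀ k, ContDiff ℝ ∞ (α k) := fun k =>
    contDiff_const.mul (ContDiff.sum fun j _ => contDiff_const.mul (hA j))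
  set e : ι → TestFn ι →ₗ[ℂ] TestFn ι := fun k => magOp h (fun j => L j k) (α k) (hαs k) with he
  have heD : ∀ k u, e k u = ∑ j, (L j k : ℂ) • D j u := fun k u =>
    magOp_eq_sum_magD h A hA _ _ _ (fun Z => rfl) u
  have hDe : ∀ l u, D l u = ∑ k, (M k l : ℂ) • e k u := by
    intro l u
    simp only [heD, Finset.smul_sum, smul_smul]
    rw [Finset.sum_comm]
    have h1 : ∀ j, ∑ k, ((M k l : ℂ) * (L j k : ℂ)) • D j u =
        (((1 : Matrix ι ι ℝ) j l : ℝ) : ℂ) • D j u := by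
      intro j
      rw [← Finset.sum_smul, ← hLM, Matrix.mul_apply]
      push_cast
      exact congrArg (· • D j u) (Finset.sum_congr rfl fun k _ => mul_comm _ _)
    simp only [h1, Matrix.one_apply]
    simp
  have hsq : ∀ u, ∑ k, e k (e k u) = ∑ j, ∑ l, ((G⁻¹ j l : ℝ) : ℂ) • D j (D l u) := by
    intro u
    simp only [heD, map_sum, map_smul, Finset.smul_sum, smul_smul, hGL, Matrix.mul_apply,
      Matrix.transpose_apply]
    push_cast
    simp only [Finset.sum_smul]
    rw [Finset.sum_comm]
    refine Finset.sum_congr rfl fun j _ => ?_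
    rw [Finset.sum_comm]
  have hsym : ∀ k x y, inner ℂ (e k x) y = inner ℂ x (e k y) := fun k x y =>
    inner_magOp _ _ _ _ x y
  have hαd : ∀ k Z x, fderiv ℝ (α k) Z x = h⁻¹ * ∑ j, L j k * fderiv ℝ (A j) Z x := by
    intro k Z x
    have h1 : HasFDerivAt (α k) (h⁻¹ • ∑ j, L j k • fderiv ℝ (A j) Z) Z :=
      (HasFDerivAt.fun_sum fun j _ =>
        (((hA j).differentiable (by simp) Z).hasFDerivAt.const_mul (L j k))).const_mul h⁻¹
    rw [h1.fderiv]
    simp [_root_.sum_apply, _root_.smul_apply]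
  have hcomm : ∀ j k x Z, (e j (e k x) - e k (e j x)) Z =
      Complex.I * ((Lᵀ * curvature A Z * L) j k : ℝ) * x Z := by
    intro j k x Z
    rw [he, magOp_commutator]
    congr 3
    have h1 : ∀ p q, fderiv ℝ (α p) Z (fun i => L i q) =
        h⁻¹ * ∑ x, ∑ i, L x p * (L i q * fderiv ℝ (A x) Z (Pi.single i 1)) := by
      intro p q
      rw [hαd]
      simp only [fderiv_eq_sum_single _ Z (fun i => L i q), Finset.mul_sum]
    rw [h1, h1, ← mul_sub, mul_inv_cancel_left₀ hh.ne']
    conv_lhs => rw [sub_eq_add_neg, add_comm, Finset.sum_comm]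
    simp only [Matrix.mul_apply, Matrix.transpose_apply, curvature, Finset.sum_mul]
    rw [← Finset.sum_neg_distrib, ← Finset.sum_add_distrib]
    refine Finset.sum_congr rfl fun x _ => ?_
    rw [← Finset.sum_neg_distrib, ← Finset.sum_add_distrib]
    exact Finset.sum_congr rfl fun i _ => by ring
  have hcommK : ∀ j k x, ‖e j (e k x) - e k (e j x) - (Complex.I * (K j k : ℂ)) • x‖ ≤
      c₁ * η * ‖x‖ := by
    intro j k x
    refine norm_le_of_forall_le (by positivity) _ _ fun Z => ?_
    rw [TestFn.sub_apply, hcomm, TestFn.smul_apply, ← sub_mul, norm_mul, ← mul_sub, norm_mul,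
      Complex.norm_I, one_mul, ← Complex.ofReal_sub, Complex.norm_real, Real.norm_eq_abs]
    refine mul_le_mul_of_nonneg_right ?_ (norm_nonneg _)
    have h1 : (Lᵀ * curvature A Z * L) j k - K j k = (Lᵀ * (curvature A Z - B) * L) j k := by
      rw [Matrix.mul_sub, Matrix.sub_mul, Matrix.sub_apply]
    rw [h1]
    exact hframe _ η (fun j k => hcurv Z j k) hη0 j k
  have hcommF : ∀ j k x, ‖e j (e k x) - e k (e j x)‖ ≤ F * ‖x‖ := by
    intro j k x
    have h1 := norm_add_le (e j (e k x) - e k (e j x) - (Complex.I * (K j k : ℂ)) • x)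
      ((Complex.I * (K j k : ℂ)) • x)
    rw [sub_add_cancel, norm_smul, norm_mul, Complex.norm_I, one_mul, Complex.norm_real,
      Real.norm_eq_abs] at h1
    have h2 := mul_le_mul_of_nonneg_right (hframe B C₀ hBC hC₀ j k) (norm_nonneg x)
    have h3 := hcommK j k x
    have h4 : c₁ * η * ‖x‖ ≤ c₁ * 1 * ‖x‖ :=
      mul_le_mul_of_nonneg_right (mul_le_mul_of_nonneg_left hη1 hc₁0) (norm_nonneg _)
    have h5 : F * ‖x‖ = c₁ * C₀ * ‖x‖ + c₁ * 1 * ‖x‖ := by rw [hF]; ring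
    linarith
  have hdense : ∃ T₀ : ℝ, ∀ T : ℝ, T₀ ≤ T →
      DenseRange (∑ k, e k ∘ₗ e k + (T : ℂ) • (LinearMap.id : TestFn ι →ₗ[ℂ] TestFn ι)) := by
    let b : Module.Basis ι ℝ (ι → ℝ) := Module.Basis.ofEquivFun
      ((Matrix.toLin'OfInv hLM hML).symm.trans (LinearEquiv.smulOfNeZero ℝ _ h hh.ne')).symm
    have hb : ∀ k, b k = h • fun j => L j k := by
      intro k
      have h1 : (Matrix.toLin'OfInv hLM hML).symm (Pi.single k 1) = fun j => L j k := by
        change Matrix.toLin' L (Pi.single k 1) = _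
        ext i
        simp [Matrix.mulVec_single]
      simp [b, h1]
    have hAd : ∀ j, ∃ c, ∀ Z, ‖fderiv ℝ (A j) Z‖ ≤ c := by
      intro j
      obtain ⟨c, hc⟩ := ((hβ j).1.continuous_fderiv (by simp)).bounded_above_of_compact_support
        ((hβ j).2.fderiv (𝕜 := ℝ))
      let l : (ι → ℝ) →L[ℝ] ℝ := ∑ k, ℓ j k • ContinuousLinearMap.proj k
      refine ⟨‖l‖ + c, fun Z => ?_⟩
      have h1 : HasFDerivAt (A j) (l + fderiv ℝ (β j) Z) Z := by
        rw [funext (hAβ j)]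
        exact (HasFDerivAt.fun_sum fun k _ => (((ContinuousLinearMap.proj (R := ℝ)
          (φ := fun _ : ι => ℝ) k).hasFDerivAt.sub_const _).const_mul (ℓ j k))).add
          ((hβ j).1.differentiable (by simp) Z).hasFDerivAt
      rw [h1.fderiv]
      exact (norm_add_le _ _).trans (by linarith [hc Z])
    choose cA hcA using hAd
    refine exists_denseRange_magOp h _ b hb α hαs (Cα := |h⁻¹| * ∑ k, ∑ j, |L j k| * cA j)
      fun k Z => ?_
    have h1 : fderiv ℝ (α k) Z = h⁻¹ • ∑ j, L j k • fderiv ℝ (A j) Z := by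
      ext x
      rw [hαd]
      simp [_root_.sum_apply, _root_.smul_apply]
    have hcA0 : ∀ j, 0 ≤ cA j := fun j => (norm_nonneg _).trans (hcA j 0)
    rw [h1, norm_smul, Real.norm_eq_abs]
    refine mul_le_mul_of_nonneg_left ((norm_sum_le _ _).trans ?_) (abs_nonneg _)
    refine le_trans ?_ (Finset.single_le_sum (f := fun k => ∑ j, |L j k| * cA j)
      (fun k _ => Finset.sum_nonneg fun j _ => mul_nonneg (abs_nonneg _) (hcA0 j))
      (Finset.mem_univ k))
    exact Finset.sum_le_sum fun j _ => by
      rw [norm_smul, Real.norm_eq_abs]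
      exact mul_le_mul_of_nonneg_left (hcA j Z) (abs_nonneg _)
  have hMa : ∀ j k, |M j k| ≤ CG + 1 := fun j k => abs_le_one_add_of_sq_le (hMb j k)
  have hx0 : 0 ≤ ‖∑ k, e k (e k v)‖ := norm_nonneg _
  have hv0 : 0 ≤ ‖v‖ := norm_nonneg _
  rw [← hsq]
  set x := ‖∑ k, e k (e k v)‖ with hx
  refine ⟨?_, fun j l => ?_, fun l => ?_⟩
  · refine hθ (TestFn ι) a (c₁ * η) K w e hw hsym hcommK ha hdense d μ hd0 hd (by positivity) ?_ hμ
      hgap v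
    have h1 : c₁ / θ * η ≤ d := by
      refine le_trans (mul_le_mul_of_nonneg_right ?_ hη0) hηd
      linarith
    rw [div_mul_eq_mul_div, div_le_iff₀ hθ0] at h1
    linarith
  · have h1 : ∀ k m, ‖e k (e m v)‖ ≤ (2 + 2 * (N * F)) * (x + ‖v‖) := by
      intro k m
      refine (norm_symm_symm_le e hsym hF0 hcommF v k m).trans ?_
      have : 0 ≤ N * F * x := by positivity
      linarith
    have h2 : ∀ k, ‖e k (D l v)‖ ≤ N * ((CG + 1) * ((2 + 2 * (N * F)) * (x + ‖v‖))) := by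
      intro k
      rw [hDe l v, map_sum]
      simp only [map_smul]
      exact norm_sum_smul_le _ _ (fun m => hMa m l) (h1 k) (by positivity)
    rw [hDe j]
    refine (norm_sum_smul_le _ _ (fun k => hMa k j) h2 (by positivity)).trans ?_
    have h3 : Fintype.card ι * ((CG + 1) * (N * ((CG + 1) * ((2 + 2 * (N * F)) * (x + ‖v‖))))) =
        N * ((CG + 1) * (N * ((CG + 1) * (2 + 2 * (N * F))))) * (x + ‖v‖) := by rw [← hN]; ring
    rw [h3]
    refine mul_le_mul_of_nonneg_right ?_ (by positivity)
    linarith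
  · have h1 : ∀ k, ‖e k v‖ ≤ x + ‖v‖ := by
      intro k
      refine le_of_sq_le_sq ?_ (by positivity)
      have h2 := sum_norm_sq_symm_le e hsym v
      have h3 := Finset.single_le_sum (f := fun k => ‖e k v‖ ^ 2) (fun k _ => sq_nonneg _)
        (Finset.mem_univ k)
      have h4 : 0 ≤ x * ‖v‖ := by positivity
      linarith [sq_nonneg x, sq_nonneg ‖v‖, add_sq x ‖v‖]
    rw [hDe l]
    refine (norm_sum_smul_le _ _ (fun k => hMa k l) h1 (by positivity)).trans ?_
    rw [← mul_assoc]
    refine mul_le_mul_of_nonneg_right ?_ (by positivity)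
    linarith

end FrozenCoefficients

section LocalFrozen

open scoped ContDiff ComplexConjugate

open TestFn

variable {ι : Type} [Fintype ι] [DecidableEq ι]

/-- The magnetic Laplacian with constant coefficients `Q`. -/
def constLap (h : ℝ) (A : ι → (ι → ℝ) → ℝ) (hA : ∀ j, ContDiff ℝ ∞ (A j)) (Q : Matrix ι ι ℝ)
    (v : TestFn ι) : TestFn ι :=
  ∑ j, ∑ l, ((Q j l : ℝ) : ℂ) • magD h A hA j (magD h A hA l v)

theorem magD_eq_zero (h : ℝ) (A : ι → (ι → ℝ) → ℝ) (hA : ∀ j, ContDiff ℝ ∞ (A j)) (j : ι)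
    {y : ι → ℝ} {r : ℝ} {u : TestFn ι} (hu : ∀ Z, r < ‖Z - y‖ → u Z = 0) :
    ∀ Z, r < ‖Z - y‖ → magD h A hA j u Z = 0 :=
  magOp_eq_zero_of_isOpen h _ _ _
    (isOpen_lt continuous_const (continuous_id.sub continuous_const).norm) hu

/-- Local lower bound for the magnetic Laplacian with frozen metric. -/
theorem exists_local_frozen_bound (n : ℕ) (ι : Type) [Fintype ι] [DecidableEq ι]
    (b₀ K' ε CG C₀ C₁ : ℝ) (hb₀ : 0 < b₀) (hε : 0 < ε) (hCG : 0 ≤ CG) (hC₀ : 0 ≤ C₀)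
    (hC₁ : 0 ≤ C₁) :
    ∃ θ Cf, 0 < θ ∧ θ ≤ 1 ∧ 0 ≤ Cf ∧ ∀ (A : ι → (ι → ℝ) → ℝ) (hA : ∀ j, ContDiff ℝ ∞ (A j))
      (y : ι → ℝ) (r : ℝ), (∀ j k, |curvature A y j k| ≤ C₀) →
      (∀ Z j k, |curvature A Z j k - curvature A y j k| ≤ C₁ * ‖Z - y‖) →
      0 < r → Cf * r ≤ 1 →
      ∀ (G : Matrix ι ι ℝ), G.IsSymm →
      (∀ v : ι → ℝ, ε * ∑ j, v j ^ 2 ≤ ∑ j, ∑ l, G j l * v j * v l) → (∀ j, G j j ≤ CG) →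
      ∀ (a : Fin n → ℝ), (∀ j, b₀ ≤ a j) →
      (G⁻¹ * curvature A y).charpoly = ∏ j, (X ^ 2 + C (a j ^ 2)) →
      ∀ h, 0 < h → ∀ d μ, 0 < d → d ≤ b₀ → Cf * r ≤ d → μ ≤ K' →
      (∀ k : Fin n → ℕ, d ≤ |μ - ∑ j, (2 * (k j : ℝ) + 1) * a j|) → ∀ v : TestFn ι,
      (∀ Z, r < ‖Z - y‖ → v Z = 0) →
      θ * d * ‖v‖ ≤ ‖constLap h A hA G⁻¹ v - (μ : ℂ) • v‖ ∧
      (∀ j l, ‖magD h A hA j (magD h A hA l v)‖ ≤ Cf * (‖constLap h A hA G⁻¹ v‖ + ‖v‖)) ∧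
      ∀ l, ‖magD h A hA l v‖ ≤ Cf * (‖constLap h A hA G⁻¹ v‖ + ‖v‖) := by
  obtain ⟨θ, Cf, hθ0, hθ1, hCf, H⟩ := exists_frozen_frame_bound n ι b₀ K' ε CG C₀ hb₀ hε hCG hC₀
  obtain ⟨C', hC', H'⟩ := exists_local_potential ι C₁ hC₁
  refine ⟨θ, Cf + C' + Cf * C', hθ0, hθ1, by positivity, ?_⟩
  intro A hA y r hB0 hB1 hr hr1 G hGs hGp hGC a ha hchar h hh d μ hd hdb hrd hμ hgap v hv
  obtain ⟨φ, At, ℓ, β, hφ, hAt, hφA, hcurv, hβ, hAtβ⟩ := H' A hA y r hr hB1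
  have hprod : 0 ≤ Cf * C' * r := by positivity
  have hprod1 : 0 ≤ C' * r := by positivity
  have hprod2 : 0 ≤ Cf * r := by positivity
  have hexp : (Cf + C' + Cf * C') * r = Cf * r + C' * r + Cf * C' * r := by ring
  set ψ : (ι → ℝ) → ℝ := fun Z => h⁻¹ * h⁻¹ * φ Z with hψ
  have hψs : ContDiff ℝ ∞ ψ := contDiff_const.mul hφ
  have hψd : ∀ Z v, fderiv ℝ ψ Z v = h⁻¹ * h⁻¹ * fderiv ℝ φ Z v := by
    intro Z v
    rw [hψ, fderiv_const_mul (hφ.differentiable (by simp) Z)]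
    rfl
  set Φ : TestFn ι →ₗ[ℂ] TestFn ι := mulOp (phase ψ) (phase_contDiff hψs) with hΦ
  have hΦn : ∀ w, ‖Φ w‖ = ‖w‖ := norm_mulOp_eq _ _ (norm_phase ψ)
  have hD : ∀ j (w : TestFn ι), (∀ Z, r < ‖Z - y‖ → w Z = 0) →
      magD h A hA j (Φ w) = Φ (magD h At hAt j w) := by
    intro j w hw
    refine (magOp_phase_local h _ _ _ _ _ ψ hψs y r (fun Z hZ => ?_) w hw).1
    rw [hψd, hφA Z hZ]
    field_simp
  set w : TestFn ι := mulOp (phase (-ψ)) (phase_contDiff hψs.neg) v with hw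
  have hvw : v = Φ w := by
    ext Z
    rw [hΦ, hw, mulOp_apply, mulOp_apply, ← mul_assoc, phase_mul_neg, one_mul]
  have hw0 : ∀ Z, r < ‖Z - y‖ → w Z = 0 := fun Z hZ => by rw [hw, mulOp_apply, hv Z hZ, mul_zero]
  have hD2 : ∀ j l, magD h A hA j (magD h A hA l v) = Φ (magD h At hAt j (magD h At hAt l w)) := by
    intro j l
    rw [hvw, hD l w hw0, hD j _ (magD_eq_zero h At hAt l hw0)]
  have hlap : constLap h A hA G⁻¹ v = Φ (constLap h At hAt G⁻¹ w) := by
    simp only [constLap, map_sum, map_smul, hD2]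
  have hBa : ∀ j k, curvature A y j k = -curvature A y k j := fun j k => by
    simp [curvature]
  obtain ⟨h1, h2, h3⟩ := H At hAt ℓ y β hβ hAtβ (curvature A y) (C' * r) hBa hB0 hprod1
    (by linarith) hcurv G hGs hGp hGC a ha hchar h hh d μ hd hdb (by linarith) hμ hgap w
  have hle : ∀ x : ℝ, 0 ≤ x → Cf * x ≤ (Cf + C' + Cf * C') * x := fun x hx => by
    have : 0 ≤ C' * x := by positivity
    have : 0 ≤ Cf * C' * x := by positivity
    linarith [add_mul (Cf + C') (Cf * C') x, add_mul Cf C' x]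
  have hvn : ‖v‖ = ‖w‖ := by rw [hvw, hΦn]
  have hln : ‖constLap h A hA G⁻¹ v‖ = ‖constLap h At hAt G⁻¹ w‖ := by rw [hlap, hΦn]
  refine ⟨?_, fun j l => ?_, fun l => ?_⟩
  · rw [hvn, hlap, hvw, ← map_smul, ← map_sub, hΦn]
    exact h1
  · rw [hD2, hΦn, hln, hvn]
    exact (h2 j l).trans (hle _ (by positivity))
  · rw [hln, hvn, hvw, hD l w hw0, hΦn]
    exact (h3 l).trans (hle _ (by positivity))

end LocalFrozen

section VariableCoefficients

open scoped ContDiff ComplexConjugate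

open TestFn

variable {ι : Type} [Fintype ι]

theorem norm_mulOp_le_of_ball (f : (ι → ℝ) → ℂ) (hf : ContDiff ℝ ∞ f) {C : ℝ} (hC : 0 ≤ C)
    {y : ι → ℝ} {r : ℝ} (hfC : ∀ Z, ‖Z - y‖ ≤ r → ‖f Z‖ ≤ C) {u : TestFn ι}
    (hu : ∀ Z, r < ‖Z - y‖ → u Z = 0) : ‖mulOp f hf u‖ ≤ C * ‖u‖ := by
  refine norm_le_of_forall_le hC _ _ fun Z => ?_
  rw [mulOp_apply, norm_mul]
  rcases le_or_gt ‖Z - y‖ r with hZ | hZ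
  · exact mul_le_mul_of_nonneg_right (hfC Z hZ) (norm_nonneg _)
  · rw [hu Z hZ]
    simp

theorem norm_sum_univ_le {κ E : Type*} [Fintype κ] [SeminormedAddCommGroup E] (x : κ → E) {b : ℝ}
    (hx : ∀ j, ‖x j‖ ≤ b) : ‖∑ j, x j‖ ≤ Fintype.card κ * b := by
  refine (norm_sum_le_of_le _ fun j _ => hx j).trans ?_
  rw [Finset.sum_const, nsmul_eq_mul, Finset.card_univ]

variable [DecidableEq ι]

/-- A second order magnetic operator with variable coefficients. -/
def varOp (h : ℝ) (A : ι → (ι → ℝ) → ℝ) (hA : ∀ j, ContDiff ℝ ∞ (A j))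
    (Q : ι → ι → (ι → ℝ) → ℝ) (hQ : ∀ j l, ContDiff ℝ ∞ (Q j l))
    (b : ι → (ι → ℝ) → ℂ) (hb : ∀ l, ContDiff ℝ ∞ (b l)) (V : (ι → ℝ) → ℝ)
    (hV : ContDiff ℝ ∞ V) : TestFn ι →ₗ[ℂ] TestFn ι :=
  ∑ j, ∑ l, mulOp (fun Z => (Q j l Z : ℂ)) (hQ j l).complex_ofReal ∘ₗ magD h A hA j ∘ₗ
    magD h A hA l + ∑ l, mulOp (b l) (hb l) ∘ₗ magD h A hA l +
    mulOp (fun Z => (V Z : ℂ)) hV.complex_ofReal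

theorem varOp_apply_apply (h : ℝ) (A : ι → (ι → ℝ) → ℝ) (hA : ∀ j, ContDiff ℝ ∞ (A j))
    (Q : ι → ι → (ι → ℝ) → ℝ) (hQ : ∀ j l, ContDiff ℝ ∞ (Q j l))
    (b : ι → (ι → ℝ) → ℂ) (hb : ∀ l, ContDiff ℝ ∞ (b l)) (V : (ι → ℝ) → ℝ)
    (hV : ContDiff ℝ ∞ V) (u : TestFn ι) (Z : ι → ℝ) :
    varOp h A hA Q hQ b hb V hV u Z =
      ∑ j, ∑ l, (Q j l Z : ℂ) * magD h A hA j (magD h A hA l u) Z +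
      ∑ l, b l Z * magD h A hA l u Z + V Z * u Z := by
  simp [varOp, LinearMap.add_apply, LinearMap.sum_apply, TestFn.add_apply, TestFn.sum_apply]

theorem norm_varOp_sub_constLap_le (h : ℝ) (A : ι → (ι → ℝ) → ℝ) (hA : ∀ j, ContDiff ℝ ∞ (A j))
    (Q : ι → ι → (ι → ℝ) → ℝ) (hQ : ∀ j l, ContDiff ℝ ∞ (Q j l))
    (b : ι → (ι → ℝ) → ℂ) (hb : ∀ l, ContDiff ℝ ∞ (b l)) (V : (ι → ℝ) → ℝ)
    (hV : ContDiff ℝ ∞ V) (P : Matrix ι ι ℝ) (y : ι → ℝ) (r η Cf X : ℝ) (hη : 0 ≤ η)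
    (hQP : ∀ Z, ‖Z - y‖ ≤ r → ∀ j l, |Q j l Z - P j l| ≤ η)
    (hbη : ∀ Z, ‖Z - y‖ ≤ r → ∀ l, ‖b l Z‖ ≤ η)
    (hVη : ∀ Z, ‖Z - y‖ ≤ r → |V Z - V y| ≤ η) (v : TestFn ι)
    (hv : ∀ Z, r < ‖Z - y‖ → v Z = 0)
    (h2 : ∀ j l, ‖magD h A hA j (magD h A hA l v)‖ ≤ Cf * X)
    (h1 : ∀ l, ‖magD h A hA l v‖ ≤ Cf * X) (h0 : ‖v‖ ≤ X) :
    ‖varOp h A hA Q hQ b hb V hV v - constLap h A hA P v - (V y : ℂ) • v‖ ≤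
      η * (Fintype.card ι * (Fintype.card ι * Cf) + Fintype.card ι * Cf + 1) * X := by
  have key : varOp h A hA Q hQ b hb V hV v - constLap h A hA P v - (V y : ℂ) • v =
      ∑ j, ∑ l, mulOp (fun Z => (Q j l Z : ℂ) - (P j l : ℂ))
        ((hQ j l).complex_ofReal.sub contDiff_const) (magD h A hA j (magD h A hA l v)) +
      ∑ l, mulOp (b l) (hb l) (magD h A hA l v) +
      mulOp (fun Z => (V Z : ℂ) - (V y : ℂ)) (hV.complex_ofReal.sub contDiff_const) v := by
    ext Z
    simp only [TestFn.sub_apply, varOp_apply_apply, constLap, TestFn.add_apply, TestFn.sum_apply,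
      TestFn.smul_apply, mulOp_apply, sub_mul, Finset.sum_sub_distrib]
    ring
  rw [key]
  have e2 : ∀ j l, ‖mulOp (fun Z => (Q j l Z : ℂ) - (P j l : ℂ))
      ((hQ j l).complex_ofReal.sub contDiff_const) (magD h A hA j (magD h A hA l v))‖ ≤
      η * (Cf * X) := fun j l =>
    (norm_mulOp_le_of_ball _ _ hη (fun Z hZ => by
      rw [← Complex.ofReal_sub, Complex.norm_real]; exact hQP Z hZ j l)
      (magD_eq_zero h A hA j (magD_eq_zero h A hA l hv))).trans
      (mul_le_mul_of_nonneg_left (h2 j l) hη)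
  have e1 : ∀ l, ‖mulOp (b l) (hb l) (magD h A hA l v)‖ ≤ η * (Cf * X) := fun l =>
    (norm_mulOp_le_of_ball _ _ hη (fun Z hZ => hbη Z hZ l) (magD_eq_zero h A hA l hv)).trans
      (mul_le_mul_of_nonneg_left (h1 l) hη)
  have e0 : ‖mulOp (fun Z => (V Z : ℂ) - (V y : ℂ)) (hV.complex_ofReal.sub contDiff_const) v‖ ≤
      η * X :=
    (norm_mulOp_le_of_ball _ _ hη (fun Z hZ => by
      rw [← Complex.ofReal_sub, Complex.norm_real]; exact hVη Z hZ) hv).trans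
      (mul_le_mul_of_nonneg_left h0 hη)
  refine (norm_add₃_le).trans ?_
  have f2 := norm_sum_univ_le _ fun j => norm_sum_univ_le _ (e2 j)
  have f1 := norm_sum_univ_le _ e1
  refine (add_le_add (add_le_add f2 f1) e0).trans (le_of_eq ?_)
  ring

theorem lower_bound_perturb {F t x v s η θd m : ℝ} (hv : 0 ≤ v) (hF : t ≤ F + s)
    (hx : x ≤ t + m * v) (hη0 : 0 ≤ η) (hs : s ≤ η * (x + v)) (hη : η ≤ 1 / 2)
    (hηd : η * (1 + m) ≤ θd / 4) (hlow : θd * v ≤ t) (ht : 0 ≤ t) : θd / 4 * v ≤ F := by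
  have h1 : η * (x + v) ≤ η * (t + m * v + v) := mul_le_mul_of_nonneg_left (by linarith) hη0
  have h2 : η * t ≤ 1 / 2 * t := mul_le_mul_of_nonneg_right hη ht
  have h3 := mul_le_mul_of_nonneg_right hηd hv
  have h4 : η * (t + m * v + v) = η * t + η * (1 + m) * v := by ring
  linarith

/-- Local lower bound for the variable coefficient operator. -/
theorem exists_local_bound (n : ℕ) (ι : Type) [Fintype ι] [DecidableEq ι]
    (b₀ K' ε CG C₀ C₁ : ℝ) (hb₀ : 0 < b₀) (hε : 0 < ε) (hCG : 0 ≤ CG) (hC₀ : 0 ≤ C₀)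
    (hC₁ : 0 ≤ C₁) (hK' : 0 ≤ K') :
    ∃ θ Cf, 0 < θ ∧ 0 ≤ Cf ∧ ∀ (A : ι → (ι → ℝ) → ℝ) (hA : ∀ j, ContDiff ℝ ∞ (A j))
      (Q : ι → ι → (ι → ℝ) → ℝ) (hQ : ∀ j l, ContDiff ℝ ∞ (Q j l))
      (b : ι → (ι → ℝ) → ℂ) (hb : ∀ l, ContDiff ℝ ∞ (b l)) (V : (ι → ℝ) → ℝ)
      (hV : ContDiff ℝ ∞ V)
      (y : ι → ℝ) (r : ℝ), (∀ j k, |curvature A y j k| ≤ C₀) →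
      (∀ Z j k, |curvature A Z j k - curvature A y j k| ≤ C₁ * ‖Z - y‖) →
      0 < r → Cf * r ≤ 1 →
      ∀ (G : Matrix ι ι ℝ), G.IsSymm →
      (∀ v : ι → ℝ, ε * ∑ j, v j ^ 2 ≤ ∑ j, ∑ l, G j l * v j * v l) → (∀ j, G j j ≤ CG) →
      ∀ (a : Fin n → ℝ), (∀ j, b₀ ≤ a j) →
      (G⁻¹ * curvature A y).charpoly = ∏ j, (X ^ 2 + C (a j ^ 2)) →
      (∀ Z, ‖Z - y‖ ≤ r → ∀ j l, |Q j l Z - G⁻¹ j l| ≤ C₁ * r) →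
      (∀ Z, ‖Z - y‖ ≤ r → ∀ l, ‖b l Z‖ ≤ C₁ * r) →
      (∀ Z, ‖Z - y‖ ≤ r → |V Z - V y| ≤ C₁ * r) →
      ∀ h, 0 < h → ∀ d lam, 0 < d → d ≤ b₀ → Cf * r ≤ d → |lam - V y| ≤ K' →
      (∀ k : Fin n → ℕ, d ≤ |lam - (∑ j, (2 * (k j : ℝ) + 1) * a j + V y)|) → ∀ v : TestFn ι,
      (∀ Z, r < ‖Z - y‖ → v Z = 0) →
      θ * d * ‖v‖ ≤ ‖varOp h A hA Q hQ b hb V hV v - (lam : ℂ) • v‖ := by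
  obtain ⟨θ, Cf, hθ0, hθ1, hCf, H⟩ :=
    exists_local_frozen_bound n ι b₀ K' ε CG C₀ C₁ hb₀ hε hCG hC₀ hC₁
  set c : ℝ := C₁ * (Fintype.card ι * (Fintype.card ι * Cf) + Fintype.card ι * Cf + 1) with hc
  have hc0 : 0 ≤ c := by positivity
  have hCx : 0 ≤ 4 * c * (1 + K') / θ := by positivity
  refine ⟨θ / 4, Cf + 2 * c + 4 * c * (1 + K') / θ, by positivity, by positivity, ?_⟩
  intro A hA Q hQ b hb V hV y r hB0 hB1 hr hr1 G hGs hGp hGC a ha hchar hQy hby hVy h hh d lam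
    hd hdb hrd hlam hgap v hv
  have hexp : (Cf + 2 * c + 4 * c * (1 + K') / θ) * r =
    Cf * r + 2 * (c * r) + 4 * c * (1 + K') / θ * r := by ring
  have hp1 : 0 ≤ Cf * r := by positivity
  have hp2 : 0 ≤ c * r := by positivity
  have hp3 : 0 ≤ 4 * c * (1 + K') / θ * r := by positivity
  obtain ⟨h1, h2, h3⟩ := H A hA y r hB0 hB1 hr (by linarith) G hGs hGp hGC a ha hchar h hh d
    (lam - V y) hd hdb (by linarith) ((le_abs_self _).trans hlam)
    (fun k => by convert hgap k using 2; ring) v hv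
  have hpert := norm_varOp_sub_constLap_le h A hA Q hQ b hb V hV G⁻¹ y r (C₁ * r) Cf
    (‖constLap h A hA G⁻¹ v‖ + ‖v‖) (by positivity) hQy hby hVy v hv h2 h3
    (le_add_of_nonneg_left (norm_nonneg _))
  set T := constLap h A hA G⁻¹ v with hT
  set W := varOp h A hA Q hQ b hb V hV v with hW
  have e1 : T - ((lam - V y : ℝ) : ℂ) • v = (W - (lam : ℂ) • v) - (W - T - (V y : ℂ) • v) := by
    push_cast
    rw [sub_smul]
    abel
  have e2 : T = (T - ((lam - V y : ℝ) : ℂ) • v) + ((lam - V y : ℝ) : ℂ) • v := by abel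
  have f1 := norm_sub_le (W - (lam : ℂ) • v) (W - T - (V y : ℂ) • v)
  rw [← e1] at f1
  have f2 := norm_add_le (T - ((lam - V y : ℝ) : ℂ) • v) (((lam - V y : ℝ) : ℂ) • v)
  rw [← e2, norm_smul, Complex.norm_real, Real.norm_eq_abs] at f2
  have f3 : |lam - V y| * ‖v‖ ≤ K' * ‖v‖ := mul_le_mul_of_nonneg_right hlam (norm_nonneg _)
  have f4 : c * r * (1 + K') ≤ θ * d / 4 := by
    have : 4 * c * (1 + K') / θ * r ≤ d := by linarith
    rw [div_mul_eq_mul_div, div_le_iff₀ hθ0] at this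
    linarith
  have := lower_bound_perturb (η := c * r) (θd := θ * d) (m := K') (norm_nonneg v) f1
    (f2.trans (by linarith)) hp2 (hpert.trans (le_of_eq (by rw [hc]; ring))) (by linarith) f4 h1
    (norm_nonneg _)
  linarith

end VariableCoefficients

section Energy

open scoped ContDiff ComplexConjugate

open TestFn

variable {ι : Type} [Fintype ι]

theorem re_sum_inner_mulOp_ge (Q : ι → ι → (ι → ℝ) → ℝ) (hQ : ∀ j l, ContDiff ℝ ∞ (Q j l))
    {c₀ : ℝ} (hpos : ∀ Z (x : ι → ℝ), c₀ * ∑ j, x j ^ 2 ≤ ∑ j, ∑ l, Q j l Z * x j * x l)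
    (X : ι → TestFn ι) :
    c₀ * ∑ j, ‖X j‖ ^ 2 ≤ (∑ j, ∑ l,
      inner ℂ (mulOp (fun Z => (Q j l Z : ℂ)) (hQ j l).complex_ofReal (X j)) (X l)).re := by
  have hI : ∀ j l, Integrable fun Z => conj ((Q j l Z : ℂ) * X j Z) * X l Z := fun j l =>
    integrable_inner (mulOp (fun Z => (Q j l Z : ℂ)) (hQ j l).complex_ofReal (X j)) (X l)
  have h1 : ∑ j, ∑ l,
      inner ℂ (mulOp (fun Z => (Q j l Z : ℂ)) (hQ j l).complex_ofReal (X j)) (X l) =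
      ∫ Z, ∑ j, ∑ l, conj ((Q j l Z : ℂ) * X j Z) * X l Z := by
    rw [integral_finsetSum _ fun j _ => integrable_finsetSum _ fun l _ => hI j l]
    refine Finset.sum_congr rfl fun j _ => ?_
    rw [integral_finsetSum _ fun l _ => hI j l]
    rfl
  have hint : Integrable fun Z => ∑ j, ∑ l, conj ((Q j l Z : ℂ) * X j Z) * X l Z :=
    integrable_finsetSum _ fun j _ => integrable_finsetSum _ fun l _ => hI j l
  have h2 : c₀ * ∑ j, ‖X j‖ ^ 2 = ∫ Z, c₀ * ∑ j, ‖X j Z‖ ^ 2 := by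
    rw [integral_const_mul, integral_finsetSum _ fun j _ => (X j).integrable_norm_sq]
    simp only [norm_sq]
  rw [h1, h2, ← RCLike.re_eq_complex_re, ← integral_re hint]
  refine integral_mono ((integrable_finsetSum _ fun j _ =>
    (X j).integrable_norm_sq).const_mul c₀) hint.re fun Z => ?_
  have e1 := hpos Z fun j => (X j Z).re
  have e2 := hpos Z fun j => (X j Z).im
  have e3 : RCLike.re (∑ j, ∑ l, conj ((Q j l Z : ℂ) * X j Z) * X l Z) =
      ∑ j, ∑ l, Q j l Z * (X j Z).re * (X l Z).re +
        ∑ j, ∑ l, Q j l Z * (X j Z).im * (X l Z).im := by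
    rw [RCLike.re_eq_complex_re, ← Finset.sum_add_distrib, Complex.re_sum]
    refine Finset.sum_congr rfl fun j _ => ?_
    rw [← Finset.sum_add_distrib, Complex.re_sum]
    refine Finset.sum_congr rfl fun l _ => ?_
    simp
  have e4 : ∑ j, ‖X j Z‖ ^ 2 = ∑ j, (X j Z).re ^ 2 + ∑ j, (X j Z).im ^ 2 := by
    rw [← Finset.sum_add_distrib]
    refine Finset.sum_congr rfl fun j _ => ?_
    rw [Complex.sq_norm, Complex.normSq_apply]
    ring
  simp only [e3, e4]
  linarith

theorem norm_inner_le_of_le {E : Type*} [NormedAddCommGroup E] [InnerProductSpace ℂ E] {x y : E}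
    {a b : ℝ} (hx : ‖x‖ ≤ a) (hy : ‖y‖ ≤ b) (ha : 0 ≤ a) : ‖inner ℂ x y‖ ≤ a * b :=
  (norm_inner_le_norm x y).trans (mul_le_mul hx hy (norm_nonneg _) ha)

variable [DecidableEq ι]

theorem inner_mulOp_magD_magD (h : ℝ) (A : ι → (ι → ℝ) → ℝ) (hA : ∀ j, ContDiff ℝ ∞ (A j))
    (q : (ι → ℝ) → ℝ) (hq : ContDiff ℝ ∞ q) (u X : TestFn ι) (j : ι) :
    inner ℂ u (mulOp (fun Z => (q Z : ℂ)) hq.complex_ofReal (magD h A hA j X)) =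
      inner ℂ (mulOp (fun Z => (q Z : ℂ)) hq.complex_ofReal (magD h A hA j u)) X +
      inner ℂ ((Complex.I * h) • mulOp (fun Z => fderiv ℝ (fun Z => (q Z : ℂ)) Z (Pi.single j 1))
        (contDiff_fderiv_apply hq.complex_ofReal _) u) X := by
  rw [← inner_mulOp _ _ (fun Z => Complex.conj_ofReal _), magD, ← inner_magOp, magOp_mulOp,
    inner_add_left]

theorem sq_le_of_energy {c₀ s u f M C : ℝ} (hc₀ : 0 < c₀)
    (h : c₀ * s ^ 2 ≤ u * f + C * u ^ 2 + M * (u * s)) :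
    s ^ 2 ≤ (1 / c₀ + 2 * C / c₀ + M ^ 2 / c₀ ^ 2) * u ^ 2 + 1 / c₀ * f ^ 2 := by
  have h1 : 0 ≤ (c₀ * s - M * u) ^ 2 := sq_nonneg _
  have h2 : 0 ≤ (u - f) ^ 2 := sq_nonneg _
  have h3 : c₀ ^ 2 * s ^ 2 ≤ (c₀ + 2 * C * c₀ + M ^ 2) * u ^ 2 + c₀ * f ^ 2 := by
    have h4 := mul_le_mul_of_nonneg_left h (by positivity : 0 ≤ 2 * c₀)
    have h5 : 0 ≤ c₀ * (u - f) ^ 2 := by positivity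
    nlinarith
  have h6 : (1 / c₀ + 2 * C / c₀ + M ^ 2 / c₀ ^ 2) * u ^ 2 + 1 / c₀ * f ^ 2 =
      ((c₀ + 2 * C * c₀ + M ^ 2) * u ^ 2 + c₀ * f ^ 2) / c₀ ^ 2 := by
    field_simp
  rw [h6, le_div_iff₀ (by positivity)]
  linarith

/-- The energy estimate. -/
theorem exists_energy_bound (ι : Type) [Fintype ι] [DecidableEq ι] (c₀ C : ℝ) (hc₀ : 0 < c₀)
    (hC : 0 ≤ C) : ∃ C', 0 ≤ C' ∧ ∀ (h : ℝ) (A : ι → (ι → ℝ) → ℝ) (hA : ∀ j, ContDiff ℝ ∞ (A j))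
    (Q : ι → ι → (ι → ℝ) → ℝ) (hQ : ∀ j l, ContDiff ℝ ∞ (Q j l))
    (b : ι → (ι → ℝ) → ℂ) (hb : ∀ l, ContDiff ℝ ∞ (b l)) (V : (ι → ℝ) → ℝ)
    (hV : ContDiff ℝ ∞ V) (lam : ℝ), 0 ≤ h → h ≤ 1 →
    (∀ Z (x : ι → ℝ), c₀ * ∑ j, x j ^ 2 ≤ ∑ j, ∑ l, Q j l Z * x j * x l) →
    (∀ Z i j l, ‖fderiv ℝ (fun Z => (Q j l Z : ℂ)) Z (Pi.single i 1)‖ ≤ C) →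
    (∀ Z l, ‖b l Z‖ ≤ C) → (∀ Z, |V Z - lam| ≤ C) → ∀ u : TestFn ι,
    ∑ l, ‖magD h A hA l u‖ ^ 2 ≤
      C' * (‖u‖ ^ 2 + ‖varOp h A hA Q hQ b hb V hV u - (lam : ℂ) • u‖ ^ 2) := by
  set N : ℝ := ((Fintype.card ι : ℕ) : ℝ) with hN
  have hN0 : 0 ≤ N := Nat.cast_nonneg _
  set M : ℝ := N * (N * C) + N * C with hM
  refine ⟨1 / c₀ + 2 * C / c₀ + M ^ 2 / c₀ ^ 2, by positivity, ?_⟩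
  intro h A hA Q hQ b hb V hV lam hh0 hh1 hpos hQd hbC hVC u
  set f := varOp h A hA Q hQ b hb V hV u - (lam : ℂ) • u with hf
  set S := ∑ l, ‖magD h A hA l u‖ ^ 2 with hS
  have hS0 : 0 ≤ S := Finset.sum_nonneg fun _ _ => sq_nonneg _
  have hsS : Real.sqrt S ^ 2 = S := Real.sq_sqrt hS0
  have hXs : ∀ l, ‖magD h A hA l u‖ ≤ Real.sqrt S := fun l =>
    Real.le_sqrt_of_sq_le (Finset.single_le_sum (f := fun l => ‖magD h A hA l u‖ ^ 2)
      (fun _ _ => sq_nonneg _) (Finset.mem_univ l))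
  have hu0 : 0 ≤ ‖u‖ := norm_nonneg _
  have key : ∑ j, ∑ l, inner ℂ (mulOp (fun Z => (Q j l Z : ℂ)) (hQ j l).complex_ofReal
        (magD h A hA j u)) (magD h A hA l u) =
      inner ℂ u f - ∑ j, ∑ l, inner ℂ ((Complex.I * h) • mulOp
        (fun Z => fderiv ℝ (fun Z => (Q j l Z : ℂ)) Z (Pi.single j 1))
        (contDiff_fderiv_apply (hQ j l).complex_ofReal _) u) (magD h A hA l u) -
      ∑ l, inner ℂ u (mulOp (b l) (hb l) (magD h A hA l u)) -
      inner ℂ u (mulOp (fun Z => (V Z : ℂ) - (lam : ℂ))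
        (hV.complex_ofReal.sub contDiff_const) u) := by
    have h1 : f = ∑ j, ∑ l, mulOp (fun Z => (Q j l Z : ℂ)) (hQ j l).complex_ofReal
        (magD h A hA j (magD h A hA l u)) + ∑ l, mulOp (b l) (hb l) (magD h A hA l u) +
        mulOp (fun Z => (V Z : ℂ) - (lam : ℂ)) (hV.complex_ofReal.sub contDiff_const) u := by
      ext Z
      rw [hf]
      simp only [TestFn.sub_apply, varOp_apply_apply, TestFn.add_apply, TestFn.sum_apply,
        TestFn.smul_apply, mulOp_apply, sub_mul]
      ring
    rw [h1]
    have h2 : ∀ j l, inner ℂ u (mulOp (fun Z => (Q j l Z : ℂ)) (hQ j l).complex_ofReal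
        (magD h A hA j (magD h A hA l u))) = _ := fun j l =>
      inner_mulOp_magD_magD h A hA (Q j l) (hQ j l) u (magD h A hA l u) j
    simp only [inner_add_right, inner_sum, h2, Finset.sum_add_distrib]
    abel
  have h1 := re_sum_inner_mulOp_ge Q hQ hpos fun l => magD h A hA l u
  rw [key, Complex.sub_re, Complex.sub_re, Complex.sub_re] at h1
  have b1 : |(inner ℂ u f).re| ≤ ‖u‖ * ‖f‖ :=
    (Complex.abs_re_le_norm _).trans (norm_inner_le_norm u f)
  have b2 : ‖∑ j, ∑ l, inner ℂ ((Complex.I * h) • mulOp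
        (fun Z => fderiv ℝ (fun Z => (Q j l Z : ℂ)) Z (Pi.single j 1))
        (contDiff_fderiv_apply (hQ j l).complex_ofReal _) u) (magD h A hA l u)‖ ≤
      N * (N * (C * ‖u‖ * Real.sqrt S)) := by
    refine norm_sum_univ_le _ fun j => norm_sum_univ_le _ fun l =>
      norm_inner_le_of_le ?_ (hXs l) (by positivity)
    rw [norm_smul, norm_mul, Complex.norm_I, one_mul, Complex.norm_real, Real.norm_eq_abs,
      abs_of_nonneg hh0]
    refine (mul_le_of_le_one_left (norm_nonneg _) hh1).trans ?_
    exact norm_le_of_forall_le hC _ _ fun Z => by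
      rw [mulOp_apply, norm_mul]
      exact mul_le_mul_of_nonneg_right (hQd _ _ _ _) (norm_nonneg _)
  have b3 : ‖∑ l, inner ℂ u (mulOp (b l) (hb l) (magD h A hA l u))‖ ≤
      N * (‖u‖ * (C * Real.sqrt S)) :=
    norm_sum_univ_le _ fun l => norm_inner_le_of_le le_rfl
      ((norm_le_of_forall_le hC _ _ fun Z => by
        rw [mulOp_apply, norm_mul]
        exact mul_le_mul_of_nonneg_right (hbC _ _) (norm_nonneg _)).trans
        (mul_le_mul_of_nonneg_left (hXs l) hC)) hu0
  have b4 : ‖inner ℂ u (mulOp (fun Z => (V Z : ℂ) - (lam : ℂ))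
        (hV.complex_ofReal.sub contDiff_const) u)‖ ≤ ‖u‖ * (C * ‖u‖) :=
    norm_inner_le_of_le le_rfl (norm_le_of_forall_le hC _ _ fun Z => by
        rw [mulOp_apply, norm_mul, ← Complex.ofReal_sub, Complex.norm_real]
        exact mul_le_mul_of_nonneg_right (hVC _) (norm_nonneg _)) hu0
  have b1' := (abs_le.1 b1).2
  have b2' := (abs_le.1 ((Complex.abs_re_le_norm _).trans b2)).1
  have b3' := (abs_le.1 ((Complex.abs_re_le_norm _).trans b3)).1
  have b4' := (abs_le.1 ((Complex.abs_re_le_norm _).trans b4)).1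
  have h2 : c₀ * Real.sqrt S ^ 2 ≤ ‖u‖ * ‖f‖ + C * ‖u‖ ^ 2 + M * (‖u‖ * Real.sqrt S) := by
    rw [hsS]
    have e : M * (‖u‖ * Real.sqrt S) = N * (N * (C * ‖u‖ * Real.sqrt S)) +
      N * (‖u‖ * (C * Real.sqrt S)) := by rw [hM]; ring
    have e' : C * ‖u‖ ^ 2 = ‖u‖ * (C * ‖u‖) := by ring
    rw [e, e']
    linarith
  have h3 := sq_le_of_energy hc₀ h2
  rw [hsS] at h3
  refine h3.trans ?_
  rw [mul_add]
  have h4 : 0 ≤ (2 * C / c₀ + M ^ 2 / c₀ ^ 2) * ‖f‖ ^ 2 := by positivity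
  linarith

end Energy

section Globalization

open scoped ContDiff ComplexConjugate

open TestFn

variable {ι : Type} [Fintype ι] [DecidableEq ι]

theorem fderiv_comp_scale {F : (ι → ℝ) → ℂ} (hF : Differentiable ℝ F) (y : ι → ℝ) (t : ℝ)
    (Z v : ι → ℝ) :
    fderiv ℝ (fun Z => F (t • (Z - y))) Z v = t * fderiv ℝ F (t • (Z - y)) v := by
  have h1 : HasFDerivAt (fun Z : ι → ℝ => t • (Z - y)) (t • ContinuousLinearMap.id ℝ (ι → ℝ)) Z :=
    ((hasFDerivAt_id Z).sub_const y).const_smul t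
  have h2 := (hF (t • (Z - y))).hasFDerivAt.comp Z h1
  have h3 : fderiv ℝ (fun Z => F (t • (Z - y))) Z = _ := h2.fderiv
  rw [h3]
  simp

/-- Derivative bounds for rescaled cutoffs. -/
theorem exists_cutoffFn_bound (ι : Type) [Fintype ι] [DecidableEq ι] :
    ∃ C, 0 ≤ C ∧ ∀ (y : ι → ℝ) (r : ℝ) (hr : 0 < r) (Z : ι → ℝ) (i j : ι),
      ‖dirOp (Pi.single j 1) (cutoffFn y r hr) Z‖ ≤ C * r⁻¹ ∧
      ‖dirOp (Pi.single i 1) (dirOp (Pi.single j 1) (cutoffFn y r hr)) Z‖ ≤ C * (r⁻¹ * r⁻¹) := by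
  have h1 : ∀ j : ι, ∃ C, 0 ≤ C ∧ ∀ Z,
      ‖dirOp (Pi.single j 1) (cutoffFn (0 : ι → ℝ) 1 one_pos) Z‖ ≤ C := fun j => exists_bound _
  have h2 : ∀ i j : ι, ∃ C, 0 ≤ C ∧ ∀ Z, ‖dirOp (Pi.single i 1)
      (dirOp (Pi.single j 1) (cutoffFn (0 : ι → ℝ) 1 one_pos)) Z‖ ≤ C := fun i j => exists_bound _
  choose C1 hC1 hC1' using h1
  choose C2 hC2 hC2' using h2
  have hs1 : ∀ j, C1 j ≤ ∑ j, C1 j := fun j =>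
    Finset.single_le_sum (fun j _ => hC1 j) (Finset.mem_univ j)
  have hs2 : ∀ i j, C2 i j ≤ ∑ i, ∑ j, C2 i j := fun i j =>
    (Finset.single_le_sum (fun j _ => hC2 i j) (Finset.mem_univ j)).trans
      (Finset.single_le_sum (f := fun i => ∑ j, C2 i j)
        (fun i _ => Finset.sum_nonneg fun j _ => hC2 i j) (Finset.mem_univ i))
  have hs10 : 0 ≤ ∑ j, C1 j := Finset.sum_nonneg fun j _ => hC1 j
  have hs20 : 0 ≤ ∑ i, ∑ j, C2 i j := Finset.sum_nonneg fun i _ => Finset.sum_nonneg fun j _ => hC2 i j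
  refine ⟨∑ j, C1 j + ∑ i, ∑ j, C2 i j, by positivity, fun y r hr Z i j => ?_⟩
  have hr' : 0 < r⁻¹ := inv_pos.2 hr
  set χ := cutoffFn (0 : ι → ℝ) 1 one_pos with hχ
  have e0 : ∀ Z, cutoffFn y r hr Z = χ (r⁻¹ • (Z - y)) := by
    intro Z
    simp [hχ, cutoffFn_apply, cutoffAt]
  have e1 : ∀ Z, dirOp (Pi.single j 1) (cutoffFn y r hr) Z =
      (r⁻¹ : ℝ) * dirOp (Pi.single j 1) χ (r⁻¹ • (Z - y)) := by
    intro Z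
    rw [dirOp_apply, funext e0, fderiv_comp_scale χ.diff, dirOp_apply]
  have e2 : dirOp (Pi.single i 1) (dirOp (Pi.single j 1) (cutoffFn y r hr)) Z =
      (r⁻¹ : ℝ) * ((r⁻¹ : ℝ) * dirOp (Pi.single i 1) (dirOp (Pi.single j 1) χ) (r⁻¹ • (Z - y))) := by
    rw [dirOp_apply, funext e1, fderiv_const_mul, _root_.smul_apply, fderiv_comp_scale (dirOp _ χ).diff,
      ← dirOp_apply, smul_eq_mul]
    exact (dirOp (Pi.single j 1) χ).diff _ |>.comp Z
      (by fun_prop : DifferentiableAt ℝ (fun Z : ι → ℝ => r⁻¹ • (Z - y)) Z)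
  have f1 := (hC1' j (r⁻¹ • (Z - y))).trans (hs1 j)
  have f2 := (hC2' i j (r⁻¹ • (Z - y))).trans (hs2 i j)
  constructor
  · rw [e1, norm_mul, Complex.norm_real, Real.norm_eq_abs, abs_of_pos hr', mul_comm]
    exact mul_le_mul_of_nonneg_right (by linarith) hr'.le
  · rw [e2, norm_mul, norm_mul, Complex.norm_real, Real.norm_eq_abs, abs_of_pos hr', ← mul_assoc,
      mul_comm]
    exact mul_le_mul_of_nonneg_right (by linarith) (by positivity)

/-- Pointwise bound for the commutator with a cutoff. -/
theorem norm_varOp_mulOp_sub_le (h : ℝ) (A : ι → (ι → ℝ) → ℝ) (hA : ∀ j, ContDiff ℝ ∞ (A j))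
    (Q : ι → ι → (ι → ℝ) → ℝ) (hQ : ∀ j l, ContDiff ℝ ∞ (Q j l))
    (b : ι → (ι → ℝ) → ℂ) (hb : ∀ l, ContDiff ℝ ∞ (b l)) (V : (ι → ℝ) → ℝ)
    (hV : ContDiff ℝ ∞ V) (χ : TestFn ι) (u : TestFn ι) (Z : ι → ℝ) {C κ : ℝ} (hC : 0 ≤ C)
    (hκ : 0 ≤ κ) (hh : 0 ≤ h) (hQC : ∀ j l, |Q j l Z| ≤ C) (hbC : ∀ l, ‖b l Z‖ ≤ C)
    (h1 : ∀ l, h * ‖dirOp (Pi.single l 1) χ Z‖ ≤ κ)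
    (h2 : ∀ j l, h * (h * ‖dirOp (Pi.single j 1) (dirOp (Pi.single l 1) χ) Z‖) ≤ κ) :
    ‖(varOp h A hA Q hQ b hb V hV (mulOp χ χ.smooth u) -
        mulOp χ χ.smooth (varOp h A hA Q hQ b hb V hV u)) Z‖ ≤
      (Fintype.card ι * (Fintype.card ι * (3 * C)) + Fintype.card ι * C) * κ *
        (∑ l, ‖magD h A hA l u Z‖ + ‖u Z‖) := by
  set T := ∑ l, ‖magD h A hA l u Z‖ + ‖u Z‖ with hT
  have hs0 : 0 ≤ ∑ l, ‖magD h A hA l u Z‖ := Finset.sum_nonneg fun _ _ => norm_nonneg _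
  have hT0 : 0 ≤ T := add_nonneg hs0 (norm_nonneg _)
  have hXT : ∀ l, ‖magD h A hA l u Z‖ ≤ T := fun l =>
    (Finset.single_le_sum (f := fun l => ‖magD h A hA l u Z‖) (fun _ _ => norm_nonneg _)
      (Finset.mem_univ l)).trans (le_add_of_nonneg_right (norm_nonneg _))
  have huT : ‖u Z‖ ≤ T := le_add_of_nonneg_left hs0
  have d1 : ∀ l, magD h A hA l (mulOp χ χ.smooth u) = mulOp χ χ.smooth (magD h A hA l u) +
      (Complex.I * h) • mulOp (dirOp (Pi.single l 1) χ) (dirOp (Pi.single l 1) χ).smooth u :=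
    fun l => magOp_mulOp _ _ _ _ _ _ _
  have d2 : ∀ j l, magD h A hA j (mulOp (dirOp (Pi.single l 1) χ)
      (dirOp (Pi.single l 1) χ).smooth u) = mulOp (dirOp (Pi.single l 1) χ)
      (dirOp (Pi.single l 1) χ).smooth (magD h A hA j u) +
      (Complex.I * h) • mulOp (dirOp (Pi.single j 1) (dirOp (Pi.single l 1) χ))
        (dirOp (Pi.single j 1) (dirOp (Pi.single l 1) χ)).smooth u :=
    fun j l => magOp_mulOp _ _ _ _ _ _ _
  have d3 : ∀ j l, magD h A hA j (mulOp χ χ.smooth (magD h A hA l u)) =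
      mulOp χ χ.smooth (magD h A hA j (magD h A hA l u)) +
      (Complex.I * h) • mulOp (dirOp (Pi.single j 1) χ) (dirOp (Pi.single j 1) χ).smooth
        (magD h A hA l u) := fun j l => magOp_mulOp _ _ _ _ _ _ _
  have key : (varOp h A hA Q hQ b hb V hV (mulOp χ χ.smooth u) -
        mulOp χ χ.smooth (varOp h A hA Q hQ b hb V hV u)) Z =
      ∑ j, ∑ l, (Q j l Z : ℂ) * (Complex.I * (h * dirOp (Pi.single j 1) χ Z) * magD h A hA l u Z +
        Complex.I * (h * dirOp (Pi.single l 1) χ Z) * magD h A hA j u Z -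
        h * (h * dirOp (Pi.single j 1) (dirOp (Pi.single l 1) χ) Z) * u Z) +
      ∑ l, b l Z * (Complex.I * (h * dirOp (Pi.single l 1) χ Z) * u Z) := by
    simp only [TestFn.sub_apply, varOp_apply_apply, mulOp_apply, d1, d2, d3, map_add, map_smul,
      TestFn.add_apply, TestFn.smul_apply, mul_add, Finset.sum_add_distrib, Finset.mul_sum]
    have e : ∀ j l, (Q j l Z : ℂ) * (Complex.I * h * (Complex.I * h *
        (dirOp (Pi.single j 1) (dirOp (Pi.single l 1) χ) Z * u Z))) =
        -((Q j l Z : ℂ) * (h * (h * dirOp (Pi.single j 1) (dirOp (Pi.single l 1) χ) Z) * u Z)) := by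
      intro j l
      linear_combination (Q j l Z * h * h *
        (dirOp (Pi.single j 1) (dirOp (Pi.single l 1) χ) Z * u Z)) * Complex.I_sq
    simp only [e, mul_sub, mul_add, Finset.sum_add_distrib, Finset.sum_sub_distrib,
      Finset.sum_neg_distrib]
    simp only [mul_assoc, mul_comm, mul_left_comm]
    ring
  have n1 : ∀ l, ‖(h : ℂ) * dirOp (Pi.single l 1) χ Z‖ ≤ κ := fun l => by
    rw [norm_mul, Complex.norm_real, Real.norm_eq_abs, abs_of_nonneg hh]
    exact h1 l
  have n2 : ∀ j l, ‖(h : ℂ) * (h * dirOp (Pi.single j 1) (dirOp (Pi.single l 1) χ) Z)‖ ≤ κ :=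
    fun j l => by
      rw [norm_mul, norm_mul, Complex.norm_real, Real.norm_eq_abs, abs_of_nonneg hh]
      exact h2 j l
  have m1 : ∀ l (x : ℂ), ‖x‖ ≤ T →
      ‖Complex.I * ((h : ℂ) * dirOp (Pi.single l 1) χ Z) * x‖ ≤ κ * T := fun l x hx => by
    rw [norm_mul, norm_mul, Complex.norm_I, one_mul]
    exact mul_le_mul (n1 l) hx (norm_nonneg _) hκ
  have m2 : ∀ j l, ‖(h : ℂ) * (h * dirOp (Pi.single j 1) (dirOp (Pi.single l 1) χ) Z) * u Z‖ ≤
      κ * T := fun j l => by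
    rw [norm_mul]
    exact mul_le_mul (n2 j l) huT (norm_nonneg _) hκ
  rw [key]
  refine (norm_add_le _ _).trans ((add_le_add (norm_sum_univ_le _ fun j =>
    norm_sum_univ_le (b := C * (3 * (κ * T))) _ fun l => ?_)
    (norm_sum_univ_le (b := C * (κ * T)) _ fun l => ?_)).trans (le_of_eq (by ring)))
  · rw [norm_mul, Complex.norm_real]
    refine mul_le_mul (hQC j l) ((norm_sub_le _ _).trans ?_) (norm_nonneg _) hC
    have := norm_add_le (Complex.I * ((h : ℂ) * dirOp (Pi.single j 1) χ Z) * magD h A hA l u Z)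
      (Complex.I * ((h : ℂ) * dirOp (Pi.single l 1) χ Z) * magD h A hA j u Z)
    linarith [m1 j _ (hXT l), m1 l _ (hXT j), m2 j l]
  · rw [norm_mul]
    exact mul_le_mul (hbC l) (m1 l _ huT) (norm_nonneg _) hC

end Globalization

section GlobalBound

open scoped ContDiff ComplexConjugate

open TestFn

/-- Sum of the squared commutators of an operator with the cutoffs of a lattice partition. -/
theorem exists_sum_commutator_bound (ι : Type) [Fintype ι] [DecidableEq ι] (C₁ : ℝ)
    (hC₁ : 0 ≤ C₁) : ∃ E, 0 ≤ E ∧ ∀ (h : ℝ) (A : ι → (ι → ℝ) → ℝ) (hA : ∀ j, ContDiff ℝ ∞ (A j))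
    (Q : ι → ι → (ι → ℝ) → ℝ) (hQ : ∀ j l, ContDiff ℝ ∞ (Q j l))
    (b : ι → (ι → ℝ) → ℂ) (hb : ∀ l, ContDiff ℝ ∞ (b l)) (V : (ι → ℝ) → ℝ)
    (hV : ContDiff ℝ ∞ V) (r : ℝ) (hr : 0 < r / 2), r ≤ 1 → h = r ^ 2 →
    (∀ Z j l, |Q j l Z| ≤ C₁) → (∀ Z l, ‖b l Z‖ ≤ C₁) →
    ∀ (u : TestFn ι) (s : Finset (ι → ℤ)),
    ∑ i ∈ s, ‖varOp h A hA Q hQ b hb V hV (mulOp (cutoffFn (latticePt (r / 2) i) (r / 2) hr)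
        (cutoffFn (latticePt (r / 2) i) (r / 2) hr).smooth u) -
        mulOp (cutoffFn (latticePt (r / 2) i) (r / 2) hr)
        (cutoffFn (latticePt (r / 2) i) (r / 2) hr).smooth (varOp h A hA Q hQ b hb V hV u)‖ ^ 2 ≤
      E * r ^ 2 * (∑ l, ‖magD h A hA l u‖ ^ 2 + ‖u‖ ^ 2) := by
  obtain ⟨Cχ, hCχ0, hCχ⟩ := exists_cutoffFn_bound ι
  set N : ℝ := ((Fintype.card ι : ℕ) : ℝ) with hN
  have hN0 : 0 ≤ N := Nat.cast_nonneg _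
  set M₀ : ℝ := N * (N * (3 * C₁)) + N * C₁ with hM₀
  have hM₀0 : 0 ≤ M₀ := by positivity
  set E : ℝ := (M₀ * (4 * Cχ)) ^ 2 * (2 * N + 2) with hE
  have hE0 : 0 ≤ E := by positivity
  refine ⟨(2 * (2 : ℕ) + 1) ^ Fintype.card ι * E, by positivity, ?_⟩
  intro h A hA Q hQ b hb V hV r hr hr1 hh hQC hbC u s
  have hr0 : 0 < r := by linarith
  have hh0 : 0 ≤ h := by rw [hh]; positivity
  set y := latticePt (ι := ι) (r / 2) with hy
  set W := fun i => varOp h A hA Q hQ b hb V hV (mulOp (cutoffFn (y i) (r / 2) hr)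
        (cutoffFn (y i) (r / 2) hr).smooth u) - mulOp (cutoffFn (y i) (r / 2) hr)
        (cutoffFn (y i) (r / 2) hr).smooth (varOp h A hA Q hQ b hb V hV u) with hW
  have hT : ∀ Z, (∑ l, ‖magD h A hA l u Z‖ + ‖u Z‖) ^ 2 ≤
      (2 * N + 2) * (∑ l, ‖magD h A hA l u Z‖ ^ 2 + ‖u Z‖ ^ 2) := by
    intro Z
    have h1 := sq_sum_le_card_mul_sum_sq (s := Finset.univ) (f := fun l => ‖magD h A hA l u Z‖)
    rw [Finset.card_univ, ← hN] at h1
    have h2 := add_sq_le (a := ∑ l, ‖magD h A hA l u Z‖) (b := ‖u Z‖)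
    have h3 : 0 ≤ ∑ l, ‖magD h A hA l u Z‖ ^ 2 := Finset.sum_nonneg fun _ _ => sq_nonneg _
    have h4 : 0 ≤ N * ‖u Z‖ ^ 2 := by positivity
    linarith
  have hW1 : ∀ i Z, ‖W i Z‖ ^ 2 ≤ E * r ^ 2 * (∑ l, ‖magD h A hA l u Z‖ ^ 2 + ‖u Z‖ ^ 2) := by
    intro i Z
    have h1 : ‖W i Z‖ ≤ M₀ * (4 * Cχ * r) * (∑ l, ‖magD h A hA l u Z‖ + ‖u Z‖) := by
      refine norm_varOp_mulOp_sub_le h A hA Q hQ b hb V hV (cutoffFn (y i) (r / 2) hr) u Z hC₁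
        (by positivity) hh0 (hQC Z) (hbC Z) (fun l => ?_) fun j l => ?_
      · refine (mul_le_mul_of_nonneg_left (hCχ (y i) (r / 2) hr Z l l).1 hh0).trans ?_
        have : h * (Cχ * (r / 2)⁻¹) = 2 * (Cχ * r) := by rw [hh]; field_simp
        rw [this]
        have : 0 ≤ Cχ * r := by positivity
        linarith
      · refine (mul_le_mul_of_nonneg_left (mul_le_mul_of_nonneg_left
          (hCχ (y i) (r / 2) hr Z j l).2 hh0) hh0).trans ?_
        have : h * (h * (Cχ * ((r / 2)⁻¹ * (r / 2)⁻¹))) = 4 * Cχ * r * r := by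
          rw [hh]; field_simp; ring
        rw [this]
        exact mul_le_of_le_one_right (by positivity) hr1
    have h2 := pow_le_pow_left₀ (norm_nonneg _) h1 2
    refine h2.trans ?_
    rw [mul_pow]
    refine (mul_le_mul_of_nonneg_left (hT Z) (sq_nonneg _)).trans (le_of_eq ?_)
    rw [hE]
    ring
  have hW0 : ∀ i Z, (2 : ℕ) * (r / 2) < ‖Z - y i‖ → ‖W i Z‖ ^ 2 = 0 := by
    intro i Z hZ
    have hO : IsOpen {Z : ι → ℝ | (2 : ℕ) * (r / 2) < ‖Z - y i‖} :=
      isOpen_lt continuous_const (continuous_id.sub continuous_const).norm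
    have z0 : ∀ Z ∈ {Z : ι → ℝ | (2 : ℕ) * (r / 2) < ‖Z - y i‖},
        cutoffFn (y i) (r / 2) hr Z = 0 := by
      intro Z hZ
      rw [cutoffFn_apply, cutoffAt_eq_zero hr (by exact_mod_cast le_of_lt hZ), Complex.ofReal_zero]
    have z1 := fun l => dirOp_eq_zero_of_isOpen (Pi.single l 1) hO z0
    have z2 := fun j l => dirOp_eq_zero_of_isOpen (Pi.single j 1) hO (z1 l)
    have h1 := norm_varOp_mulOp_sub_le h A hA Q hQ b hb V hV (cutoffFn (y i) (r / 2) hr) u Z hC₁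
      le_rfl hh0 (hQC Z) (hbC Z) (fun l => by rw [z1 l Z hZ]; simp)
      fun j l => by rw [z2 j l Z hZ]; simp
    rw [mul_zero, zero_mul] at h1
    have h2 : ‖W i Z‖ = 0 := le_antisymm h1 (norm_nonneg _)
    rw [h2]
    norm_num
  have key := sum_norm_sq_le_sum s (Finset.univ : Finset (Option ι)) W
    (fun _ => (2 * (2 : ℕ) + 1) ^ Fintype.card ι * (E * r ^ 2))
    (fun o => o.elim u fun l => magD h A hA l u) fun Z => by
      rw [← Finset.mul_sum, Fintype.sum_option]
      simp only [Option.elim_none, Option.elim_some]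
      rw [mul_assoc, add_comm (‖u Z‖ ^ 2)]
      refine sum_latticePt_le hr 2 s Z _ (fun i => hW1 i Z) (fun i hi => hW0 i Z hi) ?_
      have : 0 ≤ ∑ l, ‖magD h A hA l u Z‖ ^ 2 := Finset.sum_nonneg fun _ _ => sq_nonneg _
      positivity
  refine key.trans (le_of_eq ?_)
  rw [← Finset.mul_sum, Fintype.sum_option]
  simp only [Option.elim_none, Option.elim_some]
  ring

theorem le_of_global_estimate {θ d U F S P E Ce r : ℝ} (hθ : 0 < θ) (hr : 0 ≤ r)
    (hr1 : r ≤ 1) (hP : 0 ≤ P) (hE : 0 ≤ E) (hCe : 0 ≤ Ce) (hF : 0 ≤ F)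
    (h : (θ * d * U) ^ 2 ≤ 2 * P * F ^ 2 + 2 * (E * r ^ 2 * (S + U ^ 2)))
    (hS : S ≤ Ce * (U ^ 2 + F ^ 2))
    (hrd : (2 * (2 * E * (Ce + 1)) + 1) / θ * r ≤ d) :
    θ / (2 * (2 * P + 2 * E * (Ce + 1)) + 1) * d * U ≤ F := by
  set W := 2 * E * (Ce + 1) with hW
  have hW0 : 0 ≤ W := by positivity
  have h1 : (2 * W + 1) * r ≤ θ * d := by
    rw [div_mul_eq_mul_div, div_le_iff₀ hθ] at hrd
    linarith
  have h2 : 2 * W * r ^ 2 ≤ (θ * d) ^ 2 := by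
    have h3 := pow_le_pow_left₀ (by positivity) h1 2
    have h4 : 2 * W * r ^ 2 ≤ ((2 * W + 1) * r) ^ 2 := by
      rw [mul_pow]
      exact mul_le_mul_of_nonneg_right (by nlinarith) (sq_nonneg r)
    linarith
  have h5 : 2 * (E * r ^ 2 * (S + U ^ 2)) ≤ W * r ^ 2 * (U ^ 2 + F ^ 2) := by
    have h6 : S + U ^ 2 ≤ (Ce + 1) * (U ^ 2 + F ^ 2) := by linarith [sq_nonneg F]
    have h7 := mul_le_mul_of_nonneg_left h6 (by positivity : 0 ≤ 2 * (E * r ^ 2))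
    have h8 : 2 * (E * r ^ 2) * ((Ce + 1) * (U ^ 2 + F ^ 2)) = W * r ^ 2 * (U ^ 2 + F ^ 2) := by
      rw [hW]; ring
    linarith
  have h9 : W * r ^ 2 * F ^ 2 ≤ W * F ^ 2 := by
    have : r ^ 2 ≤ 1 := pow_le_one₀ hr hr1
    have h10 := mul_le_mul_of_nonneg_left this (by positivity : 0 ≤ W * F ^ 2)
    linarith
  have h11 : 2 * W * r ^ 2 * U ^ 2 ≤ (θ * d * U) ^ 2 := by
    rw [mul_pow _ U]
    exact mul_le_mul_of_nonneg_right h2 (sq_nonneg U)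
  set R := 2 * (2 * P + W) + 1 with hR
  have hR1 : 1 ≤ R := by rw [hR]; linarith
  have h12 : (θ * d * U) ^ 2 ≤ (R * F) ^ 2 := by
    have h13 : (θ * d * U) ^ 2 ≤ 2 * (2 * P + W) * F ^ 2 := by linarith
    have h14 : 2 * (2 * P + W) ≤ R ^ 2 := by nlinarith
    rw [mul_pow R F]
    exact h13.trans (mul_le_mul_of_nonneg_right h14 (sq_nonneg F))
  have h15 := le_of_sq_le_sq h12 (by positivity)
  rw [mul_assoc, div_mul_eq_mul_div, div_le_iff₀ (by linarith)]
  linarith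

/-- Global lower bound away from the model spectrum. -/
theorem exists_global_bound (n : ℕ) (ι : Type) [Fintype ι] [DecidableEq ι]
    (b₀ K' ε C₁ c₀ : ℝ) (hb₀ : 0 < b₀) (hε : 0 < ε) (hC₁ : 0 ≤ C₁) (hK' : 0 ≤ K')
    (hc₀ : 0 < c₀) :
    ∃ δ₀ C', 0 < δ₀ ∧ 0 ≤ C' ∧ ∀ (A : ι → (ι → ℝ) → ℝ) (hA : ∀ j, ContDiff ℝ ∞ (A j))
      (Q : ι → ι → (ι → ℝ) → ℝ) (hQ : ∀ j l, ContDiff ℝ ∞ (Q j l))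
      (b : ι → (ι → ℝ) → ℂ) (hb : ∀ l, ContDiff ℝ ∞ (b l)) (V : (ι → ℝ) → ℝ)
      (hV : ContDiff ℝ ∞ V) (g : (ι → ℝ) → Matrix ι ι ℝ) (a : Fin n → (ι → ℝ) → ℝ) (h r : ℝ),
      (∀ Z j k, |curvature A Z j k| ≤ C₁) →
      (∀ Z y j k, |curvature A Z j k - curvature A y j k| ≤ C₁ * ‖Z - y‖) →
      (∀ Z, (g Z).IsSymm) →
      (∀ Z (v : ι → ℝ), ε * ∑ j, v j ^ 2 ≤ ∑ j, ∑ l, g Z j l * v j * v l) →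
      (∀ Z j, g Z j j ≤ C₁) → (∀ j Z, b₀ ≤ a j Z) →
      (∀ Z, ((g Z)⁻¹ * curvature A Z).charpoly = ∏ j, (X ^ 2 + C (a j Z ^ 2))) →
      (∀ Z j l, Q j l Z = (g Z)⁻¹ j l) →
      (∀ Z (x : ι → ℝ), c₀ * ∑ j, x j ^ 2 ≤ ∑ j, ∑ l, Q j l Z * x j * x l) →
      (∀ Z j l, |Q j l Z| ≤ C₁) → (∀ Z y j l, |Q j l Z - Q j l y| ≤ C₁ * ‖Z - y‖) →
      (∀ Z i j l, ‖fderiv ℝ (fun Z => (Q j l Z : ℂ)) Z (Pi.single i 1)‖ ≤ C₁) →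
      (∀ Z l, ‖b l Z‖ ≤ C₁ * h) → (∀ Z y, |V Z - V y| ≤ C₁ * ‖Z - y‖) →
      0 < r → r ≤ 1 → h = r ^ 2 → C' * r ≤ 1 → ∀ d lam, 0 < d → d ≤ b₀ → C' * r ≤ d →
      (∀ Z, |V Z - lam| ≤ K') →
      (∀ Z (k : Fin n → ℕ), d ≤ |lam - (∑ j, (2 * (k j : ℝ) + 1) * a j Z + V Z)|) →
      ∀ u : TestFn ι, δ₀ * d * ‖u‖ ≤ ‖varOp h A hA Q hQ b hb V hV u - (lam : ℂ) • u‖ := by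
  obtain ⟨θ, Cf, hθ, hCf, Hloc⟩ :=
    exists_local_bound n ι b₀ K' ε C₁ C₁ C₁ hb₀ hε hC₁ hC₁ hC₁ hK'
  obtain ⟨Ce, hCe, Hen⟩ := exists_energy_bound ι c₀ (C₁ + K') hc₀ (by positivity)
  obtain ⟨E, hE, Hcom⟩ := exists_sum_commutator_bound ι C₁ hC₁
  set P : ℝ := (2 * (2 : ℕ) + 1) ^ Fintype.card ι with hP
  have hP0 : 0 ≤ P := by positivity
  have hx0 : 0 ≤ (2 * (2 * E * (Ce + 1)) + 1) / θ := by positivity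
  refine ⟨θ / (2 * (2 * P + 2 * E * (Ce + 1)) + 1),
    Cf + (2 * (2 * E * (Ce + 1)) + 1) / θ, by positivity, by positivity, ?_⟩
  intro A hA Q hQ b hb V hV g a h r hB0 hB1 hgs hgp hgC ha hchar hQg hQp hQC hQl hQd hbC hVl
    hr0 hr1 hh hCr d lam hd hdb hCd hVlam hgap u
  rw [add_mul] at hCr hCd
  have hCfr : 0 ≤ Cf * r := by positivity
  have hxr : 0 ≤ (2 * (2 * E * (Ce + 1)) + 1) / θ * r := by positivity
  have hr : 0 < r / 2 := by linarith
  have hh0 : 0 < h := by rw [hh]; positivity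
  have hhr : h ≤ r := by rw [hh, sq]; exact mul_le_of_le_one_left hr0.le hr1
  have hbC' : ∀ Z l, ‖b l Z‖ ≤ C₁ := fun Z l =>
    (hbC Z l).trans (mul_le_of_le_one_right hC₁ (hhr.trans hr1))
  set L := varOp h A hA Q hQ b hb V hV with hL
  set f := L u - (lam : ℂ) • u with hf
  set y := latticePt (ι := ι) (r / 2) with hy
  set χ := fun i => cutoffFn (y i) (r / 2) hr with hχ
  obtain ⟨ρ, hρ⟩ := u.compact.isBounded.exists_norm_le
  obtain ⟨s, hs⟩ := exists_finset_latticePt (ι := ι) hr ρ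
  have hχ1 : ∀ i Z, ‖χ i Z‖ ≤ 1 := by
    intro i Z
    rw [hχ, cutoffFn_apply, Complex.norm_real, Real.norm_eq_abs,
      abs_of_nonneg (cutoffAt_mem_Icc _ _ _).1]
    exact (cutoffAt_mem_Icc _ _ _).2
  have hχ0 : ∀ i Z, 2 * (r / 2) ≤ ‖Z - y i‖ → χ i Z = 0 := by
    intro i Z hZ
    rw [hχ, cutoffFn_apply, cutoffAt_eq_zero hr hZ, Complex.ofReal_zero]
  have e1 : ‖u‖ ^ 2 ≤ ∑ i ∈ s, ‖mulOp (χ i) (χ i).smooth u‖ ^ 2 := by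
    have := norm_sq_le_sum s u (fun _ => 1) (fun i => mulOp (χ i) (χ i).smooth u) fun Z => by
      simp only [one_mul]
      by_cases hZ : Z ∈ tsupport u
      · obtain ⟨i, hi, h1⟩ := hs Z (hρ Z hZ)
        refine le_trans (le_of_eq ?_) (Finset.single_le_sum
          (f := fun i => ‖mulOp (χ i) (χ i).smooth u Z‖ ^ 2) (fun _ _ => sq_nonneg _) hi)
        simp only [hχ, mulOp_apply, cutoffFn_apply, hy]
        rw [cutoffAt_eq_one hr h1]
        simp
      · rw [image_eq_zero_of_notMem_tsupport hZ, norm_zero, zero_pow two_ne_zero]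
        exact Finset.sum_nonneg fun _ _ => sq_nonneg _
    simpa using this
  have e2 : ∑ i ∈ s, ‖mulOp (χ i) (χ i).smooth f‖ ^ 2 ≤ P * ‖f‖ ^ 2 := by
    have := sum_norm_sq_le_sum s {()} (fun i => mulOp (χ i) (χ i).smooth f) (fun _ => P)
      (fun _ => f) fun Z => by
        rw [Finset.sum_singleton]
        refine sum_latticePt_le hr 2 s Z _ (fun i => ?_) (fun i hi => ?_) (sq_nonneg _)
        · rw [mulOp_apply, norm_mul]
          exact pow_le_pow_left₀ (by positivity)
            (mul_le_of_le_one_left (norm_nonneg _) (hχ1 i Z)) 2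
        · rw [mulOp_apply, hχ0 i Z (by exact_mod_cast hi.le)]
          simp
    simpa using this
  have e3 := Hcom h A hA Q hQ b hb V hV r hr hr1 hh hQC hbC' u s
  have e4 := Hen h A hA Q hQ b hb V hV lam hh0.le (hhr.trans hr1) hQp
    (fun Z i j l => (hQd Z i j l).trans (by linarith)) (fun Z l => (hbC' Z l).trans (by linarith))
    (fun Z => (hVlam Z).trans (by linarith)) u
  have e5 : ∀ i, (θ * d) ^ 2 * ‖mulOp (χ i) (χ i).smooth u‖ ^ 2 ≤
      2 * ‖mulOp (χ i) (χ i).smooth f‖ ^ 2 + 2 * ‖L (mulOp (χ i) (χ i).smooth u) -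
        mulOp (χ i) (χ i).smooth (L u)‖ ^ 2 := by
    intro i
    have h1 := Hloc A hA Q hQ b hb V hV (y i) r (hB0 _) (fun Z => hB1 Z _) hr0 (by linarith)
      (g (y i)) (hgs _) (hgp _) (hgC _) (fun j => a j (y i)) (fun j => ha j _) (hchar _)
      (fun Z hZ j l => by
        rw [← hQg]
        exact (hQl Z (y i) j l).trans (mul_le_mul_of_nonneg_left hZ hC₁))
      (fun Z hZ l => (hbC Z l).trans (mul_le_mul_of_nonneg_left hhr hC₁))
      (fun Z hZ => (hVl Z (y i)).trans (mul_le_mul_of_nonneg_left hZ hC₁)) h hh0 d lam hd hdb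
      (by linarith) (by rw [abs_sub_comm]; exact hVlam _) (hgap _) (mulOp (χ i) (χ i).smooth u)
      (fun Z hZ => by rw [mulOp_apply, hχ0 i Z (by linarith), zero_mul])
    have h2 : varOp h A hA Q hQ b hb V hV (mulOp (χ i) (χ i).smooth u) -
        (lam : ℂ) • mulOp (χ i) (χ i).smooth u = mulOp (χ i) (χ i).smooth f +
        (L (mulOp (χ i) (χ i).smooth u) - mulOp (χ i) (χ i).smooth (L u)) := by
      rw [hf, map_sub, map_smul]
      abel
    rw [h2] at h1
    have h3 := pow_le_pow_left₀ (by positivity) (h1.trans (norm_add_le _ _)) 2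
    rw [mul_pow] at h3
    refine h3.trans (add_sq_le.trans (le_of_eq ?_))
    ring
  refine le_of_global_estimate hθ hr0.le hr1 hP0 hE hCe (norm_nonneg _) ?_ e4
    (by linarith)
  have e6 := Finset.sum_le_sum fun i (_ : i ∈ s) => e5 i
  rw [Finset.sum_add_distrib, ← Finset.mul_sum, ← Finset.mul_sum, ← Finset.mul_sum] at e6
  have e7 := mul_le_mul_of_nonneg_left e1 (sq_nonneg (θ * d))
  rw [mul_pow _ ‖u‖]
  linarith

end GlobalBound

section BoundedC1

open scoped ContDiff

variable {ι : Type} [Fintype ι]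

/-- Smooth real functions which are bounded together with their differential. -/
structure IsBddC1 (f : (ι → ℝ) → ℝ) : Prop where
  contDiff : ContDiff ℝ ∞ f
  bdd : ∃ C, ∀ Z, |f Z| ≤ C
  bdd_fderiv : ∃ C, ∀ Z, ‖fderiv ℝ f Z‖ ≤ C

namespace IsBddC1

variable {f g : (ι → ℝ) → ℝ}

theorem of_iteratedFDeriv (hf : ContDiff ℝ ∞ f)
    (h : ∀ k : ℕ, ∃ C, ∀ Z, ‖iteratedFDeriv ℝ k f Z‖ ≤ C) : IsBddC1 f where
  contDiff := hf
  bdd := by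
    obtain ⟨C, hC⟩ := h 0
    exact ⟨C, fun Z => by simpa using hC Z⟩
  bdd_fderiv := by
    obtain ⟨C, hC⟩ := h 1
    exact ⟨C, fun Z => by simpa [norm_iteratedFDeriv_one] using hC Z⟩

theorem differentiableAt (hf : IsBddC1 f) (Z : ι → ℝ) : DifferentiableAt ℝ f Z :=
  hf.contDiff.differentiable (by simp) Z

theorem const (c : ℝ) : IsBddC1 fun _ : ι → ℝ => c :=
  ⟨contDiff_const, ⟨|c|, fun _ => le_rfl⟩, ⟨0, fun Z => by simp⟩⟩

theorem mul (hf : IsBddC1 f) (hg : IsBddC1 g) : IsBddC1 fun Z => f Z * g Z where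
  contDiff := hf.contDiff.mul hg.contDiff
  bdd := by
    obtain ⟨C, hC⟩ := hf.bdd
    obtain ⟨D, hD⟩ := hg.bdd
    refine ⟨C * D, fun Z => ?_⟩
    rw [abs_mul]
    exact mul_le_mul (hC Z) (hD Z) (abs_nonneg _) ((abs_nonneg _).trans (hC Z))
  bdd_fderiv := by
    obtain ⟨C, hC⟩ := hf.bdd
    obtain ⟨D, hD⟩ := hg.bdd
    obtain ⟨C', hC'⟩ := hf.bdd_fderiv
    obtain ⟨D', hD'⟩ := hg.bdd_fderiv
    refine ⟨C * D' + D * C', fun Z => ?_⟩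
    rw [fderiv_fun_mul (hf.differentiableAt Z) (hg.differentiableAt Z)]
    refine (norm_add_le _ _).trans (add_le_add ?_ ?_)
    · rw [norm_smul]
      exact mul_le_mul (hC Z) (hD' Z) (norm_nonneg _) ((abs_nonneg _).trans (hC Z))
    · rw [norm_smul]
      exact mul_le_mul (hD Z) (hC' Z) (norm_nonneg _) ((abs_nonneg _).trans (hD Z))

theorem add (hf : IsBddC1 f) (hg : IsBddC1 g) : IsBddC1 fun Z => f Z + g Z where
  contDiff := hf.contDiff.add hg.contDiff
  bdd := by
    obtain ⟨C, hC⟩ := hf.bdd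
    obtain ⟨D, hD⟩ := hg.bdd
    exact ⟨C + D, fun Z => (abs_add_le _ _).trans (add_le_add (hC Z) (hD Z))⟩
  bdd_fderiv := by
    obtain ⟨C, hC⟩ := hf.bdd_fderiv
    obtain ⟨D, hD⟩ := hg.bdd_fderiv
    refine ⟨C + D, fun Z => ?_⟩
    rw [fderiv_fun_add (hf.differentiableAt Z) (hg.differentiableAt Z)]
    exact (norm_add_le _ _).trans (add_le_add (hC Z) (hD Z))

theorem sum {κ : Type} (s : Finset κ) {F : κ → (ι → ℝ) → ℝ} (hF : ∀ i, IsBddC1 (F i)) :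
    IsBddC1 fun Z => ∑ i ∈ s, F i Z := by
  classical
  induction s using Finset.induction_on with
  | empty => simpa using const 0
  | insert i s hi ih =>
    simp only [Finset.sum_insert hi]
    exact (hF i).add ih

theorem prod {κ : Type} (s : Finset κ) {F : κ → (ι → ℝ) → ℝ} (hF : ∀ i, IsBddC1 (F i)) :
    IsBddC1 fun Z => ∏ i ∈ s, F i Z := by
  classical
  induction s using Finset.induction_on with
  | empty => simpa using const 1
  | insert i s hi ih =>
    simp only [Finset.prod_insert hi]
    exact (hF i).mul ih

theorem comp (hf : IsBddC1 f) {φ : ℝ → ℝ} {C D : ℝ} (hφ : ∀ Z, ContDiffAt ℝ ∞ φ (f Z))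
    (hC : ∀ Z, |φ (f Z)| ≤ C) (hD : ∀ Z, |deriv φ (f Z)| ≤ D) : IsBddC1 fun Z => φ (f Z) where
  contDiff := contDiff_iff_contDiffAt.2 fun Z => (hφ Z).comp Z hf.contDiff.contDiffAt
  bdd := ⟨C, hC⟩
  bdd_fderiv := by
    obtain ⟨C', hC'⟩ := hf.bdd_fderiv
    refine ⟨D * C', fun Z => ?_⟩
    have h1 := (((hφ Z).differentiableAt (by simp)).hasDerivAt.comp_hasFDerivAt Z
      (hf.differentiableAt Z).hasFDerivAt).fderiv
    have h2 : fderiv ℝ (fun Z => φ (f Z)) Z = deriv φ (f Z) • fderiv ℝ f Z := h1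
    rw [h2, norm_smul]
    exact mul_le_mul (hD Z) (hC' Z) (norm_nonneg _) ((abs_nonneg _).trans (hD Z))

theorem inv (hf : IsBddC1 f) {c : ℝ} (hc : 0 < c) (h : ∀ Z, c ≤ f Z) :
    IsBddC1 fun Z => (f Z)⁻¹ := by
  have hp := fun Z => hc.trans_le (h Z)
  refine hf.comp (φ := fun x => x⁻¹) (C := c⁻¹) (D := (c ^ 2)⁻¹)
    (fun Z => contDiffAt_inv ℝ (hp Z).ne') (fun Z => ?_) fun Z => ?_
  · rw [abs_of_pos (inv_pos.2 (hp Z))]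
    exact inv_anti₀ hc (h Z)
  · rw [deriv_inv, abs_neg, abs_of_pos (by have := hp Z; positivity)]
    exact inv_anti₀ (by positivity) (pow_le_pow_left₀ hc.le (h Z) 2)

theorem sqrt (hf : IsBddC1 f) {c : ℝ} (hc : 0 < c) (h : ∀ Z, c ≤ f Z) :
    IsBddC1 fun Z => Real.sqrt (f Z) := by
  have hp := fun Z => hc.trans_le (h Z)
  obtain ⟨C, hC⟩ := hf.bdd
  refine hf.comp (φ := Real.sqrt) (C := Real.sqrt C) (D := 1 / (2 * Real.sqrt c))
    (fun Z => Real.contDiffAt_sqrt (hp Z).ne') (fun Z => ?_) fun Z => ?_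
  · rw [abs_of_nonneg (Real.sqrt_nonneg _)]
    exact Real.sqrt_le_sqrt ((le_abs_self _).trans (hC Z))
  · rw [(Real.hasDerivAt_sqrt (hp Z).ne').deriv, abs_of_nonneg (by positivity)]
    have := Real.sqrt_pos.2 hc
    exact one_div_le_one_div_of_le (by positivity)
      (mul_le_mul_of_nonneg_left (Real.sqrt_le_sqrt (h Z)) two_pos.le)

theorem exists_lipschitz (hf : IsBddC1 f) : ∃ C, 0 ≤ C ∧ ∀ Z y, |f Z - f y| ≤ C * ‖Z - y‖ := by
  obtain ⟨C, hC⟩ := hf.bdd_fderiv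
  exact ⟨C, (norm_nonneg _).trans (hC 0), fun Z y => convex_univ.norm_image_sub_le_of_norm_fderiv_le
    (fun x _ => hf.differentiableAt x) (fun x _ => hC x) (Set.mem_univ y) (Set.mem_univ Z)⟩

variable [DecidableEq ι]

theorem exists_partial (hf : IsBddC1 f) :
    ∃ C, ∀ Z i, |fderiv ℝ f Z (Pi.single i 1)| ≤ C := by
  obtain ⟨C, hC⟩ := hf.bdd_fderiv
  refine ⟨C, fun Z i => ?_⟩
  have h1 := (fderiv ℝ f Z).le_opNorm (Pi.single i 1)
  rw [Pi.norm_single, norm_one, mul_one] at h1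
  exact h1.trans (hC Z)

variable {κ : Type} [Fintype κ] [DecidableEq κ]

theorem det {G : (ι → ℝ) → Matrix κ κ ℝ} (hG : ∀ j l, IsBddC1 fun Z => G Z j l) :
    IsBddC1 fun Z => (G Z).det := by
  simp only [Matrix.det_apply']
  exact sum _ fun σ => (const _).mul (prod _ fun i => hG _ _)

theorem adjugate {G : (ι → ℝ) → Matrix κ κ ℝ} (hG : ∀ j l, IsBddC1 fun Z => G Z j l) (j l : κ) :
    IsBddC1 fun Z => (G Z).adjugate j l := by
  simp only [Matrix.adjugate_apply]
  refine det fun i k => ?_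
  simp only [Matrix.updateRow_apply]
  split_ifs
  · exact const _
  · exact hG i k

theorem matrix_inv {G : (ι → ℝ) → Matrix κ κ ℝ} (hG : ∀ j l, IsBddC1 fun Z => G Z j l)
    {c : ℝ} (hc : 0 < c) (h : ∀ Z, c ≤ (G Z).det) (j l : κ) : IsBddC1 fun Z => (G Z)⁻¹ j l := by
  simp only [Matrix.inv_def, Matrix.smul_apply, smul_eq_mul, Ring.inverse_eq_inv']
  exact ((det hG).inv hc h).mul (adjugate hG j l)

end IsBddC1

/-- A finite family of bounds depending on a parameter has a common nonnegative majorant. -/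
theorem exists_forall_of_forall_exists {κ : Type} [Fintype κ] {P : κ → ℝ → Prop}
    (hP : ∀ i C D, C ≤ D → P i C → P i D) (h : ∀ i, ∃ C, P i C) : ∃ C, 0 ≤ C ∧ ∀ i, P i C := by
  choose C hC using h
  refine ⟨∑ i, |C i|, Finset.sum_nonneg fun _ _ => abs_nonneg _, fun i => hP i _ _ ?_ (hC i)⟩
  exact (le_abs_self _).trans
    (Finset.single_le_sum (f := fun i => |C i|) (fun _ _ => abs_nonneg _) (Finset.mem_univ i))

end BoundedC1

section MetricBounds

variable {ι : Type} [Fintype ι] [DecidableEq ι]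

theorem sum_sum_mul_transpose (L : Matrix ι ι ℝ) (x : ι → ℝ) :
    ∑ j, ∑ l, (L * Lᵀ) j l * x j * x l = ∑ k, (∑ j, L j k * x j) ^ 2 := by
  calc _ = ∑ j, ∑ k, ∑ l, L j k * L l k * x j * x l := by
        refine Finset.sum_congr rfl fun j _ => ?_
        simp only [Matrix.mul_apply, Matrix.transpose_apply, Finset.sum_mul]
        exact Finset.sum_comm
    _ = ∑ k, ∑ j, ∑ l, L j k * L l k * x j * x l := Finset.sum_comm
    _ = _ := by
        refine Finset.sum_congr rfl fun k _ => ?_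
        rw [sq, Finset.sum_mul_sum]
        refine Finset.sum_congr rfl fun j _ => Finset.sum_congr rfl fun l _ => ?_
        ring

/-- Lower bounds for the determinant and for the inverse of a positive definite matrix with
bounded diagonal. -/
theorem exists_pos_det_inv_bound (ε C : ℝ) (hε : 0 < ε) :
    ∃ c, 0 < c ∧ ∀ G : Matrix ι ι ℝ, G.IsSymm →
      (∀ v : ι → ℝ, ε * ∑ j, v j ^ 2 ≤ ∑ j, ∑ l, G j l * v j * v l) → (∀ j, G j j ≤ C) →
      c ≤ G.det ∧ ∀ x : ι → ℝ, c * ∑ j, x j ^ 2 ≤ ∑ j, ∑ l, G⁻¹ j l * x j * x l := by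
  set N : ℝ := ((Fintype.card ι : ℕ) : ℝ) with hN
  set T : ℝ := (Nat.factorial (Fintype.card ι) : ℝ) * (ε⁻¹ + 1) ^ Fintype.card ι with hT
  have hN0 : 0 ≤ N := Nat.cast_nonneg _
  have hT0 : 0 < T := by positivity
  have hc2 : 0 < (1 + N * (N * |C|)) := by positivity
  refine ⟨min (T ^ 2)⁻¹ (1 + N * (N * |C|))⁻¹, lt_min (by positivity) (by positivity),
    fun G hs hp hC => ?_⟩
  obtain ⟨L, M, hML, hLM, hinv, hG, hL, hM⟩ := exists_orthonormal_frame G ε C hε hs hp hC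
  constructor
  · refine (min_le_left _ _).trans ?_
    have h1 : |L.det| ≤ T := by
      have := Matrix.det_le (A := L) (abv := AbsoluteValue.abs) (x := ε⁻¹ + 1) fun i j =>
        abs_le_one_add_of_sq_le (hL i j)
      simpa [hT, nsmul_eq_mul] using this
    have h2 : M.det * L.det = 1 := by rw [← Matrix.det_mul, hML, Matrix.det_one]
    have h3 : G.det = M.det ^ 2 := by rw [hG, Matrix.det_mul, Matrix.det_transpose, sq]
    have h4 : L.det ^ 2 ≤ T ^ 2 := sq_le_sq.2 (by rwa [abs_of_pos hT0])
    have h5 : M.det ^ 2 * L.det ^ 2 = 1 := by rw [← mul_pow, h2, one_pow]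
    rw [h3, inv_le_iff_one_le_mul₀ (by positivity), ← h5]
    exact mul_le_mul_of_nonneg_left h4 (sq_nonneg _)
  · intro x
    rw [hinv, sum_sum_mul_transpose]
    set S := ∑ k, (∑ j, L j k * x j) ^ 2 with hS
    have hS0 : 0 ≤ S := Finset.sum_nonneg fun _ _ => sq_nonneg _
    have hx : ∀ j, x j ^ 2 ≤ N * |C| * S := by
      intro j
      have h1 : x j = ∑ k, M k j * ∑ i, L i k * x i := by
        have h2 : x = ((L * M)ᵀ) *ᵥ x := by rw [hLM, Matrix.transpose_one, Matrix.one_mulVec]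
        rw [Matrix.transpose_mul, ← Matrix.mulVec_mulVec] at h2
        exact congrFun h2 j
      rw [h1]
      refine (Finset.sum_mul_sq_le_sq_mul_sq _ _ _).trans (mul_le_mul_of_nonneg_right ?_ hS0)
      refine (Finset.sum_le_sum fun k _ => (hM k j).trans (le_abs_self C)).trans (le_of_eq ?_)
      rw [Finset.sum_const, Finset.card_univ, nsmul_eq_mul]
    have hsum : ∑ j, x j ^ 2 ≤ N * (N * |C|) * S := by
      refine (Finset.sum_le_sum fun j _ => hx j).trans (le_of_eq ?_)
      rw [Finset.sum_const, Finset.card_univ, nsmul_eq_mul]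
      ring
    calc _ ≤ (1 + N * (N * |C|))⁻¹ * ∑ j, x j ^ 2 := mul_le_mul_of_nonneg_right
          (min_le_right _ _) (Finset.sum_nonneg fun _ _ => sq_nonneg _)
      _ ≤ S := by
        rw [inv_mul_le_iff₀ hc2]
        linarith

end MetricBounds

section Assembly

open scoped ContDiff

open TestFn

variable {ι : Type} [Fintype ι]

theorem fderiv_complex_ofReal_apply {f : (ι → ℝ) → ℝ} {Z : ι → ℝ} (hf : DifferentiableAt ℝ f Z)
    (v : ι → ℝ) : fderiv ℝ (fun W => (f W : ℂ)) Z v = (fderiv ℝ f Z v : ℂ) := by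
  have h := ((Complex.ofRealCLM.hasFDerivAt (x := f Z)).comp Z hf.hasFDerivAt).fderiv
  exact congrArg (fun L : (ι → ℝ) →L[ℝ] ℂ => L v) h

variable [DecidableEq ι]

theorem IsBddC1.exists_common_bound {κ : Type} [Fintype κ] {F : κ → κ → (ι → ℝ) → ℝ}
    (hF : ∀ j l, IsBddC1 (F j l)) : ∃ C, 0 ≤ C ∧ (∀ Z j l, |F j l Z| ≤ C) ∧
      (∀ Z y j l, |F j l Z - F j l y| ≤ C * ‖Z - y‖) ∧
      ∀ Z i j l, |fderiv ℝ (F j l) Z (Pi.single i 1)| ≤ C := by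
  obtain ⟨C1, h1, h1'⟩ := exists_forall_of_forall_exists
    (P := fun (q : κ × κ) C => ∀ Z, |F q.1 q.2 Z| ≤ C) (fun q C D hCD h Z => (h Z).trans hCD)
    fun q => (hF q.1 q.2).bdd
  obtain ⟨C2, h2, h2'⟩ := exists_forall_of_forall_exists
    (P := fun (q : κ × κ) C => ∀ Z y, |F q.1 q.2 Z - F q.1 q.2 y| ≤ C * ‖Z - y‖)
    (fun q C D hCD h Z y => (h Z y).trans (mul_le_mul_of_nonneg_right hCD (norm_nonneg _)))
    fun q => by
      obtain ⟨C, -, hC⟩ := (hF q.1 q.2).exists_lipschitz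
      exact ⟨C, hC⟩
  obtain ⟨C3, h3, h3'⟩ := exists_forall_of_forall_exists
    (P := fun (q : κ × κ) C => ∀ Z i, |fderiv ℝ (F q.1 q.2) Z (Pi.single i 1)| ≤ C)
    (fun q C D hCD h Z i => (h Z i).trans hCD) fun q => (hF q.1 q.2).exists_partial
  refine ⟨C1 + C2 + C3, by positivity, fun Z j l => (h1' (j, l) Z).trans (by linarith),
    fun Z y j l => (h2' (j, l) Z y).trans ?_, fun Z i j l => (h3' (j, l) Z i).trans (by linarith)⟩
  exact mul_le_mul_of_nonneg_right (by linarith) (norm_nonneg _)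

variable {n : ℕ}

theorem mg_eq_magD {p : ℕ} {h : ℝ} (hh : h ≠ 0) (hp : (p : ℝ) = h⁻¹ * h⁻¹)
    (A : Fin (2*n) → (Fin (2*n) → ℝ) → ℝ) (hA : ∀ j, ContDiff ℝ ∞ (A j)) (j : Fin (2*n))
    (u : TestFn (Fin (2*n))) (Z : Fin (2*n) → ℝ) :
    mg A p j u Z = (h : ℂ)⁻¹ * magD h A hA j u Z := by
  have hc : (p : ℂ) = (h : ℂ)⁻¹ * (h : ℂ)⁻¹ := by exact_mod_cast congrArg ((↑) : ℝ → ℂ) hp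
  have hh' : (h : ℂ) ≠ 0 := Complex.ofReal_ne_zero.2 hh
  rw [magD, magOp_apply, mg, pd, hc]
  push_cast
  field_simp

/-- Nondivergence form of the Bochner–Schrödinger operator. -/
theorem Hop_eq_varOp {p : ℕ} {h : ℝ} (hh : h ≠ 0) (hp : (p : ℝ) = h⁻¹ * h⁻¹)
    (A : Fin (2*n) → (Fin (2*n) → ℝ) → ℝ) (hA : ∀ j, ContDiff ℝ ∞ (A j))
    (g : (Fin (2*n) → ℝ) → Matrix (Fin (2*n)) (Fin (2*n)) ℝ)
    (hρ : ContDiff ℝ ∞ fun Z => Real.sqrt (g Z).det) (hρ0 : ∀ Z, 0 < Real.sqrt (g Z).det)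
    (hQ : ∀ j l, ContDiff ℝ ∞ fun Z => (g Z)⁻¹ j l)
    (b : Fin (2*n) → (Fin (2*n) → ℝ) → ℂ) (hb : ∀ l, ContDiff ℝ ∞ (b l))
    (hb' : ∀ l Z, b l Z = ∑ j, Complex.I * h * (((Real.sqrt (g Z).det)⁻¹ *
      fderiv ℝ (fun W => Real.sqrt (g W).det * (g W)⁻¹ j l) Z (Pi.single j 1) : ℝ) : ℂ))
    (V : (Fin (2*n) → ℝ) → ℝ) (hV : ContDiff ℝ ∞ V) (u : TestFn (Fin (2*n)))
    (Z : Fin (2*n) → ℝ) :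
    Hop g A V p u Z = varOp h A hA (fun j l Z => (g Z)⁻¹ j l) hQ b hb V hV u Z := by
  have hc : (p : ℂ) = (h : ℂ)⁻¹ * (h : ℂ)⁻¹ := by exact_mod_cast congrArg ((↑) : ℝ → ℂ) hp
  have hh' : (h : ℂ) ≠ 0 := Complex.ofReal_ne_zero.2 hh
  have hρ' : ((Real.sqrt (g Z).det : ℝ) : ℂ) ≠ 0 := Complex.ofReal_ne_zero.2 (hρ0 Z).ne'
  have hP : ∀ j l, ContDiff ℝ ∞ fun W => Real.sqrt (g W).det * (g W)⁻¹ j l :=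
    fun j l => hρ.mul (hQ j l)
  have key : ∀ j l, mg A p j (fun W => ((Real.sqrt (g W).det : ℝ) : ℂ) *
      (((g W)⁻¹ j l : ℝ) : ℂ) * mg A p l u W) Z = (h : ℂ)⁻¹ * (h : ℂ)⁻¹ *
      (((Real.sqrt (g Z).det : ℝ) : ℂ) * (((g Z)⁻¹ j l : ℝ) : ℂ) *
        magD h A hA j (magD h A hA l u) Z + Complex.I * h *
        (fderiv ℝ (fun W => Real.sqrt (g W).det * (g W)⁻¹ j l) Z (Pi.single j 1) : ℝ) *
        magD h A hA l u Z) := by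
    intro j l
    have e1 : (fun W => ((Real.sqrt (g W).det : ℝ) : ℂ) * (((g W)⁻¹ j l : ℝ) : ℂ) *
        mg A p l u W) = ⇑((h : ℂ)⁻¹ • mulOp (fun W => ((Real.sqrt (g W).det *
          (g W)⁻¹ j l : ℝ) : ℂ)) (hP j l).complex_ofReal (magD h A hA l u)) := by
      funext W
      rw [mg_eq_magD hh hp A hA, TestFn.smul_apply, mulOp_apply]
      push_cast
      ring
    rw [e1, mg_eq_magD hh hp A hA, map_smul]
    have e2 := magOp_mulOp h (Pi.single j 1) (fun Z => h⁻¹ * A j Z) (contDiff_const.mul (hA j))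
      (fun W => ((Real.sqrt (g W).det * (g W)⁻¹ j l : ℝ) : ℂ)) (hP j l).complex_ofReal
      (magD h A hA l u)
    have e3 := congrArg (fun w : TestFn (Fin (2*n)) => w Z) e2
    rw [TestFn.smul_apply]
    simp only [TestFn.add_apply, TestFn.smul_apply, mulOp_apply] at e3
    rw [fderiv_complex_ofReal_apply ((hP j l).differentiable (by simp) Z)] at e3
    rw [magD, e3]
    push_cast
    ring
  rw [Hop, varOp_apply_apply]
  congr 1
  simp only [key, hb']
  rw [Finset.sum_comm (f := fun j l => (((g Z)⁻¹ j l : ℝ) : ℂ) *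
    magD h A hA j (magD h A hA l u) Z), Finset.sum_comm, ← Finset.sum_add_distrib, Finset.mul_sum]
  refine Finset.sum_congr rfl fun l _ => ?_
  rw [Finset.sum_mul, ← Finset.sum_add_distrib, Finset.mul_sum]
  refine Finset.sum_congr rfl fun j _ => ?_
  rw [hc]
  push_cast
  field_simp

theorem l2g_bounds (g : (Fin (2*n) → ℝ) → Matrix (Fin (2*n)) (Fin (2*n)) ℝ)
    (hρ : Continuous fun Z => Real.sqrt (g Z).det) {c₁ c₂ : ℝ} (hc₁ : 0 ≤ c₁) (hc₂ : 0 ≤ c₂)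
    (h₁ : ∀ Z, c₁ ≤ Real.sqrt (g Z).det) (h₂ : ∀ Z, Real.sqrt (g Z).det ≤ c₂)
    (u : TestFn (Fin (2*n))) :
    Real.sqrt c₁ * ‖u‖ ≤ l2g g u ∧ l2g g u ≤ Real.sqrt c₂ * ‖u‖ := by
  have hI : Integrable fun Z => ‖u Z‖ ^ 2 * Real.sqrt (g Z).det := by
    refine (u.integrable_norm_sq.const_mul c₂).mono'
      ((u.cont.norm.pow 2).mul hρ).aestronglyMeasurable (Filter.Eventually.of_forall fun Z => ?_)
    rw [Real.norm_of_nonneg (by positivity), mul_comm]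
    exact mul_le_mul_of_nonneg_right (h₂ Z) (sq_nonneg _)
  have hm : ∀ c : ℝ, c * ‖u‖ ^ 2 = ∫ Z, c * ‖u Z‖ ^ 2 := fun c => by
    rw [TestFn.norm_sq, integral_const_mul]
  have hs : ∀ c : ℝ, 0 ≤ c → Real.sqrt c * ‖u‖ = Real.sqrt (c * ‖u‖ ^ 2) := fun c hc => by
    rw [Real.sqrt_mul hc, Real.sqrt_sq (norm_nonneg _)]
  rw [hs c₁ hc₁, hs c₂ hc₂, l2g, hm, hm]
  constructor
  · refine Real.sqrt_le_sqrt (integral_mono (u.integrable_norm_sq.const_mul c₁) hI fun Z => ?_)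
    change c₁ * ‖u Z‖ ^ 2 ≤ ‖u Z‖ ^ 2 * Real.sqrt (g Z).det
    rw [mul_comm c₁]
    exact mul_le_mul_of_nonneg_left (h₁ Z) (sq_nonneg _)
  · refine Real.sqrt_le_sqrt (integral_mono hI (u.integrable_norm_sq.const_mul c₂) fun Z => ?_)
    change ‖u Z‖ ^ 2 * Real.sqrt (g Z).det ≤ c₂ * ‖u Z‖ ^ 2
    rw [mul_comm c₂]
    exact mul_le_mul_of_nonneg_left (h₂ Z) (sq_nonneg _)

end Assembly

/-- Rough asymptotic description of the spectrum of the Bochner–Schrödinger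
operator `H_p`: for every `K > 0` there is `c > 0` such that every
`λ ∈ [0, K]` at distance `> c p^{-1/4}` from the union `Σ` of the spectra of
the model operators lies outside the spectrum of `H_p` (expressed via a
quantitative lower bound `‖(H_p − λ)u‖ ≥ δ‖u‖` on compactly supported smooth
functions). -/
theorem stmt0 (n : ℕ) (hn : 1 ≤ n)
    (g : (Fin (2*n) → ℝ) → Matrix (Fin (2*n)) (Fin (2*n)) ℝ)
    (hg_smooth : ∀ j l, ContDiff ℝ (⊤ : ℕ∞) fun Z => g Z j l)
    (hg_bdd : ∀ j l (k : ℕ), ∃ C, ∀ Z, ‖iteratedFDeriv ℝ k (fun Z => g Z j l) Z‖ ≤ C)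
    (hg_symm : ∀ Z, (g Z).IsSymm)
    (hg_pos : ∃ ε > 0, ∀ Z (v : Fin (2*n) → ℝ), ε * ∑ j, v j ^ 2 ≤ ∑ j, ∑ l, g Z j l * v j * v l)
    (A : Fin (2*n) → (Fin (2*n) → ℝ) → ℝ)
    (hA : ∀ j, ContDiff ℝ (⊤ : ℕ∞) (A j))
    (hB_bdd : ∀ j l (k : ℕ), ∃ C, ∀ Z,
      ‖iteratedFDeriv ℝ k (fun Z => Bfield A Z j l) Z‖ ≤ C)
    (b₀ : ℝ) (hb₀ : 0 < b₀)
    (a : Fin n → (Fin (2*n) → ℝ) → ℝ)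
    (ha_cont : ∀ j, Continuous (a j))
    (ha_lb : ∀ j Z, b₀ ≤ a j Z)
    (hchar : ∀ Z, ((g Z)⁻¹ * Bfield A Z).charpoly =
      ∏ j : Fin n, (Polynomial.X ^ 2 + Polynomial.C ((a j Z) ^ 2)))
    (V : (Fin (2*n) → ℝ) → ℝ)
    (hV : ContDiff ℝ (⊤ : ℕ∞) V)
    (hV_bdd : ∀ k : ℕ, ∃ C, ∀ Z, ‖iteratedFDeriv ℝ k V Z‖ ≤ C)
    (K : ℝ) (hK : 0 < K) :
    ∃ c > 0, ∀ p : ℕ, 0 < p → ∀ lam : ℝ, lam ∈ Set.Icc (0 : ℝ) K →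
      c * (p : ℝ) ^ (-(1/4 : ℝ)) <
        Metric.infDist lam
          {x : ℝ | ∃ (kk : Fin n → ℕ) (Z : Fin (2*n) → ℝ),
            x = ∑ j, (2 * (kk j : ℝ) + 1) * a j Z + V Z} →
      ∃ δ > 0, ∀ u : (Fin (2*n) → ℝ) → ℂ,
        ContDiff ℝ (⊤ : ℕ∞) u → HasCompactSupport u →
        δ * l2g g u ≤ l2g g fun Z => Hop g A V p u Z - (lam : ℂ) * u Z := by
  have hg : ∀ j l, IsBddC1 fun Z => g Z j l :=
    fun j l => IsBddC1.of_iteratedFDeriv (hg_smooth j l) (hg_bdd j l)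
  have hVB : IsBddC1 V := IsBddC1.of_iteratedFDeriv hV hV_bdd
  have hB : ∀ j l, IsBddC1 fun Z => curvature A Z j l := fun j l =>
    IsBddC1.of_iteratedFDeriv ((contDiff_fderiv_single (hA l) _).sub
      (contDiff_fderiv_single (hA j) _)) (hB_bdd j l)
  obtain ⟨ε, hε, hpos⟩ := hg_pos
  obtain ⟨Cg, hCg0, hCg, -, -⟩ := IsBddC1.exists_common_bound hg
  obtain ⟨c₀, hc₀, hdet⟩ := exists_pos_det_inv_bound (ι := Fin (2*n)) ε Cg hε
  have hdet' := fun Z => hdet (g Z) (hg_symm Z) (hpos Z) fun j => (le_abs_self _).trans (hCg Z j j)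
  have hQ : ∀ j l, IsBddC1 fun Z => (g Z)⁻¹ j l :=
    IsBddC1.matrix_inv hg hc₀ fun Z => (hdet' Z).1
  have hρ : IsBddC1 fun Z => Real.sqrt (g Z).det :=
    (IsBddC1.det hg).sqrt hc₀ fun Z => (hdet' Z).1
  have hc₁ : 0 < Real.sqrt c₀ := Real.sqrt_pos.2 hc₀
  have hρ1 : ∀ Z, Real.sqrt c₀ ≤ Real.sqrt (g Z).det := fun Z => Real.sqrt_le_sqrt (hdet' Z).1
  have hρ0 : ∀ Z, 0 < Real.sqrt (g Z).det := fun Z => hc₁.trans_le (hρ1 Z)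
  obtain ⟨c₂, hc₂⟩ := hρ.bdd
  have hρ2 : ∀ Z, Real.sqrt (g Z).det ≤ c₂ := fun Z => (le_abs_self _).trans (hc₂ Z)
  have hc₂0 : 0 < c₂ := (hρ0 0).trans_le (hρ2 0)
  obtain ⟨CB, hCB0, hCB, hCB', -⟩ := IsBddC1.exists_common_bound hB
  obtain ⟨CQ, hCQ0, hCQ, hCQ', hCQ''⟩ := IsBddC1.exists_common_bound hQ
  obtain ⟨CP, hCP0, -, -, hCP⟩ := IsBddC1.exists_common_bound fun j l => hρ.mul (hQ j l)
  obtain ⟨CV, hCV0, hCV, hCV', -⟩ :=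
    IsBddC1.exists_common_bound (κ := Unit) (F := fun _ _ => V) fun _ _ => hVB
  set CR : ℝ := ((2 * n : ℕ) : ℝ) * ((Real.sqrt c₀)⁻¹ * CP) with hCR
  have hCR0 : 0 ≤ CR := by positivity
  set C₁ : ℝ := CB + Cg + CQ + CR + CV with hC₁
  set R : Fin (2*n) → Fin (2*n) → (Fin (2*n) → ℝ) → ℝ := fun j l Z => (Real.sqrt (g Z).det)⁻¹ *
    fderiv ℝ (fun W => Real.sqrt (g W).det * (g W)⁻¹ j l) Z (Pi.single j 1) with hR
  have hRs : ∀ j l, ContDiff ℝ (⊤ : ℕ∞) (R j l) := fun j l =>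
    (hρ.inv hc₁ hρ1).contDiff.mul (contDiff_fderiv_single (hρ.mul (hQ j l)).contDiff _)
  have hRb : ∀ j l Z, |R j l Z| ≤ (Real.sqrt c₀)⁻¹ * CP := fun j l Z => by
    rw [hR, abs_mul, abs_of_pos (inv_pos.2 (hρ0 Z))]
    exact mul_le_mul (inv_anti₀ hc₁ (hρ1 Z)) (hCP Z j j l) (abs_nonneg _) (by positivity)
  obtain ⟨δ₀, C', hδ₀, hC', hmain⟩ := exists_global_bound n (Fin (2*n)) b₀ (K + CV) ε C₁ c₀ hb₀ hε
    (by positivity) (by positivity) hc₀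
  set Λ₀ : ℝ := ∑ j, (2 * (((0 : Fin n → ℕ) j : ℕ) : ℝ) + 1) * a j 0 + V 0 with hΛ₀
  set T : ℝ := K + |Λ₀| with hT
  have hT0 : 0 < T := by positivity
  set κ : ℝ := b₀ / (T + b₀) with hκ
  have hκ0 : 0 < κ := by positivity
  have hκ1 : κ ≤ 1 := (div_le_one (by positivity)).2 (by linarith)
  have hκT : κ * T ≤ b₀ := by
    rw [hκ, div_mul_eq_mul_div, div_le_iff₀ (by positivity)]
    exact mul_le_mul_of_nonneg_left (by linarith) hb₀.le
  set c : ℝ := C' / κ + C' * T + 1 with hc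
  have hc0 : 0 < c := by positivity
  refine ⟨c, hc0, fun p hp lam hlam hdist => ?_⟩
  set r : ℝ := (p : ℝ) ^ (-(1/4 : ℝ)) with hr
  have hp0 : (0 : ℝ) < p := Nat.cast_pos.2 hp
  have hr0 : 0 < r := Real.rpow_pos_of_pos hp0 _
  have hr1 : r ≤ 1 := Real.rpow_le_one_of_one_le_of_nonpos (Nat.one_le_cast.2 hp) (by norm_num)
  have hph : (p : ℝ) = (r ^ 2)⁻¹ * (r ^ 2)⁻¹ := by
    have h4 : r ^ 4 = (p : ℝ)⁻¹ := by
      rw [hr, ← Real.rpow_natCast, ← Real.rpow_mul hp0.le, ← Real.rpow_neg_one]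
      norm_num
    rw [← mul_inv, ← pow_add, h4, inv_inv]
  have hgap : ∀ (k : Fin n → ℕ) Z,
      c * r < |lam - (∑ j, (2 * (k j : ℝ) + 1) * a j Z + V Z)| := fun k Z =>
    hdist.trans_le (Metric.infDist_le_dist_of_mem ⟨k, Z, rfl⟩)
  have hcr : c * r ≤ T := by
    refine (hgap 0 0).le.trans ((abs_sub _ _).trans (add_le_add ?_ le_rfl))
    rw [abs_of_nonneg hlam.1]
    exact hlam.2
  have hC'r : C' * r ≤ 1 := by
    have h1 : C' * (c * r) ≤ C' * T := mul_le_mul_of_nonneg_left hcr hC'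
    have h2 : C' * T ≤ c := by
      have : 0 ≤ C' / κ := by positivity
      linarith
    have h3 : c * (C' * r) ≤ c * 1 := by linarith
    exact le_of_mul_le_mul_left h3 hc0
  set d : ℝ := κ * (c * r) with hd
  have hd0 : 0 < d := by positivity
  have hdb : d ≤ b₀ := (mul_le_mul_of_nonneg_left hcr hκ0.le).trans hκT
  have hC'd : C' * r ≤ d := by
    have h1 : C' ≤ κ * c := by
      have h2 : κ * (C' / κ) = C' := by field_simp
      have h3 : 0 ≤ κ * (C' * T + 1) := by positivity
      have h4 : κ * c = κ * (C' / κ) + κ * (C' * T + 1) := by rw [hc]; ring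
      linarith
    rw [hd, ← mul_assoc]
    exact mul_le_mul_of_nonneg_right h1 hr0.le
  have hb : ∀ l, ContDiff ℝ (⊤ : ℕ∞)
      fun Z => ∑ j, Complex.I * ((r ^ 2 : ℝ) : ℂ) * ((R j l Z : ℝ) : ℂ) := fun l =>
    ContDiff.sum fun j _ => contDiff_const.mul (hRs j l).complex_ofReal
  have hbb : ∀ Z l, ‖∑ j, Complex.I * ((r ^ 2 : ℝ) : ℂ) * ((R j l Z : ℝ) : ℂ)‖ ≤
      C₁ * r ^ 2 := fun Z l => by
    have h1 : ∀ j, ‖Complex.I * ((r ^ 2 : ℝ) : ℂ) * ((R j l Z : ℝ) : ℂ)‖ ≤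
        r ^ 2 * ((Real.sqrt c₀)⁻¹ * CP) := fun j => by
      rw [norm_mul, norm_mul, Complex.norm_I, one_mul, Complex.norm_real, Complex.norm_real,
        Real.norm_of_nonneg (sq_nonneg r)]
      exact mul_le_mul_of_nonneg_left (hRb j l Z) (sq_nonneg r)
    refine (norm_sum_le _ _).trans ((Finset.sum_le_sum fun j _ => h1 j).trans ?_)
    rw [Finset.sum_const, Finset.card_univ, Fintype.card_fin, nsmul_eq_mul]
    have h2 : CR * r ^ 2 ≤ C₁ * r ^ 2 := mul_le_mul_of_nonneg_right (by linarith) (sq_nonneg r)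
    rw [hCR] at h2
    linarith
  have hfinal := hmain A hA (fun j l Z => (g Z)⁻¹ j l) (fun j l => (hQ j l).contDiff)
    (fun l Z => ∑ j, Complex.I * ((r ^ 2 : ℝ) : ℂ) * ((R j l Z : ℝ) : ℂ)) hb V hV g a (r ^ 2) r
    (fun Z j k => (hCB Z j k).trans (by linarith))
    (fun Z y j k => (hCB' Z y j k).trans
      (mul_le_mul_of_nonneg_right (by linarith) (norm_nonneg _)))
    hg_symm hpos (fun Z j => (le_abs_self _).trans ((hCg Z j j).trans (by linarith))) ha_lb hchar
    (fun _ _ _ => rfl) (fun Z => (hdet' Z).2) (fun Z j l => (hCQ Z j l).trans (by linarith))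
    (fun Z y j l => (hCQ' Z y j l).trans
      (mul_le_mul_of_nonneg_right (by linarith) (norm_nonneg _)))
    (fun Z i j l => by
      rw [fderiv_complex_ofReal_apply ((hQ j l).differentiableAt Z), Complex.norm_real]
      exact (hCQ'' Z i j l).trans (by linarith)) hbb
    (fun Z y => (hCV' Z y () ()).trans
      (mul_le_mul_of_nonneg_right (by linarith) (norm_nonneg _)))
    hr0 hr1 rfl hC'r d lam hd0 hdb hC'd
    (fun Z => (abs_sub _ _).trans (by
      rw [abs_of_nonneg hlam.1]
      have := hCV Z () ()
      linarith [hlam.2]))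
    (fun Z k => (mul_le_of_le_one_left (by positivity) hκ1).trans (hgap k Z).le)
  refine ⟨δ₀ * d * (Real.sqrt (Real.sqrt c₀) / Real.sqrt c₂), by positivity, fun u hu huc => ?_⟩
  set w := TestFn.mk u hu huc with hw
  set f := varOp (r ^ 2) A hA (fun j l Z => (g Z)⁻¹ j l) (fun j l => (hQ j l).contDiff)
    (fun l Z => ∑ j, Complex.I * ((r ^ 2 : ℝ) : ℂ) * ((R j l Z : ℝ) : ℂ)) hb V hV w -
      (lam : ℂ) • w with hf
  have hfun : (fun Z => Hop g A V p u Z - (lam : ℂ) * u Z) = ⇑f := by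
    funext Z
    rw [hf, TestFn.sub_apply, TestFn.smul_apply, ← Hop_eq_varOp (by positivity) hph A hA g
      hρ.contDiff hρ0 _ _ hb (fun _ _ => rfl) V hV w Z]
    rfl
  have h1 := (l2g_bounds g hρ.contDiff.continuous hc₁.le hc₂0.le hρ1 hρ2 w).2
  have h2 := (l2g_bounds g hρ.contDiff.continuous hc₁.le hc₂0.le hρ1 hρ2 f).1
  have hs : 0 < Real.sqrt c₂ := Real.sqrt_pos.2 hc₂0
  rw [hfun]
  calc _ ≤ δ₀ * d * (Real.sqrt (Real.sqrt c₀) / Real.sqrt c₂) * (Real.sqrt c₂ * ‖w‖) :=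
        mul_le_mul_of_nonneg_left h1 (by positivity)
    _ = Real.sqrt (Real.sqrt c₀) * (δ₀ * d * ‖w‖) := by field_simp
    _ ≤ Real.sqrt (Real.sqrt c₀) * ‖f‖ :=
        mul_le_mul_of_nonneg_left (hfinal w) (Real.sqrt_nonneg _)
    _ ≤ _ := h2
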